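/- arXiv:1205.6387 — 2 statements merged into one kernel-verified Lean document; each statement's English description precedes it below -/
import Mathlib

section
/- Let M be a matroid on a finite ground set E, with rank function r (where r(A) is the size of a maximal independent subset of A ⊆ E). Then the polynomial identity Σ_{A ⊆ E} (−1)^{r(E) − r(A)} (t − 1)^{|A| − r(A)} = t^{|E| − r(E)} holds in ℤ[t] (i.e. the Tutte polynomial satisfies T(M; 0, t) = t^{|E| − r(E)}) if and only if E can be partitioned into circuits C₁, …, C_l of M with r(E) = Σ_k (|C_k| − 1), i.e. if and only if M is a direct sum of circuits. -/
open scoped BigOperators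

noncomputable section

/-- The rank of a subset `A` in a matroid `M`: the size of a maximal independent subset
of `A`. -/
def matroidRank {α : Type} (M : Matroid α) (A : Set α) : ℕ :=
  sSup {k : ℕ | ∃ I ⊆ A, M.Indep I ∧ I.ncard = k}

/-- A circuit of a matroid: a minimal dependent set. -/
def IsMatroidCircuit {α : Type} (M : Matroid α) (C : Set α) : Prop :=
  ¬ M.Indep C ∧ ∀ D : Set α, D ⊂ C → M.Indep D

lemma mr_cast {α : Type} [Fintype α] (M : Matroid α) (A : Set α) :
    (matroidRank M A : ℕ∞) = M.eRk A := by
  obtain ⟨I, hI⟩ := M.exists_isBasis' A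
  rw [← hI.encard_eq_eRk, ← Set.Finite.cast_ncard_eq (Set.toFinite I)]
  congr 1
  apply IsGreatest.csSup_eq
  refine ⟨⟨I, hI.subset, hI.indep, rfl⟩, ?_⟩
  rintro k ⟨J, hJA, hJ, rfl⟩
  have := hJ.encard_le_eRk_of_subset hJA
  rw [← hI.encard_eq_eRk, ← Set.Finite.cast_ncard_eq (Set.toFinite I),
    ← Set.Finite.cast_ncard_eq (Set.toFinite J)] at this
  exact_mod_cast this

lemma mr_dual {α : Type} [Fintype α] [DecidableEq α] (M : Matroid α) (hE : M.E = Set.univ)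
    (B : Finset α) :
    matroidRank M✶ ↑B + matroidRank M Set.univ = matroidRank M ↑(Bᶜ) + B.card := by
  have h := M.eRk_dual_add_eRank (B : Set α) (by rw [hE]; exact Set.subset_univ _)
  rw [← M.eRk_univ_eq, ← mr_cast, ← mr_cast, ← mr_cast, Set.encard_coe_eq_coe_finsetCard, hE,
    ← Set.compl_eq_univ_sdiff, ← Finset.coe_compl] at h
  exact_mod_cast h

lemma mr_le_card {α : Type} [Fintype α] (M : Matroid α) (B : Finset α) :
    matroidRank M ↑B ≤ B.card := by
  have h := M.eRk_le_encard (B : Set α)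
  rw [← mr_cast, Set.encard_coe_eq_coe_finsetCard] at h
  exact_mod_cast h

lemma mr_mono {α : Type} [Fintype α] (M : Matroid α) {A B : Set α} (h : A ⊆ B) :
    matroidRank M A ≤ matroidRank M B := by
  have h := M.eRk_mono h
  rw [← mr_cast, ← mr_cast] at h
  exact_mod_cast h

lemma mr_dual_univ {α : Type} [Fintype α] [DecidableEq α] (M : Matroid α) (hE : M.E = Set.univ) :
    matroidRank M✶ Set.univ + matroidRank M Set.univ = Fintype.card α := by
  have h := mr_dual M hE Finset.univ
  have h2 := mr_le_card M (∅ : Finset α)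
  simp at h h2
  omega

/-- the sum rewritten through the dual rank -/
lemma sum_dual {α : Type} [Fintype α] [DecidableEq α] (M : Matroid α) (hE : M.E = Set.univ) :
    (∑ A : Finset α,
        (-1 : Polynomial ℤ) ^ (matroidRank M Set.univ - matroidRank M ↑A) *
          (Polynomial.X - 1) ^ (A.card - matroidRank M ↑A))
    = ∑ B : Finset α, (-1 : Polynomial ℤ) ^ (B.card - matroidRank M✶ ↑B) *
          (Polynomial.X - 1) ^ (matroidRank M✶ Set.univ - matroidRank M✶ ↑B) := by
  refine Fintype.sum_equiv (Equiv.ofBijective compl compl_bijective) _ _ ?_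
  intro A
  simp only [Equiv.ofBijective_apply]
  have h1 := mr_dual M hE Aᶜ
  have h2 := mr_dual_univ M hE
  have h3 := mr_le_card M A
  have h4 := mr_le_card M✶ Aᶜ
  have h5 := mr_mono M (Set.subset_univ (A : Set α))
  have h6 := mr_mono M✶ (Set.subset_univ ((Aᶜ : Finset α) : Set α))
  have h7 := Finset.card_add_card_compl A
  rw [compl_compl] at h1
  congr 2 <;> omega

lemma coeff_top (n k : ℕ) (hk : k ≤ n) :
    ((Polynomial.X - 1 : Polynomial ℤ) ^ (n - k)).coeff n = if k = 0 then 1 else 0 := by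
  have := Polynomial.coeff_X_add_C_pow (-1 : ℤ) (n - k) n
  simp only [map_neg, map_one, ← sub_eq_add_neg] at this
  rw [this]
  split_ifs with h
  · subst h; simp
  · rw [Nat.choose_eq_zero_of_lt (by omega)]; simp

lemma coeff_next (n k : ℕ) (hk : k ≤ n) (hn : 1 ≤ n) :
    ((Polynomial.X - 1 : Polynomial ℤ) ^ (n - k)).coeff (n - 1) =
      if k = 0 then -(n : ℤ) else if k = 1 then 1 else 0 := by
  have := Polynomial.coeff_X_add_C_pow (-1 : ℤ) (n - k) (n - 1)
  simp only [map_neg, map_one, ← sub_eq_add_neg] at this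
  rw [this]
  split_ifs with h h'
  · subst h
    obtain ⟨m, rfl⟩ : ∃ m, n = m + 1 := ⟨n - 1, by omega⟩
    simp
  · subst h'; simp
  · rw [Nat.choose_eq_zero_of_lt (by omega)]; simp

lemma coeff_neg_one_pow_mul (a : ℕ) (p : Polynomial ℤ) (m : ℕ) :
    ((-1 : Polynomial ℤ) ^ a * p).coeff m = (-1) ^ a * p.coeff m := by
  have : (-1 : Polynomial ℤ) ^ a = Polynomial.C ((-1) ^ a) := by simp
  rw [this, Polynomial.coeff_C_mul]

/-- the top coefficient forces looplessness -/
lemma loopless_of_sum {α : Type} [Fintype α] [DecidableEq α] (N : Matroid α)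
    (hE : N.E = Set.univ)
    (h : (∑ B : Finset α, (-1 : Polynomial ℤ) ^ (B.card - matroidRank N ↑B) *
          (Polynomial.X - 1) ^ (matroidRank N Set.univ - matroidRank N ↑B))
      = Polynomial.X ^ (matroidRank N Set.univ)) (e : α) : N.IsNonloop e := by
  classical
  have hc := congrArg (fun p => p.coeff (matroidRank N Set.univ)) h
  simp only [Polynomial.finsetSum_coeff, coeff_neg_one_pow_mul, Polynomial.coeff_X_pow_self] at hc
  by_contra hne
  have hl : e ∈ N.loops := by
    have : e ∈ N.E := by rw [hE]; trivial
    rcases N.isLoop_or_isNonloop e with h | h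
    · exact h
    · exact absurd h hne
  have hz : ∀ B : Finset α, matroidRank N ↑B = 0 ↔ B ⊆ Finset.univ.filter (· ∈ N.loops) := by
    intro B
    have : matroidRank N ↑B = 0 ↔ N.eRk (B : Set α) = 0 := by
      rw [← mr_cast]; norm_cast
    rw [this, Matroid.eRk_eq_zero_iff (by rw [hE]; exact Set.subset_univ _)]
    simp [Finset.subset_iff, Set.subset_def]
  have : ∀ B : Finset α, (-1 : ℤ) ^ (B.card - matroidRank N ↑B) *
      ((Polynomial.X - 1 : Polynomial ℤ) ^
        (matroidRank N Set.univ - matroidRank N ↑B)).coeff (matroidRank N Set.univ) =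
      if B ⊆ Finset.univ.filter (· ∈ N.loops) then (-1) ^ B.card else 0 := by
    intro B
    rw [coeff_top _ _ (mr_mono N (Set.subset_univ _))]
    by_cases hB : matroidRank N ↑B = 0
    · rw [if_pos hB, if_pos ((hz B).1 hB), hB]; simp
    · rw [if_neg hB, if_neg (fun h => hB ((hz B).2 h))]; simp
  rw [Finset.sum_congr rfl (fun B _ => this B), ← Finset.sum_filter] at hc
  have hf : (Finset.univ.filter (fun B : Finset α => B ⊆ Finset.univ.filter (· ∈ N.loops))) =
      (Finset.univ.filter (· ∈ N.loops)).powerset := by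
    ext; simp
  rw [hf, Finset.sum_powerset_neg_one_pow_card_of_nonempty ⟨e, by simpa using hl⟩] at hc
  exact absurd hc (by norm_num)

open Classical in
/-- parallel class of an element -/
def pcls {α : Type} [Fintype α] (N : Matroid α) (e : α) : Finset α :=
  Finset.univ.filter (· ∈ N.closure {e})

open Classical in
/-- the set of all parallel classes -/
def pclasses {α : Type} [Fintype α] (N : Matroid α) : Finset (Finset α) :=
  Finset.univ.image (pcls N)

lemma sum_nonempty_subsets {α : Type} [DecidableEq α] {P : Finset α} (hP : P.Nonempty) :
    ∑ B ∈ P.powerset.filter (·.Nonempty), (-1 : ℤ) ^ (B.card - 1) = 1 := by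
  have h := Finset.sum_powerset_neg_one_pow_card_of_nonempty hP
  rw [← Finset.sum_filter_add_sum_filter_not _ (·.Nonempty)] at h
  have h1 : P.powerset.filter (fun B => ¬ B.Nonempty) = {∅} := by
    ext B
    simp only [Finset.mem_filter, Finset.mem_powerset, Finset.not_nonempty_iff_eq_empty,
      Finset.mem_singleton]
    constructor
    · exact fun h => h.2
    · rintro rfl; simp
  have h2 : ∑ B ∈ P.powerset.filter (·.Nonempty), (-1 : ℤ) ^ B.card =
      - ∑ B ∈ P.powerset.filter (·.Nonempty), (-1 : ℤ) ^ (B.card - 1) := by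
    rw [← Finset.sum_neg_distrib]
    refine Finset.sum_congr rfl fun B hB => ?_
    have : 1 ≤ B.card := (Finset.mem_filter.1 hB).2.card_pos
    obtain ⟨m, hm⟩ : ∃ m, B.card = m + 1 := ⟨B.card - 1, by omega⟩
    rw [hm]; simp [pow_succ]
  rw [h1, h2] at h
  simp at h
  linarith

section
variable {α : Type} [Fintype α] (N : Matroid α)

lemma mem_pcls {e f : α} : f ∈ pcls N e ↔ f ∈ N.closure {e} := by simp [pcls]

lemma mem_pclasses {P : Finset α} : P ∈ pclasses N ↔ ∃ e, pcls N e = P := by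
  classical
  simp [pclasses]

lemma mem_pcls_self (hl : ∀ e, N.IsNonloop e) (e : α) : e ∈ pcls N e := by
  rw [mem_pcls]
  exact N.mem_closure_of_mem' rfl (hl e).mem_ground

lemma pcls_eq (hl : ∀ e, N.IsNonloop e) {e f : α} (h : f ∈ pcls N e) : pcls N f = pcls N e := by
  rw [mem_pcls] at h
  unfold pcls
  rw [(hl f).closure_eq_of_mem_closure h]

lemma eq_pcls_of_mem (hl : ∀ e, N.IsNonloop e) {P : Finset α} (hP : P ∈ pclasses N) {e : α}
    (he : e ∈ P) : P = pcls N e := by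
  obtain ⟨f, rfl⟩ := (mem_pclasses N).1 hP
  exact (pcls_eq N hl he).symm

lemma pcls_mem (e : α) : pcls N e ∈ pclasses N := (mem_pclasses N).2 ⟨e, rfl⟩

lemma pclasses_nonempty (hl : ∀ e, N.IsNonloop e) {P : Finset α} (hP : P ∈ pclasses N) :
    P.Nonempty := by
  obtain ⟨f, rfl⟩ := (mem_pclasses N).1 hP
  exact ⟨f, mem_pcls_self N hl f⟩

lemma pclasses_disj (hl : ∀ e, N.IsNonloop e) {P Q : Finset α} (hP : P ∈ pclasses N)
    (hQ : Q ∈ pclasses N) (h : P ≠ Q) : Disjoint P Q := by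
  rw [Finset.disjoint_left]
  intro e he he'
  exact h ((eq_pcls_of_mem N hl hP he).trans (eq_pcls_of_mem N hl hQ he').symm)

lemma mr_one_iff (hE : N.E = Set.univ) (hl : ∀ e, N.IsNonloop e) (B : Finset α) :
    matroidRank N ↑B = 1 ↔ ∃ P ∈ pclasses N, B ⊆ P ∧ B.Nonempty := by
  have : matroidRank N ↑B = 1 ↔ N.eRk (B : Set α) = 1 := by
    rw [← mr_cast]; norm_cast
  rw [this, Matroid.eRk_eq_one_iff (by rw [hE]; exact Set.subset_univ _)]
  constructor
  · rintro ⟨e, he, -, hB⟩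
    exact ⟨pcls N e, pcls_mem N e, fun x hx => (mem_pcls N).2 (hB hx), ⟨e, he⟩⟩
  · rintro ⟨P, hP, hBP, e, he⟩
    refine ⟨e, he, hl e, fun x hx => (mem_pcls N).1 ?_⟩
    rw [← eq_pcls_of_mem N hl hP (hBP he)]
    exact hBP hx

lemma mr_zero_iff (hE : N.E = Set.univ) (hl : ∀ e, N.IsNonloop e) (B : Finset α) :
    matroidRank N ↑B = 0 ↔ B = ∅ := by
  have : matroidRank N ↑B = 0 ↔ N.eRk (B : Set α) = 0 := by
    rw [← mr_cast]; norm_cast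
  rw [this, Matroid.eRk_eq_zero_iff (by rw [hE]; exact Set.subset_univ _)]
  constructor
  · intro h
    rw [Finset.eq_empty_iff_forall_notMem]
    intro x hx
    exact (hl x).not_isLoop (h hx)
  · rintro rfl; simp

lemma card_pclasses [DecidableEq α] (hE : N.E = Set.univ) (hl : ∀ e, N.IsNonloop e)
    (h : (∑ B : Finset α, (-1 : Polynomial ℤ) ^ (B.card - matroidRank N ↑B) *
          (Polynomial.X - 1) ^ (matroidRank N Set.univ - matroidRank N ↑B))
      = Polynomial.X ^ (matroidRank N Set.univ)) :
    (pclasses N).card = matroidRank N Set.univ := by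
  rcases Nat.eq_zero_or_pos (matroidRank N Set.univ) with h0 | hpos
  · have h1 := (mr_zero_iff N hE hl Finset.univ).1 (by simpa using h0)
    rw [h0, pclasses, h1]; simp
  have hc := congrArg (fun p => p.coeff (matroidRank N Set.univ - 1)) h
  simp only [Polynomial.finsetSum_coeff, coeff_neg_one_pow_mul, Polynomial.coeff_X_pow] at hc
  rw [if_neg (by omega)] at hc
  have : ∀ B : Finset α, (-1 : ℤ) ^ (B.card - matroidRank N ↑B) *
      ((Polynomial.X - 1 : Polynomial ℤ) ^
        (matroidRank N Set.univ - matroidRank N ↑B)).coeff (matroidRank N Set.univ - 1) =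
      (if B = ∅ then -(matroidRank N Set.univ : ℤ) else 0) +
      if matroidRank N ↑B = 1 then (-1) ^ (B.card - 1) else 0 := by
    intro B
    rw [coeff_next _ _ (mr_mono N (Set.subset_univ _)) hpos]
    by_cases hB : matroidRank N ↑B = 0
    · have hB' := (mr_zero_iff N hE hl B).1 hB
      rw [if_pos hB, if_pos hB', hB, hB']; simp
    · rw [if_neg hB, if_neg (fun h => hB ((mr_zero_iff N hE hl B).2 h))]
      by_cases h1 : matroidRank N ↑B = 1
      · simp [h1]
      · simp [h1]
  rw [Finset.sum_congr rfl (fun B _ => this B), Finset.sum_add_distrib, Finset.sum_ite_eq',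
    if_pos (Finset.mem_univ _), ← Finset.sum_filter] at hc
  have hf : (Finset.univ.filter (fun B : Finset α => matroidRank N ↑B = 1)) =
      (pclasses N).biUnion (fun P => P.powerset.filter (·.Nonempty)) := by
    ext B
    simp [mr_one_iff N hE hl]
  rw [hf, Finset.sum_biUnion, Finset.sum_congr rfl
    (fun P hP => sum_nonempty_subsets (pclasses_nonempty N hl hP))] at hc
  · simp at hc
    have : ((pclasses N).card : ℤ) = matroidRank N Set.univ := by linarith
    exact_mod_cast this
  · intro P hP Q hQ hPQ
    rw [Function.onFun, Finset.disjoint_left]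
    intro B hB hB'
    simp only [Finset.mem_filter, Finset.mem_powerset] at hB hB'
    obtain ⟨x, hx⟩ := hB.2
    exact Finset.disjoint_left.1 (pclasses_disj N hl hP hQ hPQ) (hB.1 hx) (hB'.1 hx)
end

lemma circuit_of_pclass {α : Type} [Fintype α] [DecidableEq α] (M : Matroid α)
    (hE : M.E = Set.univ) (hl : ∀ e, M✶.IsNonloop e)
    (hc : (pclasses M✶).card = matroidRank M✶ Set.univ) {P : Finset α} (hP : P ∈ pclasses M✶) :
    IsMatroidCircuit M ↑P := by
  have hE' : M✶.E = Set.univ := by simpa using hE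
  have : Nonempty α := ⟨(pclasses_nonempty M✶ hl hP).choose⟩
  constructor
  · intro hI
    have hs : M✶.Spanning ((P : Set α)ᶜ) := by
      have := (M✶.coindep_iff_compl_spanning (I := (P : Set α))
        (by rw [hE']; exact Set.subset_univ _)).1 (by simpa [Matroid.Coindep] using hI)
      rwa [hE', ← Set.compl_eq_univ_sdiff] at this
    choose! s hs' using fun (Q : Finset α) (hQ : Q ∈ pclasses M✶) => pclasses_nonempty M✶ hl hQ
    set T : Finset α := ((pclasses M✶).erase P).image s with hT
    have hsub : ((P : Set α)ᶜ) ⊆ M✶.closure T := by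
      intro x hx
      have hxP : pcls M✶ x ≠ P := by
        rintro rfl; exact hx (mem_pcls_self M✶ hl x)
      have h1 : s (pcls M✶ x) ∈ T :=
        Finset.mem_image.2 ⟨_, Finset.mem_erase.2 ⟨hxP, pcls_mem _ x⟩, rfl⟩
      have h2 := hs' _ (pcls_mem M✶ x)
      have h3 : x ∈ pcls M✶ (s (pcls M✶ x)) := by
        rw [pcls_eq M✶ hl h2]; exact mem_pcls_self M✶ hl x
      exact M✶.closure_subset_closure (Set.singleton_subset_iff.2 h1) ((mem_pcls _).1 h3)
    have h1 : M✶.eRank ≤ M✶.eRk T := by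
      rw [← hs.eRk_eq, ← M✶.eRk_closure_eq T]
      exact M✶.eRk_mono hsub
    rw [← M✶.eRk_univ_eq, ← mr_cast, ← mr_cast] at h1
    have h2 : matroidRank M✶ Set.univ ≤ matroidRank M✶ ↑T := by exact_mod_cast h1
    have h3 := mr_le_card M✶ T
    have h4 : T.card ≤ _ := Finset.card_image_le
    rw [Finset.card_erase_of_mem hP] at h4
    have h5 : 0 < (pclasses M✶).card := Finset.card_pos.2 ⟨P, hP⟩
    omega
  · intro D hD
    obtain ⟨hDP, e, heP, heD⟩ := Set.ssubset_iff_exists.1 hD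
    have hex : ∀ Q ∈ pclasses M✶, ∃ x, x ∈ Q ∧ (Q = P → x = e) := by
      intro Q hQ
      by_cases h : Q = P
      · exact ⟨e, h ▸ heP, fun _ => rfl⟩
      · obtain ⟨x, hx⟩ := pclasses_nonempty M✶ hl hQ
        exact ⟨x, hx, fun h' => absurd h' h⟩
    choose! s hs' hse using hex
    set T : Finset α := (pclasses M✶).image s with hT
    have hsp : M✶.Spanning (T : Set α) := by
      rw [Matroid.spanning_iff_ground_subset_closure (by rw [hE']; exact Set.subset_univ _)]
      intro x _
      have h1 : s (pcls M✶ x) ∈ T := Finset.mem_image.2 ⟨_, pcls_mem _ x, rfl⟩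
      have h2 := hs' _ (pcls_mem M✶ x)
      have h3 : x ∈ pcls M✶ (s (pcls M✶ x)) := by
        rw [pcls_eq M✶ hl h2]; exact mem_pcls_self M✶ hl x
      exact M✶.closure_subset_closure (Set.singleton_subset_iff.2 h1) ((mem_pcls _).1 h3)
    have hind := hsp.compl_coindep
    rw [Matroid.Coindep, Matroid.dual_dual, hE'] at hind
    refine hind.subset fun x hx => ⟨trivial, fun hxT => ?_⟩
    obtain ⟨Q, hQ, rfl⟩ := Finset.mem_image.1 (Finset.mem_coe.1 hxT)
    have : Q = P := by
      rw [eq_pcls_of_mem M✶ hl hQ (hs' Q hQ), ← eq_pcls_of_mem M✶ hl hP (hDP hx)]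
    rw [hse Q hQ this] at hx
    exact heD hx

lemma forward_dir {α : Type} [Fintype α] [DecidableEq α] (M : Matroid α)
    (hE : M.E = Set.univ)
    (h : (∑ A : Finset α,
        (-1 : Polynomial ℤ) ^ (matroidRank M Set.univ - matroidRank M ↑A) *
          (Polynomial.X - 1) ^ (A.card - matroidRank M ↑A))
      = Polynomial.X ^ (Fintype.card α - matroidRank M Set.univ)) :
    ∃ (l : ℕ) (C : Fin l → Finset α),
      (∀ k, IsMatroidCircuit M ↑(C k)) ∧
      (∀ k k', k ≠ k' → Disjoint (C k) (C k')) ∧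
      (∀ x : α, ∃ k, x ∈ C k) ∧
      matroidRank M Set.univ = ∑ k, ((C k).card - 1) := by
  have hE' : M✶.E = Set.univ := by simpa using hE
  have hu := mr_dual_univ M hE
  rw [sum_dual M hE, show Fintype.card α - matroidRank M Set.univ = matroidRank M✶ Set.univ by
    omega] at h
  have hl := loopless_of_sum M✶ hE' h
  have hc := card_pclasses M✶ hE' hl h
  have hdisj : ∀ k k', k ≠ k' → Disjoint ((pclasses M✶).equivFin.symm k).1
      ((pclasses M✶).equivFin.symm k').1 := by
    intro k k' hkk
    refine pclasses_disj M✶ hl (Subtype.prop _) (Subtype.prop _) fun heq => hkk ?_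
    exact (pclasses M✶).equivFin.symm.injective (Subtype.ext heq)
  have hcov : ∀ x : α, ∃ k, x ∈ ((pclasses M✶).equivFin.symm k).1 := by
    intro x
    refine ⟨(pclasses M✶).equivFin ⟨_, pcls_mem M✶ x⟩, ?_⟩
    simpa using mem_pcls_self M✶ hl x
  refine ⟨(pclasses M✶).card, fun k => ((pclasses M✶).equivFin.symm k).1, ?_, hdisj, hcov, ?_⟩
  · intro k
    exact circuit_of_pclass M hE hl hc (Subtype.prop _)
  · have h1 : ∑ k, (((pclasses M✶).equivFin.symm k).1).card = Fintype.card α := by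
      rw [← Finset.card_biUnion (fun k _ k' _ => hdisj k k'), ← Finset.card_univ]
      congr 1
      ext x
      simpa using hcov x
    have h2 : ∑ k, (((pclasses M✶).equivFin.symm k).1).card =
        ∑ k, ((((pclasses M✶).equivFin.symm k).1).card - 1) + ∑ k : Fin (pclasses M✶).card, 1 := by
      rw [← Finset.sum_add_distrib]
      refine Finset.sum_congr rfl fun k _ => ?_
      have := (pclasses_nonempty M✶ hl (Subtype.prop ((pclasses M✶).equivFin.symm k))).card_pos
      omega
    simp only [Finset.sum_const, Finset.card_univ, Fintype.card_fin, smul_eq_mul, mul_one] at h2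
    show _ = ∑ k, ((((pclasses M✶).equivFin.symm k).1).card - 1)
    omega

section
variable {α : Type} [Fintype α] [DecidableEq α] (M : Matroid α) (hE : M.E = Set.univ)
  {l : ℕ} {C : Fin l → Finset α}

lemma sum_card_inter (hd : ∀ k k', k ≠ k' → Disjoint (C k) (C k')) (hcov : ∀ x : α, ∃ k, x ∈ C k)
    (B : Finset α) : ∑ k, (C k ∩ B).card = B.card := by
  rw [← Finset.card_biUnion]
  · congr 1
    ext x
    simpa using fun _ => hcov x
  · intro k _ k' _ h
    exact (hd k k' h).mono Finset.inter_subset_left Finset.inter_subset_left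

lemma rank_add (hcirc : ∀ k, IsMatroidCircuit M ↑(C k))
    (hd : ∀ k k', k ≠ k' → Disjoint (C k) (C k')) (hcov : ∀ x : α, ∃ k, x ∈ C k)
    (hr : matroidRank M Set.univ = ∑ k, ((C k).card - 1)) :
    matroidRank M Set.univ + l = Fintype.card α := by
  have h := sum_card_inter hd hcov Finset.univ
  simp only [Finset.inter_univ, Finset.card_univ] at h
  have h2 : ∑ k, (C k).card = ∑ k, ((C k).card - 1) + ∑ k : Fin l, 1 := by
    rw [← Finset.sum_add_distrib]
    refine Finset.sum_congr rfl fun k _ => ?_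
    have : (C k).Nonempty := by
      rw [Finset.nonempty_iff_ne_empty]
      intro h0
      have := (hcirc k).1
      rw [h0] at this
      simp at this
    have := this.card_pos
    omega
  simp only [Finset.sum_const, Finset.card_univ, Fintype.card_fin, smul_eq_mul, mul_one] at h2
  omega

lemma indep_of_no_circuit (hE : M.E = Set.univ) (hcirc : ∀ k, IsMatroidCircuit M ↑(C k))
    (hd : ∀ k k', k ≠ k' → Disjoint (C k) (C k')) (hr : matroidRank M Set.univ + l = Fintype.card α)
    (X : Finset α) (hX : ∀ k, ¬ C k ⊆ X) : M.Indep (X : Set α) := by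
  choose e he heX using fun k => Finset.not_subset.1 (hX k)
  have hinj : Function.Injective e := by
    intro k k' h
    by_contra hne
    exact Finset.disjoint_left.1 (hd k k' hne) (he k) (h ▸ he k')
  set T : Finset α := Finset.univ.image e with hT
  have hTc : T.card = l := by
    rw [hT, Finset.card_image_of_injective _ hinj]; simp
  have hspan : M.Spanning ((Tᶜ : Finset α) : Set α) := by
    rw [Matroid.spanning_iff_ground_subset_closure (by rw [hE]; exact Set.subset_univ _)]
    intro x _
    by_cases hx : x ∈ T
    · obtain ⟨k, -, rfl⟩ := Finset.mem_image.1 hx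
      have hck : M.IsCircuit (C k : Set α) := by
        rw [Matroid.isCircuit_iff_forall_ssubset]
        exact ⟨⟨(hcirc k).1, by rw [hE]; exact Set.subset_univ _⟩, fun D hD => (hcirc k).2 D hD⟩
      refine M.closure_subset_closure ?_
        (hck.mem_closure_sdiff_singleton_of_mem (Finset.mem_coe.2 (he k)))
      rintro y ⟨hy, hyk⟩
      rw [Finset.coe_compl]
      intro hyT
      obtain ⟨k', -, rfl⟩ := Finset.mem_image.1 (Finset.mem_coe.1 hyT)
      have : k' ≠ k := by rintro rfl; exact hyk rfl
      exact Finset.disjoint_left.1 (hd k' k this) (he k') hy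
    · exact M.mem_closure_of_mem' (by simpa using hx) (by rw [hE]; trivial)
  have hind : M.Indep ((Tᶜ : Finset α) : Set α) := by
    rw [Matroid.indep_iff_eRk_eq_encard_of_finite (Set.toFinite _), hspan.eRk_eq,
      ← M.eRk_univ_eq, ← mr_cast, Set.encard_coe_eq_coe_finsetCard]
    have := Finset.card_add_card_compl T
    have : matroidRank M Set.univ = Tᶜ.card := by omega
    rw [this]
  refine hind.subset fun x hx => ?_
  rw [Finset.coe_compl]
  intro hxT
  obtain ⟨k, -, rfl⟩ := Finset.mem_image.1 (Finset.mem_coe.1 hxT)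
  exact heX k hx

lemma rank_eq (hE : M.E = Set.univ) (hcirc : ∀ k, IsMatroidCircuit M ↑(C k))
    (hd : ∀ k k', k ≠ k' → Disjoint (C k) (C k')) (hr : matroidRank M Set.univ + l = Fintype.card α)
    (A : Finset α) :
    matroidRank M ↑A + (Finset.univ.filter (fun k => C k ⊆ A)).card = A.card := by
  have key : ∀ I : Finset α, M.Indep (I : Set α) → ∀ k, ∃ x, x ∈ C k ∧ x ∉ I := by
    intro I hI k
    by_contra! h
    exact (hcirc k).1 (hI.subset h)
  apply le_antisymm
  · obtain ⟨I, hI⟩ := M.exists_isBasis' (A : Set α)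
    lift I to Finset α using Set.toFinite I
    have hIr := hI.encard_eq_eRk
    rw [← mr_cast, Set.encard_coe_eq_coe_finsetCard] at hIr
    have hIr' : I.card = matroidRank M ↑A := by exact_mod_cast hIr
    choose e he heI using key I hI.indep
    have hinj : Function.Injective e := by
      intro k k' h
      by_contra hne
      exact Finset.disjoint_left.1 (hd k k' hne) (he k) (h ▸ he k')
    have hIA : I ⊆ A := by exact_mod_cast hI.subset
    have h1 : ((Finset.univ.filter (fun k => C k ⊆ A)).image e).card ≤ (A \ I).card := by
      apply Finset.card_le_card
      intro x hx
      obtain ⟨k, hk, rfl⟩ := Finset.mem_image.1 hx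
      exact Finset.mem_sdiff.2 ⟨(Finset.mem_filter.1 hk).2 (he k), heI k⟩
    rw [Finset.card_image_of_injective _ hinj, Finset.card_sdiff_of_subset hIA] at h1
    have := Finset.card_le_card hIA
    omega
  · choose c hc _ using key ∅ (by simp)
    set S := (Finset.univ.filter (fun k => C k ⊆ A)) with hS
    have hind := indep_of_no_circuit M hE hcirc hd hr (A \ S.image c) (by
      intro k hk
      have h1 := Finset.mem_sdiff.1 (hk (hc k))
      refine h1.2 (Finset.mem_image.2 ⟨k, ?_, rfl⟩)
      simp [hS, hk.trans Finset.sdiff_subset])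
    have h1 := hind.encard_le_eRk_of_subset (X := (A : Set α))
      (by exact_mod_cast Finset.sdiff_subset)
    rw [← mr_cast, Set.encard_coe_eq_coe_finsetCard] at h1
    have h2 : (A \ S.image c).card ≤ matroidRank M ↑A := by exact_mod_cast h1
    have h3 := Finset.le_card_sdiff (S.image c) A
    have h4 : (S.image c).card ≤ S.card := Finset.card_image_le
    omega

/-- local factor -/
def gfac (D S : Finset α) : Polynomial ℤ :=
  (-1) ^ (D \ S).card * (if D ⊆ S then Polynomial.X - 1 else -1)

lemma sum_gfac (D : Finset α) (hD : D.Nonempty) :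
    ∑ S ∈ D.powerset, gfac D S = Polynomial.X := by
  have h1 : ∀ S ∈ D.powerset, gfac D S =
      -((-1) ^ D.card) * (-1) ^ S.card + if S = D then Polynomial.X else 0 := by
    intro S hS
    rw [Finset.mem_powerset] at hS
    have hp : (-1 : Polynomial ℤ) ^ (D \ S).card = (-1) ^ D.card * (-1) ^ S.card := by
      rw [← Finset.card_sdiff_add_card_eq_card hS, pow_add, mul_assoc, ← mul_pow]; simp
    rw [gfac]
    by_cases h : D ⊆ S
    · obtain rfl := hS.antisymm h
      have : (-1 : Polynomial ℤ) ^ S.card * (-1) ^ S.card = 1 := by rw [← mul_pow]; simp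
      simp only [subset_refl, if_true, hp, this, neg_mul, one_mul]
      ring
    · rw [if_neg h, if_neg (fun h' => h h'.ge), hp]; ring
  rw [Finset.sum_congr rfl h1, Finset.sum_add_distrib, ← Finset.mul_sum]
  have h0 : ∑ S ∈ D.powerset, (-1 : Polynomial ℤ) ^ S.card = 0 := by
    have := congrArg (Int.cast : ℤ → Polynomial ℤ)
      (Finset.sum_powerset_neg_one_pow_card_of_nonempty hD)
    push_cast at this
    exact this
  rw [h0]; simp

lemma sum_eq_prod (hd : ∀ k k', k ≠ k' → Disjoint (C k) (C k')) (hcov : ∀ x : α, ∃ k, x ∈ C k) :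
    ∑ A : Finset α, ∏ k, gfac (C k) A = ∏ k, ∑ S ∈ (C k).powerset, gfac (C k) S := by
  rw [Finset.prod_univ_sum]
  refine Finset.sum_bij' (fun A _ k => C k ∩ A) (fun p _ => Finset.univ.biUnion p) ?_ ?_ ?_ ?_ ?_
  · intro A _
    simp [Fintype.mem_piFinset]
  · intro p _; simp
  · intro A _
    ext x
    simpa using fun _ => hcov x
  · intro p hp
    simp only [Fintype.mem_piFinset, Finset.mem_powerset] at hp
    funext k
    ext x
    simp only [Finset.mem_inter, Finset.mem_biUnion, Finset.mem_univ, true_and]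
    constructor
    · rintro ⟨hx, k', hk'⟩
      by_cases h : k = k'
      · exact h ▸ hk'
      · exact absurd (hp k' hk') (Finset.disjoint_left.1 (hd k k' h) hx)
    · intro hx
      exact ⟨hp k hx, k, hx⟩
  · intro A _
    refine Finset.prod_congr rfl fun k _ => ?_
    simp [gfac, Finset.subset_inter_iff]

lemma backward_dir (hE : M.E = Set.univ) (hcirc : ∀ k, IsMatroidCircuit M ↑(C k))
    (hd : ∀ k k', k ≠ k' → Disjoint (C k) (C k')) (hcov : ∀ x : α, ∃ k, x ∈ C k)
    (hr : matroidRank M Set.univ = ∑ k, ((C k).card - 1)) :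
    (∑ A : Finset α,
        (-1 : Polynomial ℤ) ^ (matroidRank M Set.univ - matroidRank M ↑A) *
          (Polynomial.X - 1) ^ (A.card - matroidRank M ↑A))
      = Polynomial.X ^ (Fintype.card α - matroidRank M Set.univ) := by
  have hr' := rank_add M hcirc hd hcov hr
  have hterm : ∀ A : Finset α,
      (-1 : Polynomial ℤ) ^ (matroidRank M Set.univ - matroidRank M ↑A) *
          (Polynomial.X - 1) ^ (A.card - matroidRank M ↑A) = ∏ k, gfac (C k) A := by
    intro A
    have h1 := rank_eq M hE hcirc hd hr' A
    have h2 : ∑ k, (C k \ A).card = Aᶜ.card := by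
      rw [← sum_card_inter hd hcov]
      simp [Finset.sdiff_eq_inter_compl]
    have h3 := Finset.card_add_card_compl A
    have h4 := Finset.card_filter_add_card_filter_not (s := (Finset.univ : Finset (Fin l)))
      (fun k => C k ⊆ A)
    simp only [Finset.card_univ, Fintype.card_fin] at h4
    have h5 := mr_mono M (Set.subset_univ (A : Set α))
    simp only [gfac]
    rw [Finset.prod_mul_distrib, Finset.prod_pow_eq_pow_sum, h2, Finset.prod_ite,
      Finset.prod_const, Finset.prod_const, mul_left_comm, mul_comm]
    congr 1
    · congr 1; omega
    · rw [← pow_add]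
      apply neg_one_pow_congr
      rw [show Aᶜ.card + (Finset.univ.filter (fun k => ¬ C k ⊆ A)).card =
        (matroidRank M Set.univ - matroidRank M ↑A) +
        2 * (Finset.univ.filter (fun k => ¬ C k ⊆ A)).card by omega]
      simp [Nat.even_add]
  rw [Finset.sum_congr rfl (fun A _ => hterm A), sum_eq_prod hd hcov,
    Finset.prod_congr rfl (fun k _ => sum_gfac (C k) ?_)]
  · simp only [Finset.prod_const, Finset.card_univ, Fintype.card_fin]
    congr 1; omega
  · rw [Finset.nonempty_iff_ne_empty]
    intro h0
    have := (hcirc k).1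
    rw [h0] at this
    simp at this
end

/-- For a matroid `M` on a finite ground set `E`, the identity
`∑_{A ⊆ E} (-1)^(r(E) - r(A)) (t-1)^(|A| - r(A)) = t^(|E| - r(E))` in `ℤ[t]` (that is,
`T(M; 0, t) = t^(|E| - r(E))`) holds if and only if `E` can be partitioned into circuits
`C₁, …, C_l` of `M` with `r(E) = ∑ (|C_k| - 1)`, i.e. iff `M` is a direct sum of
circuits. -/
theorem tutte_zero_t_eq_iff_sum_of_circuits {α : Type} [Fintype α] [DecidableEq α]
    (M : Matroid α) (hE : M.E = Set.univ) :
    ((∑ A : Finset α,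
        (-1 : Polynomial ℤ) ^ (matroidRank M Set.univ - matroidRank M ↑A) *
          (Polynomial.X - 1) ^ (A.card - matroidRank M ↑A))
      = Polynomial.X ^ (Fintype.card α - matroidRank M Set.univ)) ↔
    ∃ (l : ℕ) (C : Fin l → Finset α),
      (∀ k, IsMatroidCircuit M ↑(C k)) ∧
      (∀ k k', k ≠ k' → Disjoint (C k) (C k')) ∧
      (∀ x : α, ∃ k, x ∈ C k) ∧
      matroidRank M Set.univ = ∑ k, ((C k).card - 1) := by
  constructor
  · exact forward_dir M hE
  · rintro ⟨l, C, h1, h2, h3, h4⟩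
    exact backward_dir M hE h1 h2 h3 h4
end
end

section
/- Suppose the columns of z generate ℤ^r (effective action) and the orbit space X_z is a topological manifold (every point has an open neighborhood homeomorphic to an open subset of ℝ^{2n−1−r}). Then either (a) r = 1 and no column of z is zero (the column matroid is rank-one uniform), or (b) there is a partition of Fin n into nonempty blocks B₁, …, B_l such that for each k the set of columns {(i ↦ (z i j : ℚ)) | j ∈ B_k} is minimally dependent over ℚ (a circuit) and r = n − l. -/
open scoped BigOperators

noncomputable section

/-- The sphere `S^{2n-1}`, realized as the unit sphere of `ℂ^n`. -/
abbrev Sph (n : ℕ) : Type := Metric.sphere (0 : EuclideanSpace ℂ (Fin n)) 1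

/-- The element of the circle by which `t ∈ T^r = (Fin r → Circle)` acts on the `j`-th
coordinate of `ℂ^n`, namely `∏ i, (t i) ^ (z i j)`. -/
def weightProd {n r : ℕ} (z : Fin r → Fin n → ℤ) (t : Fin r → Circle) (j : Fin n) : Circle :=
  ∏ i, t i ^ z i j

/-- The orbit equivalence relation on `S^{2n-1}` for the linear torus action with weight
matrix `z`:  `x ≈ y` iff some `t ∈ T^r` moves `x` to `y`, where `(t • x) j = (∏ i, (t i)^(z i j)) • (x j)`. -/
def orbitSetoid {n r : ℕ} (z : Fin r → Fin n → ℤ) : Setoid (Sph n) where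
  r x y := ∃ t : Fin r → Circle,
    ∀ j, (weightProd z t j : ℂ) * (x : EuclideanSpace ℂ (Fin n)) j
      = (y : EuclideanSpace ℂ (Fin n)) j
  iseqv := by
    constructor
    · intro x
      exact ⟨1, fun j => by simp [weightProd]⟩
    · rintro x y ⟨t, ht⟩
      refine ⟨fun i => (t i)⁻¹, fun j => ?_⟩
      have h : weightProd z (fun i => (t i)⁻¹) j = (weightProd z t j)⁻¹ := by
        simp only [weightProd, inv_zpow]
        exact Finset.prod_inv_distrib _
      rw [h, ← ht j, Circle.coe_inv, inv_mul_cancel_left₀ (Circle.coe_ne_zero _)]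
    · rintro x y zz ⟨t, ht⟩ ⟨s, hs⟩
      refine ⟨t * s, fun j => ?_⟩
      have h : weightProd z (t * s) j = weightProd z t j * weightProd z s j := by
        simp [weightProd, mul_zpow, Finset.prod_mul_distrib]
      rw [h, ← hs j, ← ht j]
      push_cast
      ring

/-- The orbit space `X_z = S^{2n-1}/T^r` of the linear torus action with weight matrix `z`,
equipped with the quotient topology. -/
abbrev OrbitSpace {n r : ℕ} (z : Fin r → Fin n → ℤ) : Type := Quotient (orbitSetoid z)

/-- `X` is a topological `d`-manifold: every point has an open neighborhood homeomorphic to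
an open subset of `ℝ^d`. -/
def LocallyEuclidean (X : Type) [TopologicalSpace X] (d : ℕ) : Prop :=
  ∀ x : X, ∃ (U : Set X) (V : Set (EuclideanSpace ℝ (Fin d))),
    IsOpen U ∧ IsOpen V ∧ x ∈ U ∧ Nonempty (U ≃ₜ V)

/-- The set of columns of `z` indexed by `B` is minimally dependent over `ℚ` (a circuit):
it is ℚ-linearly dependent, but every proper subset of it is ℚ-linearly independent. -/
def IsCircuitOfCols {n r : ℕ} (z : Fin r → Fin n → ℤ) (B : Finset (Fin n)) : Prop :=
  ¬ LinearIndependent ℚ (fun j : B => fun i => (z i (j : Fin n) : ℚ)) ∧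
    ∀ C : Finset (Fin n), C ⊂ B →
      LinearIndependent ℚ (fun j : C => fun i => (z i (j : Fin n) : ℚ))

/-- The column matroid of `z` is a direct sum of circuits: `Fin n` can be partitioned into
nonempty blocks, each of which indexes a circuit of columns, with `r = n - l` where `l` is
the number of blocks. -/
def IsSumOfCircuits {n r : ℕ} (z : Fin r → Fin n → ℤ) : Prop :=
  ∃ (l : ℕ) (B : Fin l → Finset (Fin n)),
    (∀ k, (B k).Nonempty) ∧ (∀ k, IsCircuitOfCols z (B k)) ∧
    (∀ k k', k ≠ k' → Disjoint (B k) (B k')) ∧ (∀ j, ∃ k, j ∈ B k) ∧ r = n - l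

section Helpers
set_option linter.unusedSectionVars false
set_option linter.style.haveILetI false
open MeasureTheory Metric Set

section Ess
variable {E : Type} [NormedAddCommGroup E] [NormedSpace ℝ E] [FiniteDimensional ℝ E]

lemma ess_det_pos (A : E →L[ℝ] E) (hA : ‖A‖ < 1) : 0 < (1 + A : E →L[ℝ] E).det := by
  have hne : ∀ τ ∈ Icc (0:ℝ) 1, (1 + τ • A : E →L[ℝ] E).det ≠ 0 := by
    intro τ hτ h0
    have hk := LinearMap.bot_lt_ker_of_det_eq_zero (f := ((1 + τ • A : E →L[ℝ] E) : E →ₗ[ℝ] E)) h0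
    obtain ⟨v, hv, hv0⟩ := (Submodule.ne_bot_iff _).1 hk.ne'
    have hv' : v + τ • A v = 0 := by simpa using hv
    have h1 : ‖v‖ = ‖τ • A v‖ := by
      have h := eq_neg_of_add_eq_zero_left hv'
      calc ‖v‖ = ‖-(τ • A v)‖ := congrArg norm h
        _ = _ := norm_neg _
    have h2 : ‖τ • A v‖ ≤ ‖A‖ * ‖v‖ := by
      rw [norm_smul, Real.norm_eq_abs, abs_of_nonneg hτ.1]
      calc τ * ‖A v‖ ≤ 1 * ‖A v‖ := by gcongr; exact hτ.2
        _ ≤ _ := by rw [one_mul]; exact A.le_opNorm v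
    have h3 : 0 < ‖v‖ := norm_pos_iff.2 hv0
    nlinarith
  by_contra hneg
  push Not at hneg
  have hc : ContinuousOn (fun τ : ℝ => (1 + τ • A : E →L[ℝ] E).det) (Icc 0 1) := by
    apply Continuous.continuousOn
    exact ContinuousLinearMap.continuous_det.comp (by fun_prop)
  have := intermediate_value_Icc' (zero_le_one) hc
  have h0 : (0:ℝ) ∈ Icc ((1 + (1:ℝ) • A : E →L[ℝ] E).det) ((1 + (0:ℝ) • A : E →L[ℝ] E).det) := by
    constructor
    · simpa using hneg
    · have : (1 + (0:ℝ) • A : E →L[ℝ] E) = 1 := by simp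
      rw [this]
      simp [ContinuousLinearMap.det]
  obtain ⟨τ, hτ, h⟩ := this h0
  exact hne τ hτ h

lemma ess_interp (S : ℝ) : ∃ (s : ℕ → ℝ) (c : ℕ → ℝ), (∀ i, S < s i) ∧
    ∀ A : E →L[ℝ] E, A.det =
      ∑ i ∈ Finset.range (Module.finrank ℝ E + 1), c i * (s i • (1 : E →L[ℝ] E) + A).det := by
  let s : ℕ → ℝ := fun i => S + 1 + i
  have hs : Set.InjOn s (Finset.range (Module.finrank ℝ E + 1) : Finset ℕ) := by
    intro a _ b _ h
    simpa [s] using h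
  refine ⟨s, fun i => (Lagrange.basis (Finset.range (Module.finrank ℝ E + 1)) s i).eval 0,
    fun i => by simp only [s]; have : (0:ℝ) ≤ i := by positivity
                linarith, fun A => ?_⟩
  let p := LinearMap.charpoly (-(A : E →ₗ[ℝ] E))
  have hev : ∀ t : ℝ, p.eval t = (t • (1 : E →L[ℝ] E) + A).det := by
    intro t
    rw [LinearMap.eval_charpoly]
    simp only [ContinuousLinearMap.det]
    congr 1
    ext v
    simp [Module.algebraMap_end_apply]
  have hdeg : p.degree < (Finset.range (Module.finrank ℝ E + 1)).card := by
    rw [Finset.card_range, Polynomial.degree_eq_natDegree (LinearMap.charpoly_monic _).ne_zero,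
      LinearMap.charpoly_natDegree]
    exact_mod_cast Nat.lt_succ_self _
  have h0 : A.det = p.eval 0 := by rw [hev]; simp
  rw [h0, Lagrange.eq_interpolate hs hdeg, Lagrange.interpolate_apply, Polynomial.eval_finsetSum]
  refine Finset.sum_congr rfl fun i _ => ?_
  rw [Polynomial.eval_mul, Polynomial.eval_C, hev, mul_comm]

variable [MeasurableSpace E] [BorelSpace E] (μ : Measure E) [μ.IsAddHaarMeasure]

lemma ess_vol (Ψ : E → E) (hΨ : ContDiff ℝ 1 Ψ) (ρ : ℝ) (hsupp : ∀ x, x ∉ closedBall (0:E) ρ → Ψ x = 0)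
    (K : NNReal) (hK : LipschitzWith K Ψ) (t : ℝ) (ht : 0 < t) (htK : t * K < 1) :
    ∫ x in closedBall (0:E) ρ, (1 + t • fderiv ℝ Ψ x : E →L[ℝ] E).det ∂μ
      = μ.real (closedBall (0:E) ρ) := by
  set g : E → E := fun x => x + t • Ψ x with hg
  have happ : ApproximatesLinearOn g ((ContinuousLinearEquiv.refl ℝ E : E ≃L[ℝ] E) : E →L[ℝ] E) univ
      (⟨t, ht.le⟩ * K) := by
    intro x _ y _
    have h := hK.norm_sub_le x y
    simp only [hg, ContinuousLinearEquiv.coe_coe, ContinuousLinearEquiv.refl_apply]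
    have : x + t • Ψ x - (y + t • Ψ y) - (x - y) = t • (Ψ x - Ψ y) := by rw [smul_sub]; abel
    rw [this, norm_smul, Real.norm_eq_abs, abs_of_pos ht]
    change _ ≤ t * K * _
    rw [mul_assoc]
    gcongr
  have hc : Subsingleton E ∨ (⟨t, ht.le⟩ * K : NNReal) <
      ‖((ContinuousLinearEquiv.refl ℝ E).symm : E →L[ℝ] E)‖₊⁻¹ := by
    rcases subsingleton_or_nontrivial E with h | h
    · exact Or.inl h
    · right
      have : ‖((ContinuousLinearEquiv.refl ℝ E).symm : E →L[ℝ] E)‖₊ = 1 := by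
        have := ContinuousLinearMap.nnnorm_id (𝕜 := ℝ) (E := E)
        simpa using this
      rw [this, inv_one]
      exact_mod_cast htK
  have hinj : Function.Injective g := Set.injOn_univ.1 (happ.injOn hc)
  have hsurj : Function.Surjective g := happ.surjective hc
  have hid : ∀ x, x ∉ closedBall (0:E) ρ → g x = x := by
    intro x hx; simp [hg, hsupp x hx]
  have himg : g '' closedBall (0:E) ρ = closedBall (0:E) ρ := by
    apply Subset.antisymm
    · rintro _ ⟨x, hx, rfl⟩
      by_contra h
      have := hinj (hid _ h)
      rw [this] at h
      exact h hx
    · intro y hy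
      obtain ⟨x, rfl⟩ := hsurj y
      refine ⟨x, ?_, rfl⟩
      by_contra h
      rw [hid x h] at hy
      exact h hy
  have hder : ∀ x, HasFDerivAt g (1 + t • fderiv ℝ Ψ x) x := by
    intro x
    have h1 := ((hΨ.differentiable one_ne_zero) x).hasFDerivAt
    exact (hasFDerivAt_id x).add (h1.const_smul t)
  have hmain := integral_image_eq_integral_abs_det_fderiv_smul μ
    (s := closedBall (0:E) ρ) (f := g) measurableSet_closedBall
    (fun x _ => (hder x).hasFDerivWithinAt) hinj.injOn (fun _ => (1:ℝ))
  rw [himg] at hmain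
  simp only [smul_eq_mul, mul_one, integral_const, MeasurableSet.univ, measureReal_restrict_apply,
    univ_inter] at hmain
  rw [hmain]
  refine setIntegral_congr_fun measurableSet_closedBall fun x _ => ?_
  refine (abs_of_pos ?_).symm
  apply ess_det_pos
  rw [norm_smul, Real.norm_eq_abs, abs_of_pos ht]
  have : ‖fderiv ℝ Ψ x‖ ≤ K := norm_fderiv_le_of_lipschitz ℝ hK
  nlinarith

lemma ess_int_zero (hdim : 0 < Module.finrank ℝ E) (Ψ : E → E) (hΨ : ContDiff ℝ 1 Ψ) (ρ : ℝ)
    (hsupp : ∀ x, x ∉ closedBall (0:E) ρ → Ψ x = 0) :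
    ∫ x in closedBall (0:E) ρ, (fderiv ℝ Ψ x).det ∂μ = 0 := by
  have hcs : HasCompactSupport Ψ := HasCompactSupport.intro (isCompact_closedBall 0 ρ) hsupp
  obtain ⟨K, hK⟩ := hΨ.lipschitzWith_of_hasCompactSupport hcs one_ne_zero
  obtain ⟨s, c, hs, hint⟩ := ess_interp (E := E) (K : ℝ)
  have hscale : ∀ i, ∀ A : E →L[ℝ] E, (s i • (1 : E →L[ℝ] E) + A).det
      = (s i) ^ (Module.finrank ℝ E) * (1 + (s i)⁻¹ • A).det := by
    intro i A
    have hpos : 0 < s i := lt_of_le_of_lt K.2 (hs i)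
    have : (s i • (1 : E →L[ℝ] E) + A) = s i • (1 + (s i)⁻¹ • A) := by
      rw [smul_add, smul_smul, mul_inv_cancel₀ hpos.ne', one_smul]
    rw [this]
    exact LinearMap.det_smul _ _
  have hfc : Continuous (fun x => fderiv ℝ Ψ x) := hΨ.continuous_fderiv one_ne_zero
  have hval : ∀ i, ∫ x in closedBall (0:E) ρ, (s i • (1 : E →L[ℝ] E) + fderiv ℝ Ψ x).det ∂μ
      = (s i • (1 : E →L[ℝ] E) + 0).det * μ.real (closedBall (0:E) ρ) := by
    intro i
    have hpos : 0 < s i := lt_of_le_of_lt K.2 (hs i)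
    simp_rw [hscale]
    rw [integral_const_mul, ess_vol μ Ψ hΨ ρ hsupp K hK (s i)⁻¹ (by positivity)
      (by rw [inv_mul_lt_iff₀ hpos, mul_one]; exact hs i)]
    simp [ContinuousLinearMap.det]
  calc ∫ x in closedBall (0:E) ρ, (fderiv ℝ Ψ x).det ∂μ
      = ∫ x in closedBall (0:E) ρ, ∑ i ∈ Finset.range (Module.finrank ℝ E + 1),
          c i * (s i • (1 : E →L[ℝ] E) + fderiv ℝ Ψ x).det ∂μ := by
        refine setIntegral_congr_fun measurableSet_closedBall fun x _ => hint _
    _ = ∑ i ∈ Finset.range (Module.finrank ℝ E + 1), c i *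
          ((s i • (1 : E →L[ℝ] E) + 0).det * μ.real (closedBall (0:E) ρ)) := by
        rw [integral_finsetSum]
        · refine Finset.sum_congr rfl fun i _ => ?_
          rw [integral_const_mul, hval]
        · intro i _
          refine ContinuousOn.integrableOn_compact (isCompact_closedBall _ _) (Continuous.continuousOn ?_)
          exact continuous_const.mul (ContinuousLinearMap.continuous_det.comp (by fun_prop))
    _ = (0 : E →L[ℝ] E).det * μ.real (closedBall (0:E) ρ) := by
        rw [hint 0, Finset.sum_mul]
        simp_rw [mul_assoc]
    _ = 0 := by
        have : (0 : E →L[ℝ] E).det = 0 := by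
          simp only [ContinuousLinearMap.det, ContinuousLinearMap.toLinearMap_zero]
          rw [LinearMap.det_zero, zero_pow hdim.ne']
        rw [this, zero_mul]
end Ess

section Ret
variable {E : Type} [NormedAddCommGroup E] [NormedSpace ℝ E]
/-- radial retraction -/
def ret (ρ : ℝ) (x : E) : E := (max 1 (‖x‖ / ρ))⁻¹ • x

lemma ret_cont (ρ : ℝ) : Continuous (ret ρ : E → E) := by
  unfold ret
  have : Continuous fun x : E => (max 1 (‖x‖ / ρ)) := by fun_prop
  exact (this.inv₀ (fun x => by positivity)).smul continuous_id

lemma ret_norm (ρ : ℝ) (hρ : 0 < ρ) (x : E) : ‖ret ρ x‖ ≤ ρ := by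
  unfold ret
  rw [norm_smul, norm_inv, Real.norm_eq_abs, abs_of_pos (by positivity), inv_mul_le_iff₀ (by positivity)]
  calc ‖x‖ = (‖x‖ / ρ) * ρ := by field_simp
    _ ≤ _ := by gcongr; exact le_max_right _ _

lemma ret_eq (ρ : ℝ) (hρ : 0 < ρ) (x : E) (hx : ‖x‖ ≤ ρ) : ret ρ x = x := by
  unfold ret
  rw [max_eq_left ((div_le_one hρ).2 hx), inv_one, one_smul]

end Ret

section Ess2
variable {E : Type} [NormedAddCommGroup E] [NormedSpace ℝ E] [FiniteDimensional ℝ E]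

lemma ess_sigma (η : ℝ) : ∃ σ : ℝ → ℝ, ∀ t, HasDerivAt σ (max 0 (η - |t|)) t := by
  refine ⟨fun t => ∫ s in (0:ℝ)..t, max 0 (η - |s|), fun t => ?_⟩
  have hc : Continuous (fun s : ℝ => max 0 (η - |s|)) := by fun_prop
  exact (hc.integral_hasStrictDerivAt 0 t).hasDerivAt

lemma ess_diag {m : ℕ} (σ σ' : ℝ → ℝ) (hσ : ∀ t, HasDerivAt σ (σ' t) t) (y : Fin m → ℝ) :
    HasFDerivAt (fun v : Fin m → ℝ => fun i => σ (v i))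
      (LinearMap.toContinuousLinearMap (Matrix.toLin' (Matrix.diagonal fun i => σ' (y i)))) y := by
  rw [hasFDerivAt_pi']
  intro i
  have h2 : HasFDerivAt (fun v : Fin m → ℝ => v i)
    (ContinuousLinearMap.proj (R := ℝ) i) y := hasFDerivAt_apply i _
  have h3 := (hσ (y i)).comp_hasFDerivAt y h2
  have h4 : (ContinuousLinearMap.proj (R := ℝ) i).comp (LinearMap.toContinuousLinearMap
      (Matrix.toLin' (Matrix.diagonal fun i => σ' (y i))))
      = σ' (y i) • (ContinuousLinearMap.proj (R := ℝ) i : (Fin m → ℝ) →L[ℝ] ℝ) := by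
    apply ContinuousLinearMap.ext
    intro v
    simp [Matrix.mulVec_diagonal]
  rw [h4]
  exact h3

lemma ess_R (κ : ℝ) (hκ : 0 < κ) : ∃ R : E → E, ContDiff ℝ 1 R ∧ (∀ y, 0 ≤ (fderiv ℝ R y).det) ∧
    0 < (fderiv ℝ R 0).det ∧ ∀ y, κ ≤ ‖y‖ → (fderiv ℝ R y).det = 0 := by
  obtain ⟨L⟩ : Nonempty (E ≃L[ℝ] (Fin (Module.finrank ℝ E) → ℝ)) :=
    ⟨(Module.finBasis ℝ E).equivFunL⟩
  set η : ℝ := κ / (‖(L.symm : (Fin (Module.finrank ℝ E) → ℝ) →L[ℝ] E)‖ + 1) with hη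
  have hηpos : 0 < η := by positivity
  obtain ⟨σ, hσ⟩ := ess_sigma η
  have hσc : ContDiff ℝ 1 σ := by
    rw [contDiff_one_iff_deriv]
    refine ⟨fun t => (hσ t).differentiableAt, ?_⟩
    have : deriv σ = fun t => max 0 (η - |t|) := by ext t; exact (hσ t).deriv
    rw [this]; fun_prop
  let R : E → E := fun y => L.symm (fun i => σ (L y i))
  have hR : ContDiff ℝ 1 R := by
    apply L.symm.contDiff.comp
    rw [contDiff_pi]
    intro i
    apply hσc.comp
    exact (contDiff_pi.1 L.contDiff) i
  have hdet : ∀ y, (fderiv ℝ R y).det = ∏ i, max 0 (η - |L y i|) := by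
    intro y
    have h1 := ess_diag σ _ hσ (L y)
    have h2 : HasFDerivAt R _ y := (L.symm.hasFDerivAt.comp y (h1.comp y L.hasFDerivAt))
    rw [h2.fderiv]
    have := LinearMap.det_conj (Matrix.toLin' (Matrix.diagonal fun i => max 0 (η - |L y i|)))
      L.symm.toLinearEquiv
    rw [LinearMap.det_toLin', Matrix.det_diagonal] at this
    rw [← this]
    rfl
  refine ⟨R, hR, fun y => ?_, ?_, fun y hy => ?_⟩
  · rw [hdet]; exact Finset.prod_nonneg fun i _ => le_max_left _ _
  · rw [hdet]
    refine Finset.prod_pos fun i _ => ?_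
    simp [hηpos]
  · rw [hdet]
    by_contra hne
    have hall : ∀ i, ‖L y i‖ < η := by
      intro i
      by_contra hi
      push Not at hi
      apply hne
      refine Finset.prod_eq_zero (Finset.mem_univ i) ?_
      rw [Real.norm_eq_abs] at hi
      exact max_eq_left (by linarith)
    have h1 : ‖L y‖ < η := (pi_norm_lt_iff hηpos).2 hall
    have h2 : ‖y‖ ≤ ‖(L.symm : (Fin (Module.finrank ℝ E) → ℝ) →L[ℝ] E)‖ * ‖L y‖ := by
      have := (L.symm : (Fin (Module.finrank ℝ E) → ℝ) →L[ℝ] E).le_opNorm (L y)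
      simpa using this
    have h3 : η * (‖(L.symm : (Fin (Module.finrank ℝ E) → ℝ) →L[ℝ] E)‖ + 1) = κ := by
      rw [hη]; field_simp
    have h4 := norm_nonneg (L.symm : (Fin (Module.finrank ℝ E) → ℝ) →L[ℝ] E)
    nlinarith [mul_le_mul_of_nonneg_left h1.le h4]

lemma det_comp_clm (A B : E →L[ℝ] E) : (A.comp B).det = A.det * B.det :=
  LinearMap.det_comp _ _

lemma ess_core (hdim : 0 < Module.finrank ℝ E) (Φ0 Φ1 : E → E) (h0 : ContDiff ℝ 1 Φ0)
    (h1 : ContDiff ℝ 1 Φ1) (ρ : ℝ) (hρ : 0 < ρ) (heq : ∀ x, ρ ≤ ‖x‖ → Φ1 x = Φ0 x)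
    (hne : ∀ x, ‖x‖ ≤ ρ → Φ1 x ≠ 0) (hdet : ∀ x, 0 ≤ (fderiv ℝ Φ0 x).det)
    (hpos : ∀ δ > 0, ∃ x, ‖x‖ < δ ∧ 0 < (fderiv ℝ Φ0 x).det) (hz : Φ0 0 = 0) : False := by
  letI : MeasurableSpace E := borel E
  haveI : BorelSpace E := ⟨rfl⟩
  let μ : Measure E := Measure.addHaar
  obtain ⟨κ, hκ, hκ'⟩ : ∃ κ > 0, ∀ x, ‖x‖ ≤ ρ → κ ≤ ‖Φ1 x‖ := by
    obtain ⟨x, hx, hmin⟩ := (isCompact_closedBall (0:E) ρ).exists_isMinOn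
      ⟨0, by simp [hρ.le]⟩ (h1.continuous.norm.continuousOn)
    refine ⟨‖Φ1 x‖, norm_pos_iff.2 (hne x (by simpa using hx)), fun y hy => hmin (by simpa using hy)⟩
  obtain ⟨R, hR, hRnn, hR0, hRz⟩ := ess_R (E := E) κ hκ
  let ψ : ContDiffBump (0:E) := ⟨2 * ρ, 3 * ρ, by linarith, by linarith⟩
  have hψ : ContDiff ℝ 1 ψ := ψ.contDiff
  have hkey : ∀ Φ : E → E, ContDiff ℝ 1 Φ → ContDiff ℝ 1 (fun x => ψ x • R (Φ x)) := fun Φ h =>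
    hψ.smul (hR.comp h)
  have hint : ∀ Φ : E → E, ContDiff ℝ 1 Φ →
      ∫ x in closedBall (0:E) (3*ρ), (fderiv ℝ (fun x => ψ x • R (Φ x)) x).det ∂μ = 0 := by
    intro Φ h
    apply ess_int_zero μ hdim _ (hkey Φ h)
    intro x hx
    have : ψ x = 0 := by
      apply ψ.zero_of_le_dist
      have := hx
      rw [mem_closedBall, not_le] at this
      exact this.le
    simp [this]
  have hloc : ∀ Φ : E → E, ContDiff ℝ 1 Φ → ∀ x, ‖x‖ < 2 * ρ →
      (fderiv ℝ (fun x => ψ x • R (Φ x)) x).det = (fderiv ℝ R (Φ x)).det * (fderiv ℝ Φ x).det := by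
    intro Φ h x hx
    have he : (fun x => ψ x • R (Φ x)) =ᶠ[nhds x] (R ∘ Φ) := by
      have : ∀ᶠ y in nhds x, ‖y‖ < 2 * ρ := continuous_norm.continuousAt.eventually_lt
        continuousAt_const hx
      filter_upwards [this] with y hy
      have : ψ y = 1 := ψ.one_of_mem_closedBall (by
        rw [mem_closedBall, dist_zero_right]; exact hy.le)
      simp [this]
    rw [he.fderiv_eq, fderiv_comp x (hR.differentiable one_ne_zero _) (h.differentiable one_ne_zero _),
      det_comp_clm]
  let G : E → ℝ := fun x => (fderiv ℝ (fun x => ψ x • R (Φ0 x)) x).det -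
    (fderiv ℝ (fun x => ψ x • R (Φ1 x)) x).det
  have hcd : ∀ Φ : E → E, ContDiff ℝ 1 Φ →
      Continuous (fun x => (fderiv ℝ (fun x => ψ x • R (Φ x)) x).det) := fun Φ h =>
    ContinuousLinearMap.continuous_det.comp ((hkey Φ h).continuous_fderiv one_ne_zero)
  have hGc : Continuous G := (hcd _ h0).sub (hcd _ h1)
  have hGin : ∀ x, ‖x‖ ≤ ρ → G x = (fderiv ℝ R (Φ0 x)).det * (fderiv ℝ Φ0 x).det := by
    intro x hx
    simp only [G]
    rw [hloc _ h0 x (by linarith), hloc _ h1 x (by linarith), hRz _ (hκ' x hx)]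
    ring
  have hGnn : ∀ x, 0 ≤ G x := by
    intro x
    rcases le_or_gt ‖x‖ ρ with hx | hx
    · rw [hGin x hx]
      exact mul_nonneg (hRnn _) (hdet _)
    · have he : (fun x => ψ x • R (Φ0 x)) =ᶠ[nhds x] (fun x => ψ x • R (Φ1 x)) := by
        have : ∀ᶠ y in nhds x, ρ < ‖y‖ := continuousAt_const.eventually_lt
          continuous_norm.continuousAt hx
        filter_upwards [this] with y hy
        rw [heq y hy.le]
      simp only [G]
      rw [he.fderiv_eq, sub_self]
  have hGint : ∫ x in closedBall (0:E) (3*ρ), G x ∂μ = 0 := by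
    simp only [G]
    rw [integral_sub, hint _ h0, hint _ h1, sub_self]
    · exact (hcd _ h0).continuousOn.integrableOn_compact (isCompact_closedBall _ _)
    · exact (hcd _ h1).continuousOn.integrableOn_compact (isCompact_closedBall _ _)
  have hGpos : 0 < ∫ x in closedBall (0:E) (3*ρ), G x ∂μ := by
    rw [setIntegral_pos_iff_support_of_nonneg_ae (Filter.Eventually.of_forall hGnn)
      (hGc.continuousOn.integrableOn_compact (isCompact_closedBall _ _))]
    obtain ⟨x0, hx0, hx0'⟩ : ∃ x, ‖x‖ < ρ ∧ 0 < G x := by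
      have : ∀ᶠ x in nhds (0:E), 0 < (fderiv ℝ R (Φ0 x)).det := by
        have hc : Continuous fun x => (fderiv ℝ R (Φ0 x)).det :=
          ContinuousLinearMap.continuous_det.comp
            ((hR.continuous_fderiv one_ne_zero).comp h0.continuous)
        refine continuousAt_const.eventually_lt hc.continuousAt ?_
        rw [hz]; exact hR0
      obtain ⟨δ, hδ, hball⟩ := Metric.eventually_nhds_iff.1 this
      obtain ⟨x, hx, hxp⟩ := hpos (min δ ρ) (lt_min hδ hρ)
      have hxρ : ‖x‖ < ρ := hx.trans_le (min_le_right _ _)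
      refine ⟨x, hxρ, ?_⟩
      rw [hGin x hxρ.le]
      refine mul_pos (hball ?_) hxp
      rw [dist_zero_right]; exact hx.trans_le (min_le_left _ _)
    have hop : IsOpen ({x | 0 < G x} ∩ ball (0:E) ρ) :=
      (isOpen_lt continuous_const hGc).inter isOpen_ball
    refine lt_of_lt_of_le (hop.measure_pos μ ⟨x0, hx0', by simpa using hx0⟩) (measure_mono ?_)
    rintro x ⟨hx, hx'⟩
    refine ⟨ne_of_gt hx, ?_⟩
    rw [mem_ball] at hx'
    rw [mem_closedBall]; linarith
  linarith

lemma essential (Φ0 : E → E) (h0 : ContDiff ℝ 1 Φ0) (hdet : ∀ x, 0 ≤ (fderiv ℝ Φ0 x).det)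
    (hpos : ∀ δ > 0, ∃ x, ‖x‖ < δ ∧ 0 < (fderiv ℝ Φ0 x).det) (hz : Φ0 0 = 0)
    (hz' : ∀ x, Φ0 x = 0 → x = 0) (ρ : ℝ) (hρ : 0 < ρ) :
    ∃ ε > 0, ∀ Φ : E → E, ContinuousOn Φ (closedBall 0 ρ) →
      (∀ x, ‖x‖ ≤ ρ → ‖Φ x - Φ0 x‖ < ε) → ∃ x, ‖x‖ ≤ ρ ∧ Φ x = 0 := by
  rcases Nat.eq_zero_or_pos (Module.finrank ℝ E) with hd | hdim
  · haveI : Subsingleton E := Module.finrank_zero_iff.1 hd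
    exact ⟨1, one_pos, fun Φ _ _ => ⟨0, by simp [hρ.le], Subsingleton.elim _ _⟩⟩
  have hcomp : IsCompact (closedBall (0:E) ρ \ ball 0 (ρ/2)) :=
    (isCompact_closedBall _ _).diff isOpen_ball
  obtain ⟨ε, hε, hε'⟩ : ∃ ε > 0, ∀ x, ρ/2 ≤ ‖x‖ → ‖x‖ ≤ ρ → 4 * ε ≤ ‖Φ0 x‖ := by
    rcases (closedBall (0:E) ρ \ ball 0 (ρ/2)).eq_empty_or_nonempty with he | hne
    · refine ⟨1, one_pos, fun x hx hx' => ?_⟩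
      have : x ∈ closedBall (0:E) ρ \ ball 0 (ρ/2) := ⟨by simpa using hx', by simpa using hx⟩
      rw [he] at this; exact this.elim
    · obtain ⟨x, hx, hmin⟩ := hcomp.exists_isMinOn hne (h0.continuous.norm.continuousOn)
      have hxn : 0 < ‖Φ0 x‖ := by
        rw [norm_pos_iff]; intro h
        have := hz' x h
        apply hx.2; rw [this]; simp [hρ]
      refine ⟨‖Φ0 x‖ / 4, by positivity, fun y hy hy' => ?_⟩
      have : ‖Φ0 x‖ ≤ ‖Φ0 y‖ := hmin ⟨by simpa using hy', by simpa using hy⟩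
      linarith
  refine ⟨ε, hε, fun Φ hΦ hclose => ?_⟩
  by_contra hno
  push Not at hno
  obtain ⟨η, hη, hη'⟩ : ∃ η > 0, ∀ x, ‖x‖ ≤ ρ → η ≤ ‖Φ x‖ := by
    obtain ⟨x, hx, hmin⟩ := (isCompact_closedBall (0:E) ρ).exists_isMinOn
      ⟨0, by simp [hρ.le]⟩ hΦ.norm
    exact ⟨‖Φ x‖, norm_pos_iff.2 (hno x (by simpa using hx)), fun y hy => hmin (by simpa using hy)⟩
  have hΦc : Continuous (fun x => Φ (ret ρ x)) :=
    hΦ.comp_continuous (ret_cont ρ) (fun x => by simpa using ret_norm ρ hρ x)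
  obtain ⟨g, hg, hgd, -⟩ := hΦc.exists_contDiff_approx (1 : ℕ∞) (ε := fun _ => min ε η)
    continuous_const (fun _ => lt_min hε hη)
  have hgd' : ∀ x, ‖x‖ ≤ ρ → ‖g x - Φ x‖ < min ε η := by
    intro x hx
    have := hgd x
    rwa [ret_eq ρ hρ x hx, dist_eq_norm] at this
  let ψ : ContDiffBump (0:E) := ⟨ρ / 2, ρ, by linarith, by linarith⟩
  have hψ : ContDiff ℝ 1 ψ := ψ.contDiff
  refine ess_core hdim Φ0 (fun x => Φ0 x + ψ x • (g x - Φ0 x)) h0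
    (h0.add (hψ.smul (ContDiff.sub hg h0))) ρ hρ ?_ ?_ hdet hpos hz
  · intro x hx
    have : ψ x = 0 := ψ.zero_of_le_dist (by simpa using hx)
    simp [this]
  · intro x hx
    rcases le_or_gt ‖x‖ (ρ/2) with h | h
    · have : ψ x = 1 := ψ.one_of_mem_closedBall (by simpa using h)
      simp only [this, one_smul]
      intro he
      have h1 : g x = 0 := by rw [← he]; abel
      have h2 := hgd' x hx
      rw [h1, zero_sub, norm_neg] at h2
      have := hη' x hx
      have := min_le_right ε η
      linarith
    · intro he
      have h1 : Φ0 x = - (ψ x • (g x - Φ0 x)) := eq_neg_of_add_eq_zero_left he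
      have h2 : ‖Φ0 x‖ ≤ 1 * ‖g x - Φ0 x‖ := by
        calc ‖Φ0 x‖ = ‖ψ x • (g x - Φ0 x)‖ := by rw [← norm_neg (ψ x • _)]; exact congrArg norm h1
          _ = ψ x * ‖g x - Φ0 x‖ := by rw [norm_smul, Real.norm_eq_abs, abs_of_nonneg ψ.nonneg]
          _ ≤ _ := by gcongr; exact ψ.le_one
      have h3 : ‖g x - Φ0 x‖ ≤ ‖g x - Φ x‖ + ‖Φ x - Φ0 x‖ := norm_sub_le_norm_sub_add_norm_sub _ _ _
      have h4 := hgd' x hx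
      have h5 := hclose x hx
      have h6 := hε' x h.le hx
      have := min_le_left ε η
      linarith

/-- Lemma G -/
lemma lemmaG {F : Type} [NormedAddCommGroup F] [NormedSpace ℝ F] [FiniteDimensional ℝ F]
    (hd : Module.finrank ℝ E < Module.finrank ℝ F) (g : E → F) (hg : Continuous g) (p : F) (ε : ℝ) (hε : 0 < ε) :
    ∃ g' : E → F, Continuous g' ∧ (∀ x, ‖g' x - g x‖ < ε) ∧ ∀ x, g' x ≠ p := by
  obtain ⟨g1, hg1, hg1d, -⟩ := hg.exists_contDiff_approx (1 : ℕ∞) (ε := fun _ => ε/2)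
    continuous_const (fun _ => by positivity)
  have hdense := ContDiff.dense_compl_range_of_finrank_lt_finrank (f := g1) hg1 hd
  obtain ⟨w, hw, hwd⟩ := hdense.exists_dist_lt p (half_pos hε)
  refine ⟨fun x => g1 x - (w - p), by have := hg1.continuous; fun_prop, fun x => ?_, fun x hx => ?_⟩
  · have h1 := hg1d x
    rw [dist_eq_norm] at h1
    have h2 : ‖w - p‖ < ε / 2 := by rw [← dist_eq_norm, dist_comm]; exact hwd
    calc ‖g1 x - (w - p) - g x‖ = ‖(g1 x - g x) - (w - p)‖ := by congr 1; abel
      _ ≤ ‖g1 x - g x‖ + ‖w - p‖ := norm_sub_le _ _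
      _ < ε := by linarith
  · apply hw
    refine ⟨x, ?_⟩
    have h : g1 x - (w - p) = p := hx
    rw [sub_eq_iff_eq_add] at h
    rw [h]; abel
end Ess2

section SecA3
variable {ιR ιC : Type} [Fintype ιR] [Fintype ιC]

abbrev WSp (ιR ιC : Type) : Type := (ιR → ℝ) × (ιC → ℂ)
abbrev ESp (ιR ιC : Type) : Type := WSp ιR ιC × ℝ × ℂ

def modelMap (M : ℕ) (e : ESp ιR ιC) : ESp ιR ιC :=
  ((e.1.1, fun i => e.1.2 i ^ M), e.2.1, e.2.2 ^ M)

def modelT (c : ιC → ℂ) (c0 : ℂ) : ESp ιR ιC →L[ℝ] ESp ιR ιC :=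
  ((ContinuousLinearMap.id ℝ (ιR → ℝ)).prodMap
    (ContinuousLinearMap.pi fun i => (c i • (1 : ℂ →L[ℝ] ℂ)).comp (ContinuousLinearMap.proj (R := ℝ) i))).prodMap
  ((ContinuousLinearMap.id ℝ ℝ).prodMap (c0 • (1 : ℂ →L[ℝ] ℂ)))

lemma modelT_apply (c : ιC → ℂ) (c0 : ℂ) (e : ESp ιR ιC) :
    modelT c c0 e = ((e.1.1, fun i => c i * e.1.2 i), e.2.1, c0 * e.2.2) := by
  rfl

lemma modelT_comp (c c' : ιC → ℂ) (c0 c0' : ℂ) :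
    (modelT c c0 : ESp ιR ιC →L[ℝ] ESp ιR ιC).comp (modelT c' c0') = modelT (c * c') (c0 * c0') := by
  apply ContinuousLinearMap.ext
  intro e
  simp only [ContinuousLinearMap.comp_apply, modelT_apply, Pi.mul_apply, mul_assoc]

lemma modelT_det_nonneg (c : ιC → ℂ) (c0 : ℂ) :
    0 ≤ (modelT c c0 : ESp ιR ιC →L[ℝ] ESp ιR ιC).det := by
  choose s hs using fun i => IsAlgClosed.exists_pow_nat_eq (c i) (n := 2) two_pos
  obtain ⟨s0, hs0⟩ := IsAlgClosed.exists_pow_nat_eq c0 (n := 2) two_pos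
  have h1 : c = s * s := by ext i; simp [← hs i, sq]
  have h2 : c0 = s0 * s0 := by rw [← hs0, sq]
  rw [h1, h2, ← modelT_comp, det_comp_clm]
  exact mul_self_nonneg _

lemma modelT_det_pos (c : ιC → ℂ) (c0 : ℂ) (hc : ∀ i, c i ≠ 0) (hc0 : c0 ≠ 0) :
    0 < (modelT c c0 : ESp ιR ιC →L[ℝ] ESp ιR ιC).det := by
  refine lt_of_le_of_ne (modelT_det_nonneg c c0) fun h => ?_
  have h1 : (modelT (c * c⁻¹) (c0 * c0⁻¹) : ESp ιR ιC →L[ℝ] ESp ιR ιC).det = 1 := by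
    have : (modelT (c * c⁻¹) (c0 * c0⁻¹) : ESp ιR ιC →L[ℝ] ESp ιR ιC) = ContinuousLinearMap.id ℝ _ := by
      apply ContinuousLinearMap.ext
      intro e
      rw [modelT_apply]
      simp [hc0, hc]
    rw [this]
    exact LinearMap.det_id
  rw [← modelT_comp, det_comp_clm, ← h, zero_mul] at h1
  exact zero_ne_one h1

lemma modelMap_fderiv (M : ℕ) (e : ESp ιR ιC) : HasFDerivAt (modelMap M)
    (modelT (fun i => M * e.1.2 i ^ (M-1)) (M * e.2.2 ^ (M-1))) e := by
  have hp : ∀ w : ℂ, HasFDerivAt (fun w : ℂ => w ^ M) (((M:ℂ) * w ^ (M-1)) • (1 : ℂ →L[ℝ] ℂ)) w :=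
    fun w => (hasDerivAt_pow M w).complexToReal_fderiv
  have f11 : HasFDerivAt (𝕜 := ℝ) (fun e : ESp ιR ιC => e.1.1) _ e :=
    (hasFDerivAt_fst (𝕜 := ℝ)).comp e (hasFDerivAt_fst (𝕜 := ℝ))
  have f12 : HasFDerivAt (𝕜 := ℝ) (fun e : ESp ιR ιC => e.1.2) _ e :=
    (hasFDerivAt_snd (𝕜 := ℝ)).comp e (hasFDerivAt_fst (𝕜 := ℝ))
  have f21 : HasFDerivAt (𝕜 := ℝ) (fun e : ESp ιR ιC => e.2.1) _ e :=
    (hasFDerivAt_fst (𝕜 := ℝ)).comp e (hasFDerivAt_snd (𝕜 := ℝ))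
  have f22 : HasFDerivAt (𝕜 := ℝ) (fun e : ESp ιR ιC => e.2.2) _ e :=
    (hasFDerivAt_snd (𝕜 := ℝ)).comp e (hasFDerivAt_snd (𝕜 := ℝ))
  have f12i : ∀ i, HasFDerivAt (𝕜 := ℝ) (fun e : ESp ιR ιC => e.1.2 i) 
      ((ContinuousLinearMap.proj (R := ℝ) (φ := fun _ : ιC => ℂ) i).comp
        ((ContinuousLinearMap.snd ℝ (ιR → ℝ) (ιC → ℂ)).comp (ContinuousLinearMap.fst ℝ (WSp ιR ιC) (ℝ × ℂ)))) e :=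
    fun i => (((ContinuousLinearMap.proj (R := ℝ) (φ := fun _ : ιC => ℂ) i).comp
        ((ContinuousLinearMap.snd ℝ (ιR → ℝ) (ιC → ℂ)).comp
          (ContinuousLinearMap.fst ℝ (WSp ιR ιC) (ℝ × ℂ))))).hasFDerivAt
  have f12' : HasFDerivAt (𝕜 := ℝ) (fun e : ESp ιR ιC => fun i => e.1.2 i ^ M) _ e :=
    hasFDerivAt_pi.2 fun i => (hp (e.1.2 i)).comp e (f12i i)
  have f22' : HasFDerivAt (𝕜 := ℝ) (fun e : ESp ιR ιC => e.2.2 ^ M) _ e :=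
    (hp e.2.2).comp e f22
  have H := (f11.prodMk f12').prodMk (f21.prodMk f22')
  refine H.congr_fderiv ?_
  apply ContinuousLinearMap.ext
  intro v
  rfl

lemma model_essential (M : ℕ) (hM : 0 < M) (ρ : ℝ) (hρ : 0 < ρ) :
    ∃ ε > 0, ∀ Φ : ESp ιR ιC → ESp ιR ιC, ContinuousOn Φ (closedBall 0 ρ) →
      (∀ x, ‖x‖ ≤ ρ → ‖Φ x - modelMap M x‖ < ε) → ∃ x, ‖x‖ ≤ ρ ∧ Φ x = 0 := by
  apply essential (modelMap M) _ _ _ _ _ ρ hρ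
  · unfold modelMap
    refine ContDiff.prodMk (ContDiff.prodMk ?_ ?_) (ContDiff.prodMk ?_ ?_)
    · fun_prop
    · rw [contDiff_pi]; intro i
      apply ContDiff.pow
      exact (contDiff_apply ℝ ℂ i).comp (contDiff_snd.comp contDiff_fst)
    · fun_prop
    · fun_prop
  · intro x
    rw [(modelMap_fderiv M x).fderiv]
    exact modelT_det_nonneg _ _
  · intro δ hδ
    have h2 : (((δ/2 : ℝ)) : ℂ) ≠ 0 := by exact_mod_cast (half_pos hδ).ne'
    have hM' : (M:ℂ) ≠ 0 := by exact_mod_cast hM.ne'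
    refine ⟨((0, fun _ => ((δ/2 : ℝ) : ℂ)), 0, ((δ/2 : ℝ) : ℂ)), ?_, ?_⟩
    · rw [Prod.norm_def, Prod.norm_def, Prod.norm_def]
      have h3 : ‖((δ/2 : ℝ) : ℂ)‖ < δ := by
        rw [Complex.norm_real, Real.norm_eq_abs, abs_of_pos (half_pos hδ)]; linarith
      refine max_lt (max_lt (by simpa using hδ) ?_) (max_lt (by simpa using hδ) h3)
      exact (pi_norm_lt_iff hδ).2 fun i => h3
    · rw [(modelMap_fderiv M _).fderiv]
      refine modelT_det_pos _ _ (fun i => ?_) ?_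
      · exact mul_ne_zero hM' (pow_ne_zero _ h2)
      · exact mul_ne_zero hM' (pow_ne_zero _ h2)
  · simp [modelMap, hM.ne']; rfl
  · rintro ⟨⟨v, ξ⟩, h, ζ⟩ hx
    simp only [modelMap, Prod.mk_eq_zero] at hx
    obtain ⟨⟨h1, h2⟩, h3, h4⟩ := hx
    have h5 : ξ = 0 := by
      ext i
      exact pow_eq_zero_iff hM.ne' |>.1 (congrFun h2 i)
    have h6 := (pow_eq_zero_iff hM.ne').1 h4
    subst h1 h5 h3 h6; rfl
end SecA3

section SecB
open ComplexConjugate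

def Thin (q : ℕ) (D : Type) [TopologicalSpace D] : Prop :=
  ∀ (F : Type) [NormedAddCommGroup F] [NormedSpace ℝ F] [FiniteDimensional ℝ F],
    q < Module.finrank ℝ F → ∀ g : D → F, Continuous g → ∀ ε > 0,
      ∃ g' : D → F, Continuous g' ∧ (∀ x, ‖g' x - g x‖ < ε) ∧ ∀ x, g' x ≠ 0

lemma thin_ball {E : Type} [NormedAddCommGroup E] [NormedSpace ℝ E] [FiniteDimensional ℝ E]
    (ρ : ℝ) (hρ : 0 < ρ) : Thin (Module.finrank ℝ E) (closedBall (0:E) ρ) := by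
  intro F _ _ _ hd g hg ε hε
  have hm : ∀ x : E, ret ρ x ∈ closedBall (0:E) ρ := fun x => by
    simpa using ret_norm ρ hρ x
  obtain ⟨g', h1, h2, h3⟩ := lemmaG hd (fun x => g ⟨ret ρ x, hm x⟩)
    (hg.comp ((ret_cont ρ).subtype_mk _)) 0 ε hε
  refine ⟨fun x => g' x, h1.comp continuous_subtype_val, fun x => ?_, fun x => h3 x⟩
  have := h2 x
  have hx : ret ρ (x:E) = x := ret_eq ρ hρ (x:E) (mem_closedBall_zero_iff.1 x.2)
  simpa only [hx] using this

variable {D : Type} [TopologicalSpace D] [CompactSpace D] [Nonempty D]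
variable {E' : Type} [NormedAddCommGroup E'] [NormedSpace ℝ E'] [FiniteDimensional ℝ E']
variable {ι : Type} [Fintype ι] [DecidableEq ι]

structure Rk (S : Finset ι) (W : D → E') (A : D → ι → ι → ℂ) : Prop where
  cW : Continuous W
  cA : Continuous A
  rk : ∀ x, ∃ y : ι → ℂ, ∀ i ∈ S, ∀ k ∈ S, A x i k = y i * conj (y k)
  nv : ∀ x, W x ≠ 0 ∨ ∃ i ∈ S, A x i i ≠ 0

lemma conj_diff_bound (a b c d : ℂ) (B e : ℝ) (he : 0 ≤ e) (he1 : e ≤ 1) (ha : ‖a‖ ≤ B) (hb : ‖b‖ ≤ B)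
    (hc : ‖c - a‖ ≤ e) (hd : ‖d - b‖ ≤ e) : ‖c * conj d - a * conj b‖ ≤ e * (2 * B + 1) := by
  have h : c * conj d - a * conj b = (c - a) * conj d + a * conj (d - b) := by
    rw [map_sub]; ring
  have hd' : ‖d‖ ≤ B + 1 := by
    calc ‖d‖ = ‖b + (d - b)‖ := by congr 1; ring
      _ ≤ ‖b‖ + ‖d - b‖ := norm_add_le _ _
      _ ≤ _ := by linarith
  rw [h]
  calc _ ≤ ‖(c - a) * conj d‖ + ‖a * conj (d - b)‖ := norm_add_le _ _
    _ = ‖c - a‖ * ‖d‖ + ‖a‖ * ‖d - b‖ := by rw [norm_mul, norm_mul, RCLike.norm_conj, RCLike.norm_conj]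
    _ ≤ e * (B + 1) + B * e := by gcongr; exact (norm_nonneg _).trans ha
    _ = _ := by ring

lemma stepC (q : ℕ) (hT : Thin q D) (hq : q < Module.finrank ℝ E' + 4) (i1 i2 : ι) (h12 : i1 ≠ i2)
    (S : Finset ι) (j : ι) (hj : j ∈ S) (hj1 : j ≠ i1) (hj2 : j ≠ i2) (h1 : i1 ∈ S) (h2 : i2 ∈ S)
    (W : D → E') (A : D → ι → ι → ℂ) (H : Rk S W A) (ε : ℝ) (hε : 0 < ε) :
    ∃ (W' : D → E') (A' : D → ι → ι → ℂ), Rk (S.erase j) W' A' ∧ (∀ x, ‖W' x - W x‖ < ε) ∧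
      ∀ x i k, ‖A' x i k - A x i k‖ < ε := by
  have cW := H.cW
  have cA := H.cA
  have cAik : ∀ i k, Continuous fun x => A x i k := fun i k => by fun_prop
  set N : D → ℝ := fun x => ‖W x‖ + ∑ i ∈ S.erase j, ‖A x i i‖ with hN
  have cN : Continuous N := by
    refine cW.norm.add (continuous_finsetSum _ fun i _ => (cAik i i).norm)
  have N0 : ∀ x, 0 ≤ N x := fun x => by positivity
  obtain ⟨δ, hδ, hδ'⟩ : ∃ δ > 0, ∀ x, N x ≤ δ → δ ≤ ‖A x j j‖ := by
    obtain ⟨x0, -, hmin⟩ := isCompact_univ.exists_isMinOn (univ_nonempty (α := D))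
      ((cN.max (cAik j j).norm).continuousOn)
    have hpos : 0 < max (N x0) ‖A x0 j j‖ := by
      rcases H.nv x0 with h | ⟨i, hi, h⟩
      · refine lt_max_of_lt_left ?_
        have : 0 < ‖W x0‖ := norm_pos_iff.2 h
        have : 0 ≤ ∑ i ∈ S.erase j, ‖A x0 i i‖ := by positivity
        simp only [hN]; linarith
      · by_cases hij : i = j
        · subst hij
          exact lt_max_of_lt_right (norm_pos_iff.2 h)
        · refine lt_max_of_lt_left ?_
          have h3 : ‖A x0 i i‖ ≤ ∑ i ∈ S.erase j, ‖A x0 i i‖ :=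
            Finset.single_le_sum (f := fun i => ‖A x0 i i‖) (fun _ _ => norm_nonneg _)
              (Finset.mem_erase.2 ⟨hij, hi⟩)
          have : 0 < ‖A x0 i i‖ := norm_pos_iff.2 h
          have := norm_nonneg (W x0)
          simp only [hN]; linarith
    refine ⟨max (N x0) ‖A x0 j j‖ / 2, by positivity, fun x hx => ?_⟩
    have h4 : max (N x0) ‖A x0 j j‖ ≤ max (N x) ‖A x j j‖ := hmin (mem_univ x)
    rcases le_max_iff.1 h4 with h5 | h5
    · linarith
    · linarith
  set ã : D → ι → ℂ := fun x i => A x i j / ((Real.sqrt (max ‖A x j j‖ δ) : ℝ) : ℂ) with hã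
  have sq0 : ∀ x, 0 < Real.sqrt (max ‖A x j j‖ δ) := fun x =>
    Real.sqrt_pos.2 (lt_max_of_lt_right hδ)
  have cã : ∀ i, Continuous fun x => ã x i := fun i => by
    refine (cAik i j).div ?_ (fun x => by exact_mod_cast (sq0 x).ne')
    exact Complex.continuous_ofReal.comp (Real.continuous_sqrt.comp ((cAik j j).norm.max continuous_const))
  have ãeq : ∀ x, N x ≤ δ → ∀ i ∈ S, ∀ k ∈ S, ã x i * conj (ã x k) = A x i k := by
    intro x hx i hi k hk
    obtain ⟨y, hy⟩ := H.rk x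
    have hd := hδ' x hx
    have e1 : max ‖A x j j‖ δ = ‖A x j j‖ := max_eq_left hd
    have e2 : ‖A x j j‖ = ‖y j‖ ^ 2 := by rw [hy j hj j hj, norm_mul, RCLike.norm_conj, sq]
    have e3 : Real.sqrt (max ‖A x j j‖ δ) = ‖y j‖ := by
      rw [e1, e2, Real.sqrt_sq (norm_nonneg _)]
    have e4 : (‖y j‖ : ℂ) ≠ 0 := by
      have := (sq0 x).ne'
      rw [e3] at this; exact_mod_cast this
    have e5 : y j * conj (y j) = (‖y j‖ : ℂ) ^ 2 := Complex.mul_conj' _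
    simp only [hã]
    rw [e3, hy i hi j hj, hy k hk j hj, hy i hi k hk, map_div₀, Complex.conj_ofReal, map_mul,
      Complex.conj_conj]
    field_simp
    linear_combination (y i * conj (y k)) * e5
  obtain ⟨B, hB0, hB⟩ : ∃ B : ℝ, 0 ≤ B ∧ ∀ x i, ‖ã x i‖ ≤ B := by
    have : Continuous fun x => ‖ã x‖ := (continuous_pi cã).norm
    obtain ⟨x0, -, hmax⟩ := isCompact_univ.exists_isMaxOn (univ_nonempty (α := D)) this.continuousOn
    refine ⟨‖ã x0‖, norm_nonneg _, fun x i => (norm_le_pi_norm (ã x) i).trans (hmax (mem_univ x))⟩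
  set m : ℝ := (S.erase j).card + 1 with hm
  have hmpos : 0 < m := by positivity
  set θ : ℝ := min ε (δ / (4 * m)) with hθ
  have hθpos : 0 < θ := lt_min hε (by positivity)
  set ε' : ℝ := min 1 (θ / (2 * B + 2)) with hε'
  have hε'pos : 0 < ε' := lt_min one_pos (by positivity)
  have hε'1 : ε' ≤ 1 := min_le_left _ _
  have hε'2 : ε' * (2 * B + 2) ≤ θ := by
    have : ε' ≤ θ / (2 * B + 2) := min_le_right _ _
    rwa [le_div_iff₀ (by positivity)] at this
  have hfin : q < Module.finrank ℝ (E' × ℂ × ℂ) := by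
    rw [Module.finrank_prod, Module.finrank_prod, Complex.finrank_real_complex]
    omega
  obtain ⟨b, cb, hbd, hbn⟩ := hT (E' × ℂ × ℂ) hfin (fun x => (W x, ã x i1, ã x i2))
    (cW.prodMk ((cã i1).prodMk (cã i2))) ε' hε'pos
  have hb1 : ∀ x, ‖(b x).1 - W x‖ ≤ ε' := fun x => (norm_fst_le (b x - (W x, ã x i1, ã x i2))).trans (hbd x).le
  have hb2 : ∀ x, ‖(b x).2.1 - ã x i1‖ ≤ ε' := fun x =>
    ((norm_fst_le _).trans (norm_snd_le (b x - (W x, ã x i1, ã x i2)))).trans (hbd x).le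
  have hb3 : ∀ x, ‖(b x).2.2 - ã x i2‖ ≤ ε' := fun x =>
    ((norm_snd_le _).trans (norm_snd_le (b x - (W x, ã x i1, ã x i2)))).trans (hbd x).le
  set χ : D → ℝ := fun x => max 0 (min 1 (2 - 2 * N x / δ)) with hχ
  have cχ : Continuous χ := by
    refine continuous_const.max (continuous_const.min (continuous_const.sub ?_))
    exact (continuous_const.mul cN).div_const _
  have χ0 : ∀ x, 0 ≤ χ x := fun x => le_max_left _ _
  have χ1 : ∀ x, χ x ≤ 1 := fun x => max_le zero_le_one (min_le_left _ _)
  have χz : ∀ x, δ < N x → χ x = 0 := by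
    intro x hx
    refine max_eq_left ((min_le_right _ _).trans ?_)
    rw [sub_nonpos, le_div_iff₀ hδ]; linarith
  have χo : ∀ x, N x ≤ δ / 2 → χ x = 1 := by
    intro x hx
    have : 2 * N x / δ ≤ 1 := by rw [div_le_iff₀ hδ]; linarith
    simp only [hχ]
    rw [min_eq_left (by linarith), max_eq_right zero_le_one]
  have smul_small : ∀ {V : Type} [NormedAddCommGroup V] [NormedSpace ℝ V] (x : D) (v : V),
      ‖v‖ ≤ ε' → ‖χ x • v‖ ≤ ε' := by
    intro V _ _ x v hv
    rw [norm_smul, Real.norm_eq_abs, abs_of_nonneg (χ0 x)]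
    calc χ x * ‖v‖ ≤ 1 * ε' := by gcongr; exact χ1 x
      _ = ε' := one_mul _
  set W' : D → E' := fun x => W x + χ x • ((b x).1 - W x) with hW'
  set c : D → ι → ℂ := fun x i => if i = i1 then ã x i1 + χ x • ((b x).2.1 - ã x i1) else
    if i = i2 then ã x i2 + χ x • ((b x).2.2 - ã x i2) else ã x i with hc
  have cc : ∀ i, Continuous fun x => c x i := by
    intro i
    simp only [hc]
    split_ifs
    · exact (cã i1).add (cχ.smul ((cb.snd.fst).sub (cã i1)))
    · exact (cã i2).add (cχ.smul ((cb.snd.snd).sub (cã i2)))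
    · exact cã i
  have hcd : ∀ x i, ‖c x i - ã x i‖ ≤ ε' := by
    intro x i
    simp only [hc]
    split_ifs with ha hb
    · subst ha; rw [add_sub_cancel_left]; exact smul_small x _ (hb2 x)
    · subst hb; rw [add_sub_cancel_left]; exact smul_small x _ (hb3 x)
    · simp [hε'pos.le]
  have hczero : ∀ x, χ x = 0 → c x = ã x := by
    intro x hx
    ext i
    simp only [hc, hx, zero_smul, add_zero]
    split_ifs with ha hb
    · rw [ha]
    · rw [hb]
    · rfl
  set A' : D → ι → ι → ℂ := fun x i k => A x i k + (c x i * conj (c x k) - ã x i * conj (ã x k)) with hA'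
  have dW : ∀ x, ‖W' x - W x‖ < θ := by
    intro x
    have : ‖W' x - W x‖ ≤ ε' := by
      simp only [hW']; rw [add_sub_cancel_left]; exact smul_small x _ (hb1 x)
    nlinarith
  have dA : ∀ x i k, ‖A' x i k - A x i k‖ < θ := by
    intro x i k
    have : ‖A' x i k - A x i k‖ ≤ ε' * (2 * B + 1) := by
      simp only [hA']; rw [add_sub_cancel_left]
      exact conj_diff_bound _ _ _ _ B ε' hε'pos.le hε'1 (hB x i) (hB x k) (hcd x i) (hcd x k)
    nlinarith
  have A'eq : ∀ x, N x ≤ δ → ∀ i ∈ S, ∀ k ∈ S, A' x i k = c x i * conj (c x k) := by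
    intro x hx i hi k hk
    simp only [hA']
    rw [ãeq x hx i hi k hk]; ring
  refine ⟨W', A', ⟨?_, ?_, ?_, ?_⟩, fun x => (dW x).trans_le (min_le_left _ _),
    fun x i k => (dA x i k).trans_le (min_le_left _ _)⟩
  · exact cW.add (cχ.smul (cb.fst.sub cW))
  · refine continuous_pi fun i => continuous_pi fun k => ?_
    refine (cAik i k).add (((cc i).mul (Complex.continuous_conj.comp (cc k))).sub
      ((cã i).mul (Complex.continuous_conj.comp (cã k))))
  · intro x
    rcases le_or_gt (N x) δ with hx | hx
    · exact ⟨c x, fun i hi k hk => A'eq x hx i (Finset.mem_of_mem_erase hi) k (Finset.mem_of_mem_erase hk)⟩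
    · obtain ⟨y, hy⟩ := H.rk x
      refine ⟨y, fun i hi k hk => ?_⟩
      simp only [hA']
      rw [hczero x (χz x hx), sub_self, add_zero]
      exact hy i (Finset.mem_of_mem_erase hi) k (Finset.mem_of_mem_erase hk)
  · intro x
    rcases le_or_gt (N x) (δ/2) with hx | hx
    · by_contra hcon
      push Not at hcon
      obtain ⟨hw, ha⟩ := hcon
      have hxδ : N x ≤ δ := by linarith
      have hone := χo x hx
      apply hbn x
      have e1 := ha i1 (Finset.mem_erase.2 ⟨hj1.symm, h1⟩)
      have e2 := ha i2 (Finset.mem_erase.2 ⟨hj2.symm, h2⟩)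
      rw [A'eq x hxδ i1 h1 i1 h1, Complex.mul_conj'] at e1
      rw [A'eq x hxδ i2 h2 i2 h2, Complex.mul_conj'] at e2
      have e1' : c x i1 = 0 := by simpa using e1
      have e2' : c x i2 = 0 := by simpa using e2
      simp only [hc, hone, one_smul, if_true, add_sub_cancel] at e1'
      simp only [hc, hone, one_smul, if_neg h12.symm, if_true, add_sub_cancel] at e2'
      simp only [hW', hone, one_smul, add_sub_cancel] at hw
      refine Prod.ext hw (Prod.ext e1' e2')
    · by_contra hcon
      push Not at hcon
      obtain ⟨hw, ha⟩ := hcon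
      have k1 : ‖W x‖ ≤ θ := by
        have := dW x; rw [hw, zero_sub, norm_neg] at this; exact this.le
      have k2 : ∑ i ∈ S.erase j, ‖A x i i‖ ≤ ∑ i ∈ S.erase j, θ := by
        refine Finset.sum_le_sum fun i hi => ?_
        have := dA x i i; rw [ha i hi, zero_sub, norm_neg] at this; exact this.le
      rw [Finset.sum_const, nsmul_eq_mul] at k2
      have k3 : N x ≤ m * θ := by simp only [hN, hm]; linarith
      have k4 : θ * (4 * m) ≤ δ := by
        have : θ ≤ δ / (4 * m) := min_le_right _ _
        rwa [le_div_iff₀ (by positivity)] at this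
      linarith

lemma lemmaC_aux (q : ℕ) (hT : Thin q D) (hq : q < Module.finrank ℝ E' + 4) (i1 i2 : ι) (h12 : i1 ≠ i2)
    (s : ℕ) : ∀ (S : Finset ι) (_ : S.card = s + 2) (_ : i1 ∈ S) (_ : i2 ∈ S)
    (W : D → E') (A : D → ι → ι → ℂ) (_ : Rk S W A) (ε : ℝ) (_ : 0 < ε),
    ∃ (W' : D → E') (A' : D → ι → ι → ℂ), Rk {i1, i2} W' A' ∧ (∀ x, ‖W' x - W x‖ < ε) ∧
      ∀ x i k, ‖A' x i k - A x i k‖ < ε := by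
  induction s with
  | zero =>
    intro S hS h1 h2 W A H ε hε
    have : S = {i1, i2} := by
      symm
      apply Finset.eq_of_subset_of_card_le
      · intro i hi
        simp only [Finset.mem_insert, Finset.mem_singleton] at hi
        rcases hi with rfl | rfl <;> assumption
      · rw [hS, Finset.card_pair h12]
    subst this
    exact ⟨W, A, H, fun x => by simpa using hε, fun x i k => by simpa using hε⟩
  | succ s ih =>
    intro S hS h1 h2 W A H ε hε
    obtain ⟨j, hj, hj1, hj2⟩ : ∃ j ∈ S, j ≠ i1 ∧ j ≠ i2 := by
      have : ((S.erase i1).erase i2).card = s + 1 := by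
        rw [Finset.card_erase_of_mem (Finset.mem_erase.2 ⟨h12.symm, h2⟩), Finset.card_erase_of_mem h1, hS]
        omega
      obtain ⟨j, hj⟩ := Finset.card_pos.1 (by rw [this]; omega)
      simp only [Finset.mem_erase] at hj
      exact ⟨j, hj.2.2, hj.2.1, hj.1⟩
    obtain ⟨W1, A1, H1, d1, d2⟩ := stepC q hT hq i1 i2 h12 S j hj hj1 hj2 h1 h2 W A H (ε/2) (half_pos hε)
    obtain ⟨W2, A2, H2, d3, d4⟩ := ih (S.erase j) (by rw [Finset.card_erase_of_mem hj, hS]; omega)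
      (Finset.mem_erase.2 ⟨hj1.symm, h1⟩) (Finset.mem_erase.2 ⟨hj2.symm, h2⟩) W1 A1 H1 (ε/2) (half_pos hε)
    refine ⟨W2, A2, H2, fun x => ?_, fun x i k => ?_⟩
    · have := norm_sub_le_norm_sub_add_norm_sub (W2 x) (W1 x) (W x)
      linarith [d1 x, d3 x]
    · have := norm_sub_le_norm_sub_add_norm_sub (A2 x i k) (A1 x i k) (A x i k)
      linarith [d2 x i k, d4 x i k]

def finalMap (i1 i2 : ι) (W : E') (A : ι → ι → ℂ) : E' × ℝ × ℂ :=
  (W, (A i1 i1 - A i2 i2).re, A i2 i1)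

lemma lemmaC (q : ℕ) (hT : Thin q D) (hq : q < Module.finrank ℝ E' + 4) (i1 i2 : ι) (h12 : i1 ≠ i2)
    (S : Finset ι) (h1 : i1 ∈ S) (h2 : i2 ∈ S)
    (W : D → E') (A : D → ι → ι → ℂ) (H : Rk S W A) (ε : ℝ) (hε : 0 < ε) :
    ∃ Φ : D → E' × ℝ × ℂ, Continuous Φ ∧ (∀ x, Φ x ≠ 0) ∧
      ∀ x, ‖Φ x - finalMap i1 i2 (W x) (A x)‖ < ε := by
  have hcard : 2 ≤ S.card := by
    rw [← Finset.card_pair h12]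
    apply Finset.card_le_card
    intro i hi
    simp only [Finset.mem_insert, Finset.mem_singleton] at hi
    rcases hi with rfl | rfl <;> assumption
  obtain ⟨W', A', H', d1, d2⟩ := lemmaC_aux q hT hq i1 i2 h12 (S.card - 2) S (by omega) h1 h2 W A H
    (ε/3) (by positivity)
  have cA := H'.cA
  have cW := H'.cW
  refine ⟨fun x => finalMap i1 i2 (W' x) (A' x), ?_, fun x hx => ?_, fun x => ?_⟩
  · unfold finalMap
    refine cW.prodMk (Continuous.prodMk ?_ ?_)
    · exact Complex.continuous_re.comp (by fun_prop)
    · fun_prop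
  · obtain ⟨y, hy⟩ := H'.rk x
    simp only [finalMap, Prod.mk_eq_zero] at hx
    obtain ⟨hw, hr, hz⟩ := hx
    rw [hy i1 (by simp) i1 (by simp), hy i2 (by simp) i2 (by simp), Complex.mul_conj', Complex.mul_conj'] at hr
    rw [hy i2 (by simp) i1 (by simp)] at hz
    have hr' : ‖y i1‖ ^ 2 - ‖y i2‖ ^ 2 = 0 := by
      rw [← Complex.ofReal_re (‖y i1‖ ^ 2 - ‖y i2‖ ^ 2), ← hr]; push_cast; rfl
    have hy0 : y i1 = 0 ∧ y i2 = 0 := by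
      rcases mul_eq_zero.1 hz with h | h
      · rw [h] at hr'
        refine ⟨by simpa using hr', h⟩
      · have h : y i1 = 0 := by simpa using h
        rw [h] at hr'
        refine ⟨h, by simpa using hr'⟩
    rcases H'.nv x with h | ⟨i, hi, h⟩
    · exact h hw
    · apply h
      rw [hy i hi i hi]
      simp only [Finset.mem_insert, Finset.mem_singleton] at hi
      rcases hi with rfl | rfl
      · rw [hy0.1, zero_mul]
      · rw [hy0.2, zero_mul]
  · have e : finalMap i1 i2 (W' x) (A' x) - finalMap i1 i2 (W x) (A x)
      = (W' x - W x, ((A' x i1 i1 - A x i1 i1) - (A' x i2 i2 - A x i2 i2)).re, A' x i2 i1 - A x i2 i1) := by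
      simp only [finalMap, Prod.mk_sub_mk]
      congr 2
      simp only [Complex.sub_re]; ring
    rw [e, Prod.norm_def, Prod.norm_def]
    have t1 : |((A' x i1 i1 - A x i1 i1) - (A' x i2 i2 - A x i2 i2)).re| < ε := by
      refine (Complex.abs_re_le_norm _).trans_lt ((norm_sub_le _ _).trans_lt ?_)
      linarith [d2 x i1 i1, d2 x i2 i2]
    refine max_lt (by linarith [d1 x]) (max_lt t1 (by linarith [d2 x i2 i1]))
end SecB

section SecC
open ComplexConjugate

/-- A local chart inverse. -/
def chInv {X : Type} [TopologicalSpace X] {d : ℕ} (p : X) {U : Set X} {V : Set (EuclideanSpace ℝ (Fin d))}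
    (h : U ≃ₜ V) (v : EuclideanSpace ℝ (Fin d)) : X :=
  open Classical in if hv : v ∈ V then (h.symm ⟨v, hv⟩ : X) else p

lemma chInv_cont {X : Type} [TopologicalSpace X] {d : ℕ} (p : X) {U : Set X}
    {V : Set (EuclideanSpace ℝ (Fin d))} (h : U ≃ₜ V) : ContinuousOn (chInv p h) V := by
  rw [continuousOn_iff_continuous_domRestrict]
  have : V.domRestrict (chInv p h) = fun v => (h.symm v : X) := by
    ext v
    simp [Set.domRestrict, chInv]
  rw [this]
  fun_prop

lemma chInv_mem {X : Type} [TopologicalSpace X] {d : ℕ} (p : X) {U : Set X}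
    {V : Set (EuclideanSpace ℝ (Fin d))} (h : U ≃ₜ V) {v} (hv : v ∈ V) : chInv p h v ∈ U := by
  simp [chInv, hv]

lemma chInv_eq {X : Type} [TopologicalSpace X] {d : ℕ} (p : X) {U : Set X}
    {V : Set (EuclideanSpace ℝ (Fin d))} (h : U ≃ₜ V) {x : X} (hx : x ∈ U) :
    chInv p h (h ⟨x, hx⟩) = x := by
  simp [chInv]

lemma chInv_eq' {X : Type} [TopologicalSpace X] {d : ℕ} (p : X) {U : Set X}
    {V : Set (EuclideanSpace ℝ (Fin d))} (h : U ≃ₜ V) {v} (hv : v ∈ V) :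
    h ⟨chInv p h v, chInv_mem p h hv⟩ = ⟨v, hv⟩ := by
  apply h.symm.injective
  rw [Homeomorph.symm_apply_apply]
  apply Subtype.ext
  simp [chInv, hv]

theorem abstract_contra {X : Type} [TopologicalSpace X] {d : ℕ} (p : X) (U : Set X)
    (V : Set (EuclideanSpace ℝ (Fin d))) (hU : IsOpen U) (hV : IsOpen V) (hp : p ∈ U) (h : U ≃ₜ V)
    {ιR ιC ι : Type} [Fintype ιR] [Fintype ιC] [Fintype ι] [DecidableEq ι]
    (hd : Module.finrank ℝ (ESp ιR ιC) < d)
    (f : ESp ιR ιC → X) (hf : Continuous f) (hf0 : f 0 = p) (O : Set X) (hO : IsOpen O) (hpO : p ∈ O)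
    (W : X → WSp ιR ιC) (A : X → ι → ι → ℂ) (hW : ContinuousOn W O) (hA : ContinuousOn A O)
    (S : Finset ι) (i1 i2 : ι) (h12 : i1 ≠ i2) (h1 : i1 ∈ S) (h2 : i2 ∈ S)
    (hrk : ∀ x ∈ O, ∃ y : ι → ℂ, ∀ i ∈ S, ∀ k ∈ S, A x i k = y i * conj (y k))
    (hz : ∀ x ∈ O, W x = 0 → (∀ i ∈ S, A x i i = 0) → x = p)
    (M : ℕ) (hM : 0 < M) (ρ0 : ℝ) (hρ0 : 0 < ρ0)
    (hmod : ∀ e, ‖e‖ ≤ ρ0 → finalMap i1 i2 (W (f e)) (A (f e)) = modelMap M e) : False := by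
  obtain ⟨ρ, hρ, hρρ, hball⟩ : ∃ ρ > 0, ρ ≤ ρ0 ∧ ∀ e, ‖e‖ ≤ ρ → f e ∈ U ∩ O := by
    have : f ⁻¹' (U ∩ O) ∈ nhds (0 : ESp ιR ιC) :=
      (hf.isOpen_preimage _ (hU.inter hO)).mem_nhds (by simp [hf0, hp, hpO])
    obtain ⟨r, hr, hb⟩ := Metric.nhds_basis_closedBall.mem_iff.1 this
    refine ⟨min r ρ0, lt_min hr hρ0, min_le_right _ _, fun e he => hb ?_⟩
    rw [mem_closedBall_zero_iff]; exact he.trans (min_le_left _ _)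
  let D : Type := closedBall (0 : ESp ιR ιC) ρ
  haveI : CompactSpace D := isCompact_iff_compactSpace.1 (isCompact_closedBall _ _)
  haveI : Nonempty D := ⟨⟨0, by simp [hρ.le]⟩⟩
  have hDn : ∀ x : D, ‖(x : ESp ιR ιC)‖ ≤ ρ := fun x => mem_closedBall_zero_iff.1 x.2
  obtain ⟨ε, hε, hess⟩ := model_essential (ιR := ιR) (ιC := ιC) M hM ρ hρ
  let g0 : D → EuclideanSpace ℝ (Fin d) := fun x => h ⟨f x, (hball x (hDn x)).1⟩
  have cg0 : Continuous g0 := by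
    refine continuous_subtype_val.comp (h.continuous.comp ?_)
    exact (hf.comp continuous_subtype_val).subtype_mk _
  let V' : Set (EuclideanSpace ℝ (Fin d)) := V ∩ chInv p h ⁻¹' O
  have hV' : IsOpen V' := (chInv_cont p h).isOpen_inter_preimage hV hO
  let Ψ : EuclideanSpace ℝ (Fin d) → ESp ιR ιC := fun v =>
    finalMap i1 i2 (W (chInv p h v)) (A (chInv p h v))
  have cWh : ContinuousOn (fun v => W (chInv p h v)) V' :=
    hW.comp ((chInv_cont p h).mono inter_subset_left) (fun v hv => hv.2)
  have cAh : ContinuousOn (fun v => A (chInv p h v)) V' :=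
    hA.comp ((chInv_cont p h).mono inter_subset_left) (fun v hv => hv.2)
  have cAik : ∀ i k, ContinuousOn (fun v => A (chInv p h v) i k) V' := fun i k =>
    (continuous_apply k).comp_continuousOn ((continuous_apply i).comp_continuousOn cAh)
  have cΨ : ContinuousOn Ψ V' := by
    refine cWh.prodMk (ContinuousOn.prodMk ?_ (cAik i2 i1))
    exact Complex.continuous_re.comp_continuousOn ((cAik i1 i1).sub (cAik i2 i2))
  have hg0V : ∀ x, g0 x ∈ V' := by
    intro x
    refine ⟨(h _).2, ?_⟩
    change chInv p h (h _) ∈ O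
    rw [chInv_eq]
    exact (hball x (hDn x)).2
  have hK : IsCompact (range g0) := isCompact_range cg0
  have hKV : range g0 ⊆ V' := by rintro _ ⟨x, rfl⟩; exact hg0V x
  obtain ⟨η1, hη1, hthick⟩ := hK.exists_thickening_subset_open hV' hKV
  have hunif := hK.uniformContinuousAt_of_continuousAt Ψ
    (fun a ha => cΨ.continuousAt (hV'.mem_nhds (hKV ha))) (Metric.dist_mem_uniformity (half_pos hε))
  obtain ⟨η2, hη2, hunif'⟩ := Metric.mem_uniformity_dist.1 hunif
  have hthin := thin_ball (E := ESp ιR ιC) ρ hρ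
  obtain ⟨g1, cg1, dg1, ng1⟩ := hthin (EuclideanSpace ℝ (Fin d)) (by simpa using hd)
    (fun x => g0 x - h ⟨p, hp⟩) (cg0.sub continuous_const) (min η1 η2) (lt_min hη1 hη2)
  let g : D → EuclideanSpace ℝ (Fin d) := fun x => g1 x + h ⟨p, hp⟩
  have cg : Continuous g := cg1.add continuous_const
  have dg : ∀ x, dist (g0 x) (g x) < min η1 η2 := by
    intro x
    rw [dist_comm, dist_eq_norm]
    have := dg1 x
    rwa [show g1 x - (g0 x - (h ⟨p, hp⟩ : EuclideanSpace ℝ (Fin d))) = g x - g0 x by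
      simp only [g]; abel] at this
  have hgV : ∀ x, g x ∈ V' := by
    intro x
    apply hthick
    rw [Metric.mem_thickening_iff]
    refine ⟨g0 x, mem_range_self x, ?_⟩
    rw [dist_comm]; exact (dg x).trans_le (min_le_left _ _)
  have hgp : ∀ x, chInv p h (g x) ≠ p := by
    intro x hx
    have h3 := chInv_eq' p h (hgV x).1
    have h4 : (h ⟨p, hp⟩ : EuclideanSpace ℝ (Fin d)) = g x := by
      have h5 : (⟨p, hp⟩ : U) = ⟨chInv p h (g x), chInv_mem p h (hgV x).1⟩ := Subtype.ext hx.symm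
      rw [h5]
      exact congrArg Subtype.val h3
    apply ng1 x
    have : g1 x + (h ⟨p, hp⟩ : EuclideanSpace ℝ (Fin d)) = h ⟨p, hp⟩ := h4.symm
    simpa using this
  have hdim : Module.finrank ℝ (ESp ιR ιC) < Module.finrank ℝ (WSp ιR ιC) + 4 := by
    rw [Module.finrank_prod, Module.finrank_prod (M := ℝ), Complex.finrank_real_complex, Module.finrank_self]
    omega
  have hRk : Rk (D := D) S (fun x => W (chInv p h (g x))) (fun x => A (chInv p h (g x))) :=
    { cW := cWh.comp_continuous cg hgV
      cA := cAh.comp_continuous cg hgV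
      rk := fun x => hrk _ (hgV x).2
      nv := fun x => by
        by_contra hcon
        push Not at hcon
        exact hgp x (hz _ (hgV x).2 hcon.1 hcon.2) }
  obtain ⟨Φ, cΦ, nΦ, dΦ⟩ := lemmaC _ hthin hdim i1 i2 h12 S h1 h2 _ _ hRk (ε/2) (half_pos hε)
  classical
  obtain ⟨x, hx, hx0⟩ := hess (fun x => if hx : x ∈ closedBall (0 : ESp ιR ιC) ρ then Φ ⟨x, hx⟩ else 0) (by
      rw [continuousOn_iff_continuous_domRestrict]
      convert cΦ using 1
      ext1 x
      simp only [Set.domRestrict_apply]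
      rw [dif_pos x.2]) (by
      intro x hx
      have hx' : x ∈ closedBall (0 : ESp ιR ιC) ρ := mem_closedBall_zero_iff.2 hx
      rw [dif_pos hx']
      have k1 := dΦ ⟨x, hx'⟩
      have k2 : dist (Ψ (g0 ⟨x, hx'⟩)) (Ψ (g ⟨x, hx'⟩)) < ε / 2 :=
        hunif' ((dg ⟨x, hx'⟩).trans_le (min_le_right _ _)) (mem_range_self _)
      have k3 : Ψ (g0 ⟨x, hx'⟩) = modelMap M x := by
        rw [← hmod x (hx.trans hρρ)]
        simp only [Ψ, g0]
        rw [chInv_eq]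
      rw [k3, dist_comm, dist_eq_norm] at k2
      have := norm_sub_le_norm_sub_add_norm_sub (Φ ⟨x, hx'⟩) (Ψ (g ⟨x, hx'⟩)) (modelMap M x)
      have k1' : ‖Φ ⟨x, hx'⟩ - Ψ (g ⟨x, hx'⟩)‖ < ε / 2 := k1
      linarith)
  have hx' : x ∈ closedBall (0 : ESp ιR ιC) ρ := mem_closedBall_zero_iff.2 hx
  rw [dif_pos hx'] at hx0
  exact nΦ _ hx0

/-- A point of a manifold cannot be avoided by maps close to the identity. -/
theorem abstract_contra1 {X : Type} [TopologicalSpace X] {d : ℕ} (p : X) (U : Set X)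
    (V : Set (EuclideanSpace ℝ (Fin d))) (hU : IsOpen U) (hV : IsOpen V) (hp : p ∈ U) (h : U ≃ₜ V)
    (P : X → ℝ → X) (hP : Continuous (fun q : X × ℝ => P q.1 q.2)) (hP0 : ∀ x, P x 0 = x)
    (hPp : ∀ x s, 0 < s → P x s ≠ p) : False := by
  let E := EuclideanSpace ℝ (Fin d)
  let v0 : E := h ⟨p, hp⟩
  have hv0 : v0 ∈ V := (h _).2
  obtain ⟨ρ, hρ, hρV⟩ := Metric.nhds_basis_closedBall.mem_iff.1 (hV.mem_nhds hv0)
  obtain ⟨ε, hε, hess⟩ := essential (E := E) id contDiff_id (fun x => by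
      rw [fderiv_id]
      have : (ContinuousLinearMap.id ℝ E).det = 1 := LinearMap.det_id
      rw [this]; exact zero_le_one) (fun δ hδ => ⟨0, by simpa using hδ, by
      rw [fderiv_id]
      have : (ContinuousLinearMap.id ℝ E).det = 1 := LinearMap.det_id
      rw [this]; exact zero_lt_one⟩) rfl (fun x hx => hx) ρ hρ
  let K : Set E := closedBall v0 ρ
  have hK : IsCompact K := isCompact_closedBall _ _
  -- the set of good (v, s)
  let Q : E × ℝ → X := fun q => P (chInv p h q.1) q.2
  have cQ : ContinuousOn Q (V ×ˢ univ) := by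
    refine hP.comp_continuousOn (g := fun q : X × ℝ => P q.1 q.2) (f := fun q : E × ℝ => (chInv p h q.1, q.2)) ?_
    refine ContinuousOn.prodMk ?_ continuousOn_snd
    exact (chInv_cont p h).comp continuousOn_fst (fun q hq => hq.1)
  let Hh : X → E := fun x => open Classical in if hx : x ∈ U then h ⟨x, hx⟩ else 0
  have cH : ContinuousOn Hh U := by
    rw [continuousOn_iff_continuous_domRestrict]
    have : U.domRestrict Hh = fun v => (h v : E) := by
      ext1 v
      simp [Set.domRestrict, Hh]
    rw [this]
    exact continuous_subtype_val.comp h.continuous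
  have hHinj : ∀ x ∈ U, Hh x = v0 → x = p := by
    intro x hx he
    simp only [Hh, hx, dif_pos, v0] at he
    have := h.injective (Subtype.ext he)
    exact congrArg Subtype.val this
  let G : Set (E × ℝ) := (V ×ˢ univ) ∩ Q ⁻¹' U
  have hG : IsOpen G := cQ.isOpen_inter_preimage (hV.prod isOpen_univ) hU
  have cHQ : ContinuousOn (fun q => Hh (Q q)) G :=
    cH.comp (cQ.mono inter_subset_left) (fun q hq => hq.2)
  let G' : Set (E × ℝ) := G ∩ (fun q => Hh (Q q) - q.1) ⁻¹' (ball 0 ε)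
  have hG' : IsOpen G' := by
    refine ContinuousOn.isOpen_inter_preimage (cHQ.sub continuousOn_fst) hG isOpen_ball
  have hmem : ∀ v ∈ K, (v, (0:ℝ)) ∈ G' := by
    intro v hv
    have hvV : v ∈ V := hρV hv
    have hQ : Q (v, 0) = chInv p h v := hP0 _
    have hQU : Q (v, 0) ∈ U := by rw [hQ]; exact chInv_mem p h hvV
    refine ⟨⟨⟨hvV, mem_univ _⟩, hQU⟩, ?_⟩
    have : Hh (Q (v, 0)) = v := by
      rw [hQ]
      simp only [Hh, chInv_mem p h hvV, dif_pos]
      rw [chInv_eq' p h hvV]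
    change Hh (Q (v, 0)) - v ∈ ball 0 ε
    rw [this, sub_self]
    exact mem_ball_self hε
  obtain ⟨A, B, hA, hB, hKA, h0B, hAB⟩ := generalized_tube_lemma hK (isCompact_singleton (x := (0:ℝ))) hG'
    (by rintro ⟨v, s⟩ ⟨hv, hs⟩; obtain rfl : s = 0 := hs; exact hmem v hv)
  obtain ⟨s, hs, hsB⟩ : ∃ s > 0, s ∈ B := by
    obtain ⟨r, hr, hrb⟩ := Metric.isOpen_iff.1 hB 0 (h0B rfl)
    refine ⟨r/2, half_pos hr, hrb ?_⟩
    rw [mem_ball_zero_iff, Real.norm_eq_abs, abs_of_pos (half_pos hr)]; linarith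
  have hgood : ∀ v ∈ K, (v, s) ∈ G' := fun v hv => hAB ⟨hKA hv, hsB⟩
  have hsh : ∀ x : E, ‖x‖ ≤ ρ → x + v0 ∈ K := fun x hx => by
    rw [mem_closedBall, dist_eq_norm, add_sub_cancel_right]; exact hx
  obtain ⟨x, hx, hx0⟩ := hess (fun x => Hh (Q (x + v0, s)) - v0) (by
      refine ContinuousOn.sub ?_ continuousOn_const
      refine cHQ.comp (f := fun x : E => (x + v0, s)) (by fun_prop) ?_
      intro x hx
      exact (hgood _ (hsh x (mem_closedBall_zero_iff.1 hx))).1) (by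
      intro x hx
      have := (hgood _ (hsh x hx)).2
      change Hh (Q (x + v0, s)) - (x + v0) ∈ ball 0 ε at this
      rw [mem_ball_zero_iff] at this
      simp only [id]
      rwa [sub_sub, add_comm v0 x])
  have := hHinj _ (hgood _ (hsh x hx)).1.2 (sub_eq_zero.1 hx0)
  exact hPp _ s hs this
end SecC

section SecD1
variable {n r : ℕ} (z : Fin r → Fin n → ℤ)

lemma wp_mul (t s : Fin r → Circle) (j : Fin n) :
    weightProd z (t * s) j = weightProd z t j * weightProd z s j := by
  simp [weightProd, mul_zpow, Finset.prod_mul_distrib]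

lemma wp_pow (u : Circle) (ℓ : Fin r → ℤ) (j : Fin n) :
    weightProd z (fun i => u ^ ℓ i) j = u ^ (∑ i, ℓ i * z i j) := by
  simp only [weightProd, ← zpow_mul]
  induction (Finset.univ : Finset (Fin r)) using Finset.induction_on with
  | empty => simp
  | insert a s ha ih => rw [Finset.prod_insert ha, Finset.sum_insert ha, zpow_add, ih]

lemma circle_root (c : Circle) (w : ℤ) (hw : w ≠ 0) : ∃ u : Circle, u ^ w = c := by
  refine ⟨Circle.exp (Complex.arg c / w), ?_⟩
  have hw' : (w:ℝ) ≠ 0 := by exact_mod_cast hw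
  rw [← Circle.exp_zsmul, zsmul_eq_mul]
  rw [mul_div_cancel₀ _ hw']
  exact Circle.exp_arg c

def nv (v : Fin n → ℂ) : ℝ := ‖(WithLp.toLp 2 v : EuclideanSpace ℂ (Fin n))‖

lemma nv_pos (v : Fin n → ℂ) (hv : v ≠ 0) : 0 < nv v := by
  unfold nv
  rw [norm_pos_iff]
  intro h
  apply hv
  ext j
  exact congrArg (fun x : EuclideanSpace ℂ (Fin n) => x j) h

lemma nv_cont : Continuous (nv : (Fin n → ℂ) → ℝ) :=
  continuous_norm.comp (PiLp.continuous_toLp 2 _)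

lemma nv_congr (v v' : Fin n → ℂ) (h : ∀ j, ‖v j‖ = ‖v' j‖) : nv v = nv v' := by
  unfold nv
  rw [EuclideanSpace.norm_eq, EuclideanSpace.norm_eq]
  congr 1
  refine Finset.sum_congr rfl fun j _ => ?_
  change ‖v j‖ ^ 2 = ‖v' j‖ ^ 2
  rw [h]

def mkS (v : Fin n → ℂ) (hv : v ≠ 0) : Sph n :=
  ⟨WithLp.toLp 2 (fun j => ((nv v)⁻¹ : ℂ) * v j), by
    rw [mem_sphere_zero_iff_norm]
    have h : (WithLp.toLp 2 (fun j => ((nv v)⁻¹ : ℂ) * v j) : EuclideanSpace ℂ (Fin n))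
      = ((nv v)⁻¹ : ℂ) • WithLp.toLp 2 v := by
      ext j; simp
    rw [h, norm_smul]
    change ‖((nv v)⁻¹ : ℂ)‖ * nv v = 1
    have := nv_pos v hv
    rw [norm_inv, Complex.norm_real, Real.norm_eq_abs, abs_of_pos this, inv_mul_cancel₀ this.ne']⟩

lemma mkS_apply (v : Fin n → ℂ) (hv : v ≠ 0) (j : Fin n) :
    (mkS v hv : EuclideanSpace ℂ (Fin n)) j = ((nv v)⁻¹ : ℂ) * v j := rfl

lemma mkS_cont {Y : Type} [TopologicalSpace Y] (v : Y → Fin n → ℂ) (hv : ∀ y, v y ≠ 0)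
    (hc : Continuous v) : Continuous fun y => mkS (v y) (hv y) := by
  refine Continuous.subtype_mk ?_ _
  refine (PiLp.continuous_toLp 2 _).comp (continuous_pi fun j => ?_)
  refine Continuous.mul ?_ (by fun_prop)
  refine Continuous.inv₀ (Complex.continuous_ofReal.comp (nv_cont.comp hc)) fun y => ?_
  exact_mod_cast (nv_pos _ (hv y)).ne'

lemma nv_sph (x : Sph n) : nv (fun j => (x : EuclideanSpace ℂ (Fin n)) j) = 1 :=
  mem_sphere_zero_iff_norm.1 x.2

lemma sph_ne (x : Sph n) : (fun j => (x : EuclideanSpace ℂ (Fin n)) j) ≠ 0 := by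
  intro h
  have := nv_sph x
  rw [h] at this
  simp [nv] at this

lemma sph_cont (j : Fin n) : Continuous fun x : Sph n => (x : EuclideanSpace ℂ (Fin n)) j := by
  have := continuous_subtype_val (p := fun x : EuclideanSpace ℂ (Fin n) => x ∈ Metric.sphere (0 : EuclideanSpace ℂ (Fin n)) 1)
  fun_prop

abbrev qm (x : Sph n) : OrbitSpace z := Quotient.mk (orbitSetoid z) x

lemma qm_eq {x y : Sph n} : qm z x = qm z y ↔ ∃ t : Fin r → Circle,
    ∀ j, (weightProd z t j : ℂ) * (x : EuclideanSpace ℂ (Fin n)) j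
      = (y : EuclideanSpace ℂ (Fin n)) j := by
  exact Quotient.eq (r := orbitSetoid z)

lemma qm_mkS_eq (v v' : Fin n → ℂ) (hv : v ≠ 0) (hv' : v' ≠ 0) (t : Fin r → Circle)
    (h : ∀ j, (weightProd z t j : ℂ) * v j = v' j) : qm z (mkS v hv) = qm z (mkS v' hv') := by
  rw [qm_eq]
  refine ⟨t, fun j => ?_⟩
  rw [mkS_apply, mkS_apply, nv_congr v v' (fun j => by rw [← h j, norm_mul, Circle.norm_coe, one_mul]), ← h j]
  ring

lemma mkS_self (x : Sph n) : mkS (fun j => (x : EuclideanSpace ℂ (Fin n)) j) (sph_ne x) = x := by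
  apply Subtype.ext
  ext j
  rw [mkS_apply, nv_sph]
  simp

def actS (t : Fin r → Circle) (x : Sph n) : Sph n :=
  mkS (fun j => (weightProd z t j : ℂ) * (x : EuclideanSpace ℂ (Fin n)) j) (by
    intro h
    apply sph_ne x
    ext j
    have := congrFun h j
    simpa using this)

lemma actS_apply (t : Fin r → Circle) (x : Sph n) (j : Fin n) :
    (actS z t x : EuclideanSpace ℂ (Fin n)) j
      = (weightProd z t j : ℂ) * (x : EuclideanSpace ℂ (Fin n)) j := by
  unfold actS
  rw [mkS_apply, nv_congr _ (fun j => (x : EuclideanSpace ℂ (Fin n)) j)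
    (fun j => by rw [norm_mul, Circle.norm_coe, one_mul]), nv_sph]
  simp

lemma actS_cont (t : Fin r → Circle) : Continuous (actS z t) := by
  unfold actS
  apply mkS_cont
  exact continuous_pi fun j => continuous_const.mul (sph_cont j)

lemma qm_open : IsOpenQuotientMap (qm z : Sph n → OrbitSpace z) where
  surjective := Quotient.mk_surjective
  continuous := continuous_quot_mk
  isOpenMap := by
    intro O hO
    rw [← (isQuotientMap_quotient_mk' (s := orbitSetoid z)).isOpen_preimage]
    have : (qm z ⁻¹' (qm z '' O)) = ⋃ t : Fin r → Circle, actS z t ⁻¹' O := by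
      ext x
      simp only [mem_preimage, mem_iUnion]
      constructor
      · rintro ⟨y, hy, hxy⟩
        have : qm z x = qm z y := hxy.symm
        rw [qm_eq] at this
        obtain ⟨t, ht⟩ := this
        refine ⟨t, ?_⟩
        have : actS z t x = y := by
          apply Subtype.ext; ext j; rw [actS_apply, ht]
        rwa [this]
      · rintro ⟨t, ht⟩
        refine ⟨_, ht, ?_⟩
        symm
        change qm z x = qm z _
        rw [qm_eq]
        exact ⟨t, fun j => (actS_apply z t x j).symm⟩
    change IsOpen (qm z ⁻¹' (qm z '' O))
    rw [this]
    exact isOpen_iUnion fun t => hO.preimage (actS_cont z t)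

lemma phase_ex (c : ℂ) : ∃ u : Circle, (u : ℂ) * c = ‖c‖ := by
  by_cases hc : c = 0
  · exact ⟨1, by simp [hc]⟩
  · have hn : (‖c‖ : ℂ) ≠ 0 := by simpa using hc
    refine ⟨⟨‖c‖ / c, by
      change _ ∈ Metric.sphere (0:ℂ) 1
      rw [mem_sphere_zero_iff_norm, norm_div, Complex.norm_real, norm_norm, div_self (norm_ne_zero_iff.2 hc)]⟩, ?_⟩
    change (‖c‖ / c : ℂ) * c = ‖c‖
    field_simp

/-- case c = 1 -/
theorem case_one {d : ℕ} (hman : LocallyEuclidean (OrbitSpace z) d) (ℓ : Fin r → ℤ) (j0 h0 : Fin n) (hj : h0 ≠ j0)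
    (hw0 : ∑ i, ℓ i * z i j0 ≠ 0) (hw : ∀ j, j ≠ j0 → ∑ i, ℓ i * z i j = 0) : False := by
  let up : Sph n × ℝ → Fin n → ℂ := fun q =>
    Function.update (fun j => (q.1 : EuclideanSpace ℂ (Fin n)) j) j0
      (((‖(q.1 : EuclideanSpace ℂ (Fin n)) j0‖ + |q.2| : ℝ)) : ℂ)
  have up0 : ∀ q, up q j0 = (((‖(q.1 : EuclideanSpace ℂ (Fin n)) j0‖ + |q.2| : ℝ)) : ℂ) := fun q => by
    simp [up]
  have up1 : ∀ q j, j ≠ j0 → up q j = (q.1 : EuclideanSpace ℂ (Fin n)) j := fun q j h => by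
    simp [up, h]
  have hup : ∀ q, up q ≠ 0 := by
    intro q h
    apply sph_ne q.1
    ext j
    by_cases hj : j = j0
    · subst hj
      have := congrFun h j
      rw [up0] at this
      have h2 : ‖(q.1 : EuclideanSpace ℂ (Fin n)) j‖ + |q.2| = 0 := Complex.ofReal_eq_zero.1 this
      have h3 : ‖(q.1 : EuclideanSpace ℂ (Fin n)) j‖ = 0 := by
        have := norm_nonneg ((q.1 : EuclideanSpace ℂ (Fin n)) j)
        have := abs_nonneg q.2
        linarith
      simpa using h3
    · have := congrFun h j
      rwa [up1 _ _ hj] at this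
  have cup : Continuous up := by
    refine Continuous.update ?_ j0 ?_
    · exact continuous_pi fun j => (sph_cont j).comp continuous_fst
    · refine Complex.continuous_ofReal.comp (Continuous.add ?_ (continuous_abs.comp continuous_snd))
      exact ((sph_cont j0).comp continuous_fst).norm
  -- modify the phase at j0
  have hphase : ∀ c : Circle, ∃ s : Fin r → Circle, weightProd z s j0 = c ∧
      ∀ j, j ≠ j0 → weightProd z s j = 1 := by
    intro c
    obtain ⟨u, hu⟩ := circle_root c _ hw0
    refine ⟨fun i => u ^ ℓ i, by rw [wp_pow, hu], fun j hj => by rw [wp_pow, hw j hj, zpow_zero]⟩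
  let P0 : ℝ → Sph n → OrbitSpace z := fun s x => qm z (mkS (up (x, s)) (hup _))
  have hP0 : ∀ s, ∀ x y : Sph n, (orbitSetoid z).r x y → P0 s x = P0 s y := by
    rintro s x y ⟨t, ht⟩
    obtain ⟨t', ht1, ht2⟩ := hphase (weightProd z t j0)⁻¹
    refine qm_mkS_eq z _ _ _ _ (t * t') fun j => ?_
    by_cases hj : j = j0
    · subst hj
      rw [wp_mul, ht1, mul_inv_cancel, up0, up0, ← ht j, norm_mul, Circle.norm_coe]
      simp
    · rw [wp_mul, ht2 j hj, mul_one, up1 _ _ hj, up1 _ _ hj]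
      exact ht j
  let P : OrbitSpace z → ℝ → OrbitSpace z := fun q s => Quotient.lift (P0 s) (hP0 s) q
  have hPc : Continuous (fun q : OrbitSpace z × ℝ => P q.1 q.2) := by
    rw [← ((qm_open z).prodMap (IsOpenQuotientMap.id (X := ℝ))).continuous_comp_iff]
    change Continuous fun q : Sph n × ℝ => qm z (mkS (up q) (hup _))
    exact (qm_open z).continuous.comp (mkS_cont up hup cup)
  let pv : Fin n → ℂ := Pi.single h0 1
  have hpv : pv ≠ 0 := by
    intro h
    have := congrFun h h0
    simp [pv] at this
  obtain ⟨U, V, hU, hV, hp, ⟨hh⟩⟩ := hman (qm z (mkS pv hpv))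
  refine abstract_contra1 _ U V hU hV hp hh P hPc ?_ ?_
  · intro q
    obtain ⟨x, rfl⟩ := (qm_open z).surjective q
    change P0 0 x = qm z x
    obtain ⟨u, hu⟩ := phase_ex ((x : EuclideanSpace ℂ (Fin n)) j0)
    obtain ⟨t, ht1, ht2⟩ := hphase u
    conv_rhs => rw [← mkS_self x]
    symm
    refine qm_mkS_eq z _ _ _ _ t fun j => ?_
    by_cases hj : j = j0
    · subst hj
      rw [ht1, up0, hu]; simp
    · rw [ht2 j hj, up1 _ _ hj]; simp
  · intro q s hs
    obtain ⟨x, rfl⟩ := (qm_open z).surjective q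
    intro he
    have he' : qm z (mkS (up (x, s)) (hup _)) = qm z (mkS pv hpv) := he
    rw [qm_eq] at he'
    obtain ⟨t, ht⟩ := he'
    have := ht j0
    rw [mkS_apply, mkS_apply, up0] at this
    have h1 : pv j0 = 0 := by simp [pv, hj.symm]
    rw [h1, mul_zero] at this
    rcases mul_eq_zero.1 this with h | h
    · exact Circle.coe_ne_zero _ h
    rcases mul_eq_zero.1 h with h | h
    · have := nv_pos _ (hup (x, s))
      rw [inv_eq_zero] at h
      exact this.ne' (by exact_mod_cast h)
    · have h2 : ‖(x : EuclideanSpace ℂ (Fin n)) j0‖ + |s| = 0 := by exact_mod_cast h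
      have := norm_nonneg ((x : EuclideanSpace ℂ (Fin n)) j0)
      have := abs_pos.2 hs.ne'
      linarith
end SecD1

section SecD2
open ComplexConjugate

def ph (c : ℂ) : Circle := Circle.exp (Complex.arg c)

lemma ph_mul (c : ℂ) : (‖c‖ : ℂ) * (ph c : ℂ) = c := by
  unfold ph
  rw [Circle.coe_exp]
  exact Complex.norm_mul_exp_arg_mul_I c

lemma ph_eq (c : ℂ) (hc : c ≠ 0) : (ph c : ℂ) = c / ‖c‖ := by
  have h : (‖c‖ : ℂ) ≠ 0 := by simpa using hc
  rw [eq_div_iff h, mul_comm]; exact ph_mul c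

lemma ph_cont {c : ℂ} (hc : c ≠ 0) : ContinuousAt ph c := by
  have hind : Topology.IsInducing (fun u : Circle => (u : ℂ)) := ⟨rfl⟩
  rw [hind.continuousAt_iff]
  have h1 : ContinuousAt (fun c : ℂ => c / (‖c‖ : ℂ)) c := by
    refine continuousAt_id.div (Complex.continuous_ofReal.comp continuous_norm).continuousAt ?_
    simpa using hc
  refine h1.congr ?_
  filter_upwards [isOpen_ne.mem_nhds hc] with d hd
  exact (ph_eq d hd).symm

lemma ph_circle (u : Circle) (c : ℂ) (hc : c ≠ 0) : ph (u * c) = u * ph c := by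
  apply Circle.ext
  rw [ph_eq _ (mul_ne_zero (Circle.coe_ne_zero u) hc), Circle.coe_mul, ph_eq c hc, norm_mul,
    Circle.norm_coe, one_mul, mul_div_assoc]

lemma ph_pos (a : ℝ) (ha : 0 < a) (c : ℂ) : ph (a * c) = ph c := by
  unfold ph
  rw [Complex.arg_real_mul _ ha]

lemma ph_one (a : ℝ) (ha : 0 ≤ a) : ph (a : ℂ) = 1 := by
  unfold ph
  rw [Complex.arg_ofReal_of_nonneg ha]; simp

def pw (m : ℤ) (c : ℂ) : ℂ := (‖c‖ : ℂ) * ((ph c ^ m : Circle) : ℂ)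

lemma norm_pw (m : ℤ) (c : ℂ) : ‖pw m c‖ = ‖c‖ := by
  unfold pw
  rw [norm_mul, Circle.norm_coe, mul_one, Complex.norm_real, norm_norm]

lemma cont_zero_mul {Y : Type*} [TopologicalSpace Y] (b : Y → ℂ) (c : Y → Circle) (y : Y)
    (hb : ContinuousAt b y) (h0 : b y = 0) : ContinuousAt (fun e => b e * (c e : ℂ)) y := by
  have : (fun e => b e * (c e : ℂ)) y = 0 := by simp [h0]
  unfold ContinuousAt
  rw [this]
  refine squeeze_zero_norm (a := fun e => ‖b e‖) (fun e => ?_) ?_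
  · rw [norm_mul, Circle.norm_coe, mul_one]
  · have := hb.norm
    have h1 : Filter.Tendsto (fun x => ‖b x‖) (nhds y) (nhds ‖b y‖) := this
    rwa [h0, norm_zero] at h1

lemma pw_cont (m : ℤ) : Continuous (pw m) := by
  rw [continuous_iff_continuousAt]
  intro c
  have hn : Continuous fun c : ℂ => (‖c‖ : ℂ) := Complex.continuous_ofReal.comp continuous_norm
  by_cases hc : c = 0
  · subst hc
    exact cont_zero_mul _ _ _ hn.continuousAt (by simp)
  · refine hn.continuousAt.mul ?_
    exact (continuous_subtype_val (p := fun c : ℂ => c ∈ Submonoid.unitSphere ℂ)).continuousAt.comp ((ph_cont hc).zpow m)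

lemma pw_circle (m : ℤ) (u : Circle) (c : ℂ) : pw m (u * c) = ((u ^ m : Circle) : ℂ) * pw m c := by
  by_cases hc : c = 0
  · subst hc; simp [pw]
  · unfold pw
    rw [ph_circle u c hc, norm_mul, Circle.norm_coe, one_mul, mul_zpow, Circle.coe_mul]
    ring

lemma pw_pos (m : ℤ) (a : ℝ) (ha : 0 < a) (c : ℂ) : pw m (a * c) = a * pw m c := by
  unfold pw
  rw [ph_pos a ha, norm_mul, Complex.norm_real, Real.norm_eq_abs, abs_of_pos ha]
  push_cast; ring

lemma pw_nonneg (m : ℤ) (a : ℝ) (ha : 0 ≤ a) : pw m (a : ℂ) = a := by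
  unfold pw
  rw [ph_one a ha, Complex.norm_real, Real.norm_eq_abs, abs_of_nonneg ha]; simp

lemma pw_nat (M : ℕ) (c : ℂ) (hM : 0 < M) : pw (M : ℤ) ((‖c‖ : ℂ) ^ (M - 1) * c) = c ^ M := by
  by_cases hc : c = 0
  · subst hc
    simp [pw, hM.ne']
  · have h : (((‖c‖ ^ (M - 1) : ℝ)) : ℂ) = (‖c‖ : ℂ) ^ (M - 1) := by push_cast; rfl
    rw [← h, pw_pos _ _ (pow_pos (norm_pos_iff.2 hc) _), h]
    unfold pw
    rw [← mul_assoc, zpow_natCast, Circle.coe_pow]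
    conv_rhs => rw [← ph_mul c, mul_pow]
    rw [← pow_succ, Nat.sub_add_cancel hM]

/-- descending functions to the quotient -/
lemma descend {n r : ℕ} (z : Fin r → Fin n → ℤ) {Y : Type} [TopologicalSpace Y] (D : Set (Sph n))
    (hD : IsOpen D) (F : Sph n → Y) (hF : ContinuousOn F D)
    (hinv : ∀ x y, qm z x = qm z y → x ∈ D → y ∈ D ∧ F y = F x) :
    ∃ G : OrbitSpace z → Y, ContinuousOn G (qm z '' D) ∧ ∀ x ∈ D, G (qm z x) = F x := by
  have hG : ∀ x ∈ D, F (Quotient.out (qm z x)) = F x := fun x hx =>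
    (hinv x _ (Quotient.out_eq (qm z x)).symm hx).2
  refine ⟨fun q => F q.out, ?_, hG⟩
  rintro _ ⟨x, hx, rfl⟩
  refine ContinuousAt.continuousWithinAt ?_
  rw [← (qm_open z).continuousAt_comp_iff]
  refine (hF.continuousAt (hD.mem_nhds hx)).congr ?_
  filter_upwards [hD.mem_nhds hx] with y hy
  exact (hG y hy).symm

/-- the functions alpha, beta -/
def alf (h t : ℝ) : ℝ := √((h + √(h ^ 2 + 4 * t ^ 2)) / 2)

lemma alf_cont : Continuous fun q : ℝ × ℝ => alf q.1 q.2 := by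
  unfold alf; fun_prop

lemma alf_aux (h t : ℝ) : |h| ≤ √(h ^ 2 + 4 * t ^ 2) := by
  rw [← Real.sqrt_sq_eq_abs]
  apply Real.sqrt_le_sqrt; nlinarith [sq_nonneg t]

lemma alf_sq (h t : ℝ) : alf h t ^ 2 = (h + √(h ^ 2 + 4 * t ^ 2)) / 2 := by
  unfold alf
  rw [Real.sq_sqrt]
  have := alf_aux h t
  have := neg_abs_le h
  linarith

lemma alf_nonneg (h t : ℝ) : 0 ≤ alf h t := Real.sqrt_nonneg _

lemma alf_diff (h t : ℝ) : alf h t ^ 2 - alf (-h) t ^ 2 = h := by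
  rw [alf_sq, alf_sq, neg_sq]; ring

lemma alf_mul (h t : ℝ) (ht : 0 ≤ t) : alf h t * alf (-h) t = t := by
  have h1 : (alf h t * alf (-h) t) ^ 2 = t ^ 2 := by
    rw [mul_pow, alf_sq, alf_sq, neg_sq]
    have := Real.sq_sqrt (show 0 ≤ h ^ 2 + 4 * t ^ 2 by positivity)
    nlinarith
  have h2 := mul_nonneg (alf_nonneg h t) (alf_nonneg (-h) t)
  nlinarith [abs_eq_abs.2 (sq_eq_sq_iff_eq_or_eq_neg.1 h1), abs_of_nonneg h2, abs_of_nonneg ht]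

lemma alf_zero (h : ℝ) (hh : h ≤ 0) : alf h 0 = 0 := by
  unfold alf
  have : √(h ^ 2 + 4 * 0 ^ 2) = -h := by
    rw [show h ^ 2 + 4 * 0 ^ 2 = h ^ 2 by ring, Real.sqrt_sq_eq_abs, abs_of_nonpos hh]
  rw [this]; simp
end SecD2

section SecD3
open ComplexConjugate
variable {n r : ℕ} (z : Fin r → Fin n → ℤ)

abbrev cx (x : Sph n) : Fin n → ℂ := fun j => (x : EuclideanSpace ℂ (Fin n)) j

lemma cx_cont : Continuous (cx : Sph n → Fin n → ℂ) := continuous_pi fun j => sph_cont j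

def yy (J : Finset (Fin n)) (s : (Fin n → ℂ) → ℝ) (m : Fin n → ℤ) (μ : Fin n → Fin n → ℤ)
    (x : Fin n → ℂ) (j : Fin n) : ℂ :=
  (((s x)⁻¹ : ℝ) : ℂ) * (pw (m j) (x j) * ((∏ i ∈ J, ph (x i) ^ (- μ j i) : Circle) : ℂ))

lemma norm_yy (J : Finset (Fin n)) (s : (Fin n → ℂ) → ℝ) (m : Fin n → ℤ) (μ : Fin n → Fin n → ℤ)
    (x : Fin n → ℂ) (j : Fin n) (hs : 0 < s x) : ‖yy J s m μ x j‖ = (s x)⁻¹ * ‖x j‖ := by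
  unfold yy
  rw [norm_mul, norm_mul, Circle.norm_coe, mul_one, norm_pw, Complex.norm_real, Real.norm_eq_abs,
    abs_of_pos (inv_pos.2 hs)]

lemma yy_contOn (J : Finset (Fin n)) (s : (Fin n → ℂ) → ℝ) (m : Fin n → ℤ) (μ : Fin n → Fin n → ℤ)
    (D : Set (Fin n → ℂ)) (hs : ContinuousOn s D) (hs0 : ∀ x ∈ D, 0 < s x)
    (hJ : ∀ x ∈ D, ∀ i ∈ J, x i ≠ 0) (j : Fin n) : ContinuousOn (fun x => yy J s m μ x j) D := by
  intro x hx
  unfold yy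
  refine ContinuousWithinAt.mul ?_ (ContinuousWithinAt.mul ?_ ?_)
  · exact Complex.continuous_ofReal.continuousAt.comp_continuousWithinAt
      ((hs x hx).inv₀ (hs0 x hx).ne')
  · exact ((pw_cont _).comp (continuous_apply j)).continuousWithinAt
  · refine ContinuousAt.continuousWithinAt ?_
    have h : ContinuousAt (fun x : Fin n → ℂ => (∏ i ∈ J, ph (x i) ^ (- μ j i) : Circle)) x := by
      refine tendsto_finsetProd _ fun i hi => ?_
      exact (ContinuousAt.comp (f := fun x : Fin n → ℂ => x i) (g := ph) (x := x)
        (ph_cont (hJ x hx i hi)) (continuous_apply i).continuousAt).zpow _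
    exact (continuous_subtype_val (p := fun c : ℂ => c ∈ Submonoid.unitSphere ℂ)).continuousAt.comp h

lemma yy_pos (J : Finset (Fin n)) (s : (Fin n → ℂ) → ℝ) (m : Fin n → ℤ) (μ : Fin n → Fin n → ℤ)
    (x : Fin n → ℂ) (j : Fin n) (a : ℝ) (ha : 0 < a) (hs : s (fun j => a * x j) = a * s x) :
    yy J s m μ (fun j => a * x j) j = yy J s m μ x j := by
  unfold yy
  simp only [ph_pos a ha, pw_pos _ a ha, hs]
  push_cast
  have : (a : ℂ) ≠ 0 := by exact_mod_cast ha.ne'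
  field_simp

lemma yy_act (J : Finset (Fin n)) (s : (Fin n → ℂ) → ℝ) (m : Fin n → ℤ) (μ : Fin n → Fin n → ℤ)
    (x x' : Fin n → ℂ) (j : Fin n) (t : Fin r → Circle) (χ : Circle)
    (hx : ∀ j, (weightProd z t j : ℂ) * x j = x' j)
    (hs : s x' = s x) (hJ : ∀ i ∈ J, x i ≠ 0)
    (hχ : weightProd z t j ^ m j = χ * ∏ i ∈ J, weightProd z t i ^ μ j i) :
    yy J s m μ x' j = χ * yy J s m μ x j := by
  unfold yy
  rw [hs, ← hx j, pw_circle, hχ]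
  have : (∏ i ∈ J, ph (x' i) ^ (- μ j i)) = (∏ i ∈ J, weightProd z t i ^ μ j i)⁻¹ *
      ∏ i ∈ J, ph (x i) ^ (- μ j i) := by
    rw [← Finset.prod_inv_distrib, ← Finset.prod_mul_distrib]
    refine Finset.prod_congr rfl fun i hi => ?_
    rw [← hx i, ph_circle _ _ (hJ i hi), mul_zpow, zpow_neg]
  rw [this]
  have hne : ((∏ i ∈ J, weightProd z t i ^ μ j i : Circle) : ℂ) ≠ 0 := Circle.coe_ne_zero _
  rw [Circle.coe_mul, Circle.coe_mul, Circle.coe_inv]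
  field_simp

lemma mkS_contAt {Y : Type} [TopologicalSpace Y] (v : Y → Fin n → ℂ) (hv : ∀ y, v y ≠ 0) (y : Y)
    (hc : ContinuousAt v y) : ContinuousAt (fun y => mkS (v y) (hv y)) y := by
  have h := mkS_cont (Y := {v : Fin n → ℂ // v ≠ 0}) (fun v => v.1) (fun v => v.2)
    continuous_subtype_val
  exact h.continuousAt.comp (x := y) (f := fun y => (⟨v y, hv y⟩ : {v : Fin n → ℂ // v ≠ 0}))
    (Topology.IsInducing.subtypeVal.continuousAt_iff.2 hc)

theorem geom {d : ℕ} (hman : LocallyEuclidean (OrbitSpace z) d)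
    (ℓ : Fin r → ℤ) (J C : Finset (Fin n)) (hJC : Disjoint J C)
    (hℓ : ∀ j, j ∉ C → ∑ i, ℓ i * z i j = 0)
    (i1 i2 : Fin n) (h12 : i1 ≠ i2) (h1 : i1 ∈ C) (h2 : i2 ∈ C)
    (hℓ2 : ∑ i, ℓ i * z i i2 ≠ 0)
    (ιR : Type) [Fintype ιR]
    (hd : Module.finrank ℝ (ESp ιR {j : Fin n // j ∉ J ∧ j ∉ C}) < d)
    (M : ℕ) (hM : 0 < M) (m : Fin n → ℤ) (μ : Fin n → Fin n → ℤ)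
    (hmH : ∀ j, j ∉ J → j ∉ C → m j = M) (hm2 : m i2 = M)
    (hχ : ∀ t : Fin r → Circle, ∀ j, j ∉ J → weightProd z t j ^ m j =
      (if j ∈ C then weightProd z t i2 ^ M else 1) * ∏ i ∈ J, weightProd z t i ^ μ j i)
    (D : Set (Fin n → ℂ)) (hD : IsOpen D) (s : (Fin n → ℂ) → ℝ) (V : (Fin n → ℂ) → ιR → ℝ)
    (hs : ContinuousOn s D) (hV : ContinuousOn V D) (hs0 : ∀ x ∈ D, 0 < s x)
    (hDJ : ∀ x ∈ D, ∀ i ∈ J, x i ≠ 0)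
    (hact : ∀ t : Fin r → Circle, ∀ x ∈ D, (fun j => (weightProd z t j : ℂ) * x j) ∈ D ∧
      s (fun j => (weightProd z t j : ℂ) * x j) = s x ∧ V (fun j => (weightProd z t j : ℂ) * x j) = V x)
    (hhom : ∀ a : ℝ, 0 < a → ∀ x ∈ D, (fun j => (a : ℂ) * x j) ∈ D ∧
      s (fun j => (a : ℂ) * x j) = a * s x ∧ V (fun j => (a : ℂ) * x j) = V x)
    (g : (ιR → ℝ) → Fin n → ℂ) (hg : Continuous g) (hg0 : ∀ v, ∃ i ∈ J, g v i ≠ 0)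
    (hgx : ∀ v, ‖v‖ ≤ 1 / 2 → ∀ x : Fin n → ℂ, (∀ i ∈ J, x i = g v i) → x ∈ D ∧ s x = 1 ∧ V x = v)
    (hgp : ∀ v, ‖v‖ ≤ 1 / 2 → ∀ j, j ∉ J → ∀ i ∈ J, ph (g v i) ^ (- μ j i) = 1)
    (huniq : ∀ x ∈ D, V x = 0 → ∃ t : Fin r → Circle, ∀ i ∈ J, (weightProd z t i : ℂ) * x i = (s x : ℂ) * g 0 i) :
    False := by
  classical
  have hCJ : ∀ j, j ∈ C → j ∉ J := fun j hj hj' => Finset.disjoint_left.1 hJC hj' hj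
  let ιC := {j : Fin n // j ∉ J ∧ j ∉ C}
  let E := ESp ιR ιC
  -- parametrization with freely chosen phases
  let a1 : E → ℝ := fun e => alf e.2.1 (‖e.2.2‖ ^ M)
  let a2 : E → ℝ := fun e => alf (-e.2.1) (‖e.2.2‖ ^ M)
  let xv : (E → Circle) → (E → Circle) → E → Fin n → ℂ := fun c1 c2 e j =>
    if j ∈ J then g e.1.1 j else if j = i1 then (a1 e : ℂ) * (c1 e : ℂ) else
    if j = i2 then (a2 e : ℂ) * (c2 e : ℂ) else if hj : j ∉ J ∧ j ∉ C then
      (‖e.1.2 ⟨j, hj⟩‖ : ℂ) ^ (M - 1) * e.1.2 ⟨j, hj⟩ else 0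
  have xvJ : ∀ c1 c2 e j, j ∈ J → xv c1 c2 e j = g e.1.1 j := fun c1 c2 e j hj => by
    simp only [xv, if_pos hj]
  have xv1 : ∀ c1 c2 e, xv c1 c2 e i1 = (a1 e : ℂ) * (c1 e : ℂ) := fun c1 c2 e => by
    simp only [xv, if_neg (hCJ i1 h1), if_true]
  have xv2 : ∀ c1 c2 e, xv c1 c2 e i2 = (a2 e : ℂ) * (c2 e : ℂ) := fun c1 c2 e => by
    simp only [xv, if_neg (hCJ i2 h2), if_neg h12.symm, if_true]
  have xvH : ∀ c1 c2 e j, (hj : j ∉ J ∧ j ∉ C) → xv c1 c2 e j =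
      (‖e.1.2 ⟨j, hj⟩‖ : ℂ) ^ (M - 1) * e.1.2 ⟨j, hj⟩ := fun c1 c2 e j hj => by
    have e1 : j ≠ i1 := fun h => hj.2 (h ▸ h1)
    have e2 : j ≠ i2 := fun h => hj.2 (h ▸ h2)
    simp only [xv, if_neg hj.1, if_neg e1, if_neg e2, dif_pos hj]
  have xvC : ∀ c1 c2 e j, j ∈ C → j ≠ i1 → j ≠ i2 → xv c1 c2 e j = 0 := fun c1 c2 e j hj e1 e2 => by
    have : ¬ (j ∉ J ∧ j ∉ C) := fun h => h.2 hj
    simp only [xv, if_neg (hCJ j hj), if_neg e1, if_neg e2, dif_neg this]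
  have xv0 : ∀ c1 c2 e, xv c1 c2 e ≠ 0 := by
    intro c1 c2 e h
    obtain ⟨i, hi, hgi⟩ := hg0 e.1.1
    apply hgi
    rw [← xvJ c1 c2 e i hi, h]; rfl
  have ca1 : Continuous a1 := by
    have : Continuous fun e : E => ((e.2.1, ‖e.2.2‖ ^ M) : ℝ × ℝ) := by fun_prop
    exact alf_cont.comp this
  have ca2 : Continuous a2 := by
    have : Continuous fun e : E => ((-e.2.1, ‖e.2.2‖ ^ M) : ℝ × ℝ) := by fun_prop
    exact alf_cont.comp this
  have xvcont : ∀ c1 c2 e, ContinuousAt (fun e => (a1 e : ℂ) * (c1 e : ℂ)) e →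
      ContinuousAt (fun e => (a2 e : ℂ) * (c2 e : ℂ)) e → ContinuousAt (xv c1 c2) e := by
    intro c1 c2 e hc1 hc2
    refine continuousAt_pi.2 fun j => ?_
    by_cases hj : j ∈ J
    · simp only [xvJ _ _ _ j hj]
      have : Continuous fun e : E => g e.1.1 j := by fun_prop
      exact this.continuousAt
    by_cases e1 : j = i1
    · subst e1; simp only [xv1]; exact hc1
    by_cases e2 : j = i2
    · subst e2; simp only [xv2]; exact hc2
    by_cases hjC : j ∈ C
    · simp only [xvC _ _ _ j hjC e1 e2]; exact continuousAt_const
    · simp only [xvH _ _ _ j ⟨hj, hjC⟩]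
      refine Continuous.continuousAt ?_
      have : Continuous fun e : E => e.1.2 ⟨j, hj, hjC⟩ := by fun_prop
      exact ((Complex.continuous_ofReal.comp this.norm).pow _).mul this
  let c2 : E → Circle := fun e => ph e.2.2
  let X0 : E → Fin n → ℂ := xv 1 c2
  let f : E → OrbitSpace z := fun e => qm z (mkS (X0 e) (xv0 _ _ e))
  -- alternative phases
  have hroot : ∀ c : Circle, ∃ u : Circle, u ^ (∑ i, ℓ i * z i i2) = c := fun c => circle_root c _ hℓ2
  choose rt hrt using hroot
  let d1 : E → Circle := fun e => rt (c2 e)⁻¹ ^ (∑ i, ℓ i * z i i1)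
  have hfalt : ∀ e, f e = qm z (mkS (xv d1 1 e) (xv0 _ _ e)) := by
    intro e
    refine qm_mkS_eq z _ _ _ _ (fun i => rt (c2 e)⁻¹ ^ ℓ i) fun j => ?_
    rw [wp_pow]
    by_cases hj : j ∈ C
    · by_cases e1 : j = i1
      · subst e1; simp only [X0, xv1, d1, Pi.one_apply]; simp; ring
      by_cases e2 : j = i2
      · subst e2; simp only [X0, xv2, hrt, Pi.one_apply]; simp; ring_nf; simp
      simp only [X0, xvC _ _ _ j hj e1 e2, mul_zero]
    · rw [hℓ j hj, zpow_zero, Circle.coe_one, one_mul]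
      by_cases hJ : j ∈ J
      · simp only [X0, xvJ _ _ _ j hJ]
      · simp only [X0, xvH _ _ _ j ⟨hJ, hj⟩]
  have hf : Continuous f := by
    rw [continuous_iff_continuousAt]
    intro e
    have cof : Continuous fun x : ℝ => (x : ℂ) := Complex.continuous_ofReal
    by_cases hζ : e.2.2 = 0
    · rcases le_total e.2.1 0 with hh | hh
      · have : f = fun e => qm z (mkS (xv d1 1 e) (xv0 _ _ e)) := funext hfalt
        rw [this]
        refine (qm_open z).continuous.continuousAt.comp (mkS_contAt _ _ e (xvcont _ _ e ?_ ?_))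
        · refine cont_zero_mul _ _ _ (cof.comp ca1).continuousAt ?_
          change ((alf e.2.1 (‖e.2.2‖ ^ M) : ℝ) : ℂ) = 0
          rw [hζ, norm_zero, zero_pow hM.ne', alf_zero _ hh]; rfl
        · simp only [Pi.one_apply, Circle.coe_one, mul_one]
          exact (cof.comp ca2).continuousAt
      · refine (qm_open z).continuous.continuousAt.comp (mkS_contAt _ _ e (xvcont _ _ e ?_ ?_))
        · simp only [Pi.one_apply, Circle.coe_one, mul_one]
          exact (cof.comp ca1).continuousAt
        · refine cont_zero_mul _ _ _ (cof.comp ca2).continuousAt ?_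
          change ((alf (-e.2.1) (‖e.2.2‖ ^ M) : ℝ) : ℂ) = 0
          rw [hζ, norm_zero, zero_pow hM.ne', alf_zero _ (by linarith)]; rfl
    · refine (qm_open z).continuous.continuousAt.comp (mkS_contAt _ _ e (xvcont _ _ e ?_ ?_))
      · simp only [Pi.one_apply, Circle.coe_one, mul_one]
        exact (cof.comp ca1).continuousAt
      · refine (cof.comp ca2).continuousAt.mul ?_
        refine (continuous_subtype_val (p := fun c : ℂ => c ∈ Submonoid.unitSphere ℂ)).continuousAt.comp ?_
        exact ContinuousAt.comp (f := fun e : E => e.2.2) (g := ph) (ph_cont hζ)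
          (continuous_snd.comp continuous_snd).continuousAt
  -- invariants
  let y := yy J s m μ
  let F : (Fin n → ℂ) → WSp ιR ιC × (Fin n → Fin n → ℂ) := fun x =>
    ((V x, fun j => y x j.1), fun i k => if i ∉ J ∧ k ∉ J ∧ i ∈ C ∧ k ∈ C then y x i * conj (y x k) else 0)
  have hyc : ∀ j, ContinuousOn (fun x => y x j) D := fun j =>
    yy_contOn J s m μ D hs hs0 hDJ j
  have hFc : ContinuousOn F D := by
    refine ContinuousOn.prodMk (hV.prodMk (continuousOn_pi.2 fun j => hyc _))
      (continuousOn_pi.2 fun i => continuousOn_pi.2 fun k => ?_)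
    by_cases h : i ∉ J ∧ k ∉ J ∧ i ∈ C ∧ k ∈ C
    · simp only [if_pos h]
      exact (hyc i).mul (Complex.continuous_conj.comp_continuousOn (hyc k))
    · simp only [if_neg h]; exact continuousOn_const
  have hFhom : ∀ a : ℝ, 0 < a → ∀ x ∈ D, F (fun j => (a : ℂ) * x j) = F x := by
    intro a ha x hx
    obtain ⟨-, k2, k3⟩ := hhom a ha x hx
    have : y (fun j => (a : ℂ) * x j) = y x := funext fun j => yy_pos J s m μ x j a ha k2
    simp only [F, k3, this]
  have hFact : ∀ t : Fin r → Circle, ∀ x ∈ D, F (fun j => (weightProd z t j : ℂ) * x j) = F x := by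
    intro t x hx
    obtain ⟨-, k2, k3⟩ := hact t x hx
    have hyt : ∀ j, j ∉ J → y (fun j => (weightProd z t j : ℂ) * x j) j =
        ((if j ∈ C then weightProd z t i2 ^ M else 1 : Circle) : ℂ) * y x j := fun j hj =>
      yy_act z J s m μ x _ j t _ (fun j => rfl) k2 (hDJ x hx) (hχ t j hj)
    simp only [F]
    refine Prod.ext (Prod.ext k3 ?_) ?_
    · funext j
      simp only []
      rw [hyt j j.2.1, if_neg j.2.2]; simp
    · funext i k
      by_cases h : i ∉ J ∧ k ∉ J ∧ i ∈ C ∧ k ∈ C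
      · simp only [if_pos h]
        rw [hyt i h.1, hyt k h.2.1, if_pos h.2.2.1, if_pos h.2.2.2, map_mul]
        have : ((weightProd z t i2 ^ M : Circle) : ℂ) * conj ((weightProd z t i2 ^ M : Circle) : ℂ) = 1 := by
          rw [Complex.mul_conj, Circle.normSq_coe]; simp
        linear_combination (y x i * conj (y x k)) * this
      · simp only [if_neg h]
  let DS : Set (Sph n) := cx ⁻¹' D
  have hDS : IsOpen DS := hD.preimage cx_cont
  obtain ⟨G, hGc, hG⟩ := descend z DS hDS (fun x => F (cx x))
    (hFc.comp cx_cont.continuousOn (fun x hx => hx)) (by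
      intro x x' hxx hx
      rw [qm_eq] at hxx
      obtain ⟨t, ht⟩ := hxx
      have : cx x' = fun j => (weightProd z t j : ℂ) * cx x j := funext fun j => (ht j).symm
      simp only [DS, mem_preimage, this]
      exact ⟨(hact t _ hx).1, hFact t _ hx⟩)
  have hGmk : ∀ x (hx0 : x ≠ 0), x ∈ D → mkS x hx0 ∈ DS ∧ G (qm z (mkS x hx0)) = F x := by
    intro x hx0 hx
    have hp := inv_pos.2 (nv_pos x hx0)
    have e1 : cx (mkS x hx0) = fun j => (((nv x)⁻¹ : ℝ) : ℂ) * x j := by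
      funext j
      change (mkS x hx0 : EuclideanSpace ℂ (Fin n)) j = _
      rw [mkS_apply]; push_cast; rfl
    have e2 : mkS x hx0 ∈ DS := by
      change cx (mkS x hx0) ∈ D
      rw [e1]; exact (hhom _ hp x hx).1
    refine ⟨e2, ?_⟩
    rw [hG _ e2, e1, hFhom _ hp x hx]
  have hX0 : ∀ e : E, ‖e.1.1‖ ≤ 1 / 2 → X0 e ∈ D ∧ s (X0 e) = 1 ∧ V (X0 e) = e.1.1 := fun e he =>
    hgx e.1.1 he _ fun i hi => xvJ _ _ _ i hi
  have hyX : ∀ e : E, ‖e.1.1‖ ≤ 1 / 2 → ∀ j, j ∉ J → y (X0 e) j = pw (m j) (X0 e j) := by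
    intro e he j hj
    simp only [y, yy]
    rw [(hX0 e he).2.1, Finset.prod_eq_one]
    · simp
    · intro i hi
      have : X0 e i = g e.1.1 i := xvJ _ _ _ i hi
      rw [this]; exact hgp _ he j hj i hi
  have he0 : ‖(0 : E).1.1‖ ≤ 1 / 2 := by
    have : (0 : E).1.1 = 0 := rfl
    rw [this, norm_zero]; norm_num
  obtain ⟨U, Vs, hU, hVs, hp, ⟨hh⟩⟩ := hman (f 0)
  refine abstract_contra (f 0) U Vs hU hVs hp hh (ιR := ιR) (ιC := ιC) (ι := Fin n) hd f hf rfl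
    (qm z '' DS) ((qm_open z).isOpenMap _ hDS) ⟨_, (hGmk _ (xv0 _ _ 0) (hX0 0 he0).1).1, rfl⟩
    (fun q => (G q).1) (fun q => (G q).2) (continuous_fst.comp_continuousOn hGc)
    (continuous_snd.comp_continuousOn hGc) C i1 i2 h12 h1 h2 ?_ ?_ M hM (1/2) (by norm_num) ?_
  · rintro _ ⟨x, hx, rfl⟩
    refine ⟨fun j => y (cx x) j, fun i hi k hk => ?_⟩
    simp only [hG x hx, F]
    rw [if_pos ⟨hCJ i hi, hCJ k hk, hi, hk⟩]
  · rintro _ ⟨x, hx, rfl⟩ hW0 hA0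
    simp only [hG x hx, F] at hW0 hA0
    have hV0 : V (cx x) = 0 := congrArg Prod.fst hW0
    have hy0 : ∀ j : ιC, y (cx x) j = 0 := fun j => congrFun (congrArg Prod.snd hW0) j
    have hsx := hs0 (cx x) hx
    have hx0 : ∀ j, j ∉ J → cx x j = 0 := by
      intro j hj
      have : y (cx x) j = 0 := by
        by_cases hC : j ∈ C
        · have := hA0 j hC
          rw [if_pos ⟨hj, hj, hC, hC⟩, Complex.mul_conj] at this
          exact Complex.normSq_eq_zero.1 (by exact_mod_cast this)
        · exact hy0 ⟨j, hj, hC⟩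
      have h3 := norm_yy J s m μ (cx x) j hsx
      have h4 : yy J s m μ (cx x) j = 0 := this
      rw [h4, norm_zero] at h3
      rcases mul_eq_zero.1 h3.symm with h | h
      · exact absurd h (inv_ne_zero hsx.ne')
      · exact norm_eq_zero.1 h
    obtain ⟨t, ht⟩ := huniq (cx x) hx hV0
    have hX00 : ∀ j, j ∉ J → X0 0 j = 0 := by
      intro j hj
      by_cases e1 : j = i1
      · subst e1
        simp only [X0, xv1]
        change ((alf 0 (‖(0:ℂ)‖ ^ M) : ℝ) : ℂ) * _ = 0
        rw [norm_zero, zero_pow hM.ne', alf_zero 0 le_rfl]; simp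
      by_cases e2 : j = i2
      · subst e2
        simp only [X0, xv2]
        change ((alf (-0) (‖(0:ℂ)‖ ^ M) : ℝ) : ℂ) * _ = 0
        rw [norm_zero, zero_pow hM.ne', neg_zero, alf_zero 0 le_rfl]; simp
      by_cases hjC : j ∈ C
      · exact xvC _ _ _ j hjC e1 e2
      · simp only [X0, xvH _ _ _ j ⟨hj, hjC⟩]
        change _ * (0:ℂ) = 0
        rw [mul_zero]
    have key : ∀ j, (weightProd z t j : ℂ) * cx x j = (s (cx x) : ℂ) * X0 0 j := by
      intro j
      by_cases hj : j ∈ J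
      · have : X0 0 j = g 0 j := xvJ _ _ _ j hj
        rw [this]; exact ht j hj
      · rw [hx0 j hj, hX00 j hj, mul_zero, mul_zero]
    change qm z x = qm z (mkS (X0 0) _)
    rw [qm_eq]
    refine ⟨t, fun j => ?_⟩
    have hnv : s (cx x) * nv (X0 0) = 1 := by
      have e1 : nv (cx x) = nv (fun j => (s (cx x) : ℂ) * X0 0 j) :=
        nv_congr _ _ fun j => by rw [← key j, norm_mul, Circle.norm_coe, one_mul]
      rw [nv_sph x] at e1
      have e2 : (WithLp.toLp 2 (fun j => (s (cx x) : ℂ) * X0 0 j) : EuclideanSpace ℂ (Fin n))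
        = (s (cx x) : ℂ) • WithLp.toLp 2 (X0 0) := by ext j; simp
      unfold nv at e1
      rw [e2, norm_smul, Complex.norm_real, Real.norm_eq_abs, abs_of_pos hsx] at e1
      exact e1.symm
    rw [mkS_apply]
    have : ((nv (X0 0))⁻¹ : ℂ) = (s (cx x) : ℂ) := by
      have h5 : (nv (X0 0))⁻¹ = s (cx x) := (eq_inv_of_mul_eq_one_left hnv).symm
      rw [← h5]; push_cast; rfl
    rw [this]
    exact key j
  · intro e he
    have he1 : ‖e.1.1‖ ≤ 1 / 2 := (norm_fst_le e.1).trans ((norm_fst_le e).trans he)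
    obtain ⟨hXD, hXs, hXV⟩ := hX0 e he1
    have hGe : G (f e) = F (X0 e) := (hGmk _ (xv0 _ _ e) hXD).2
    simp only [hGe, F, finalMap, modelMap]
    have y1 : y (X0 e) i1 = (a1 e : ℂ) := by
      rw [hyX e he1 i1 (hCJ i1 h1)]
      simp only [X0, xv1, Pi.one_apply, Circle.coe_one, mul_one]
      exact pw_nonneg _ _ (alf_nonneg _ _)
    have y2 : y (X0 e) i2 = (a2 e : ℂ) * ((ph e.2.2 ^ M : Circle) : ℂ) := by
      rw [hyX e he1 i2 (hCJ i2 h2)]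
      simp only [X0, xv2]
      rw [mul_comm, pw_circle, hm2, pw_nonneg _ _ (alf_nonneg _ _), zpow_natCast, mul_comm]
    rw [if_pos ⟨hCJ i1 h1, hCJ i1 h1, h1, h1⟩, if_pos ⟨hCJ i2 h2, hCJ i2 h2, h2, h2⟩,
      if_pos ⟨hCJ i2 h2, hCJ i1 h1, h2, h1⟩]
    refine Prod.ext (Prod.ext hXV ?_) (Prod.ext ?_ ?_)
    · funext j
      simp only []
      rw [hyX e he1 j j.2.1, hmH j j.2.1 j.2.2]
      have : X0 e j = _ := xvH _ _ e j j.2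
      rw [this]
      exact pw_nat M _ hM
    · simp only [Complex.mul_conj, y1, y2]
      simp only [map_mul, Complex.normSq_ofReal, Circle.normSq_coe]
      rw [mul_one, ← Complex.ofReal_sub, Complex.ofReal_re]
      have := alf_diff e.2.1 (‖e.2.2‖ ^ M)
      simp only [a1, a2]
      linarith
    · simp only [y1, y2, Complex.conj_ofReal]
      have := alf_mul e.2.1 (‖e.2.2‖ ^ M) (by positivity)
      conv_rhs => rw [← ph_mul e.2.2, mul_pow]
      have h3 : (a1 e : ℂ) * (a2 e : ℂ) = (‖e.2.2‖ : ℂ) ^ M := by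
        simp only [a1, a2]
        exact_mod_cast this
      rw [← h3, Circle.coe_pow]; ring
end SecD3

section SecD4
variable {n r : ℕ} (z : Fin r → Fin n → ℤ)

lemma wp_zpow (t : Fin r → Circle) (j : Fin n) (m : ℤ) :
    weightProd z t j ^ m = ∏ i, t i ^ (m * z i j) := by
  unfold weightProd
  rw [← Finset.prod_zpow]
  refine Finset.prod_congr rfl fun i _ => ?_
  rw [← zpow_mul, mul_comm]

lemma wp_sum (t : Fin r → Circle) (J : Finset (Fin n)) (μ : Fin n → ℤ) :
    ∏ k ∈ J, weightProd z t k ^ μ k = ∏ i, t i ^ (∑ k ∈ J, μ k * z i k) := by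
  simp only [wp_zpow]
  rw [Finset.prod_comm]
  refine Finset.prod_congr rfl fun i _ => ?_
  induction J using Finset.induction_on with
  | empty => simp
  | insert a s ha ih => rw [Finset.prod_insert ha, Finset.sum_insert ha, zpow_add, ih]

def RP (C J : Finset (Fin n)) (i2 j : Fin n) (M : ℕ) : Prop :=
  ∃ (m : ℤ) (μ : Fin n → ℤ), (j ∉ C → m = M) ∧ (j = i2 → m = M) ∧
    (∀ k, (∀ i, z i k = 0) → μ k = 0) ∧
    ∀ i, m * z i j = (if j ∈ C then M * z i i2 else 0) + ∑ k ∈ J, μ k * z i k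

lemma RP_mul (C J : Finset (Fin n)) (i2 j : Fin n) (M N : ℕ) (h : RP z C J i2 j M) :
    RP z C J i2 j (N * M) := by
  obtain ⟨m, μ, h1, h2, h3, h4⟩ := h
  refine ⟨N * m, fun k => N * μ k, fun h => by rw [h1 h]; push_cast; rfl,
    fun h => by rw [h2 h]; push_cast; rfl, fun k hk => by simp [h3 k hk], fun i => ?_⟩
  have : ∑ k ∈ J, (N : ℤ) * μ k * z i k = N * ∑ k ∈ J, μ k * z i k := by
    rw [Finset.mul_sum]; exact Finset.sum_congr rfl fun k _ => by ring
  rw [this, mul_assoc, h4 i]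
  split_ifs <;> push_cast <;> ring

lemma RP_ex (ℓ : Fin r → ℤ) (C J : Finset (Fin n)) (i2 : Fin n) (hi2 : i2 ∈ C)
    (hC : ∀ j, j ∈ C ↔ ∑ i, ℓ i * z i j ≠ 0)
    (hspan : ∀ v : Fin r → ℤ, ∑ i, ℓ i * v i = 0 → ∃ N : ℕ, 0 < N ∧ ∃ μ : Fin n → ℤ,
      ∀ i, N * v i = ∑ k ∈ J, μ k * z i k) (j : Fin n) : ∃ M : ℕ, 0 < M ∧ RP z C J i2 j M := by
  classical
  have hspan' : ∀ v : Fin r → ℤ, ∑ i, ℓ i * v i = 0 → ∃ N : ℕ, 0 < N ∧ ∃ μ : Fin n → ℤ,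
      (∀ k, (∀ i, z i k = 0) → μ k = 0) ∧ ∀ i, N * v i = ∑ k ∈ J, μ k * z i k := by
    intro v hv
    obtain ⟨N, hN, μ, hμ⟩ := hspan v hv
    refine ⟨N, hN, fun k => if ∀ i, z i k = 0 then 0 else μ k, fun k hk => by simp [hk], fun i => ?_⟩
    rw [hμ i]
    refine Finset.sum_congr rfl fun k _ => ?_
    by_cases hk : ∀ i, z i k = 0
    · simp [hk]
    · simp [hk]
  by_cases hj2 : j = i2
  · subst hj2
    exact ⟨1, one_pos, 1, 0, fun _ => rfl, fun _ => rfl, fun _ _ => rfl, fun i => by simp [hi2]⟩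
  by_cases hj : j ∈ C
  · let w : Fin n → ℤ := fun j => ∑ i, ℓ i * z i j
    have hwj : w j ≠ 0 := (hC j).1 hj
    obtain ⟨N, hN, μ, hμ0, hμ⟩ := hspan' (fun i => w i2 * z i j - w j * z i i2) (by
      have : ∀ i, ℓ i * (w i2 * z i j - w j * z i i2) = w i2 * (ℓ i * z i j) - w j * (ℓ i * z i i2) :=
        fun i => by ring
      simp only [this]
      rw [Finset.sum_sub_distrib, ← Finset.mul_sum, ← Finset.mul_sum]
      change w i2 * w j - w j * w i2 = 0
      ring)
    refine ⟨N * (w j).natAbs, Nat.mul_pos hN (Int.natAbs_pos.2 hwj), N * w i2 * (w j).sign,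
      fun k => μ k * (w j).sign, fun h => absurd hj h, fun h => absurd h hj2,
      fun k hk => by simp [hμ0 k hk], fun i => ?_⟩
    have : ∑ k ∈ J, μ k * (w j).sign * z i k = (w j).sign * ∑ k ∈ J, μ k * z i k := by
      rw [Finset.mul_sum]; exact Finset.sum_congr rfl fun k _ => by ring
    rw [this, ← hμ i, if_pos hj]
    push_cast
    rw [Int.abs_eq_natAbs, ← Int.sign_mul_self_eq_natAbs]
    ring
  · have h0 : ∑ i, ℓ i * z i j = 0 := by
      by_contra h; exact hj ((hC j).2 h)
    obtain ⟨N, hN, μ, hμ0, hμ⟩ := hspan' (fun i => z i j) h0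
    exact ⟨N, hN, N, μ, fun _ => rfl, fun _ => rfl, hμ0, fun i => by rw [if_neg hj, zero_add]; exact hμ i⟩

lemma RP_all (ℓ : Fin r → ℤ) (C J : Finset (Fin n)) (i2 : Fin n) (hi2 : i2 ∈ C)
    (hC : ∀ j, j ∈ C ↔ ∑ i, ℓ i * z i j ≠ 0)
    (hspan : ∀ v : Fin r → ℤ, ∑ i, ℓ i * v i = 0 → ∃ N : ℕ, 0 < N ∧ ∃ μ : Fin n → ℤ,
      ∀ i, N * v i = ∑ k ∈ J, μ k * z i k) :
    ∃ (M : ℕ) (m : Fin n → ℤ) (μ : Fin n → Fin n → ℤ), 0 < M ∧ (∀ j, j ∉ J → j ∉ C → m j = M) ∧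
      m i2 = M ∧ (∀ j k, (∀ i, z i k = 0) → μ j k = 0) ∧
      ∀ t : Fin r → Circle, ∀ j, j ∉ J → weightProd z t j ^ m j =
      (if j ∈ C then weightProd z t i2 ^ M else 1) * ∏ i ∈ J, weightProd z t i ^ μ j i := by
  choose M hM hRP using RP_ex z ℓ C J i2 hi2 hC hspan
  have hR : ∀ j, RP z C J i2 j (∏ k, M k) := by
    intro j
    rw [← Finset.prod_erase_mul _ _ (Finset.mem_univ j)]
    exact RP_mul z C J i2 j _ _ (hRP j)
  choose m μ h1 h2 h3 h4 using hR
  refine ⟨∏ k, M k, m, μ, Finset.prod_pos fun k _ => hM k, fun j _ hj => h1 j hj, h2 i2 rfl, h3,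
    fun t j _ => ?_⟩
  rw [wp_sum, wp_zpow]
  simp only [h4 j]
  by_cases hj : j ∈ C
  · simp only [if_pos hj, zpow_add, Finset.prod_mul_distrib]
    rw [← zpow_natCast, wp_zpow]
  · simp only [if_neg hj, zero_add, one_mul]

lemma card_ιC (J C : Finset (Fin n)) (hJC : Disjoint J C) :
    Fintype.card {j : Fin n // j ∉ J ∧ j ∉ C} + J.card + C.card = n := by
  have : Fintype.card {j : Fin n // j ∉ J ∧ j ∉ C} = ((J ∪ C)ᶜ : Finset (Fin n)).card := by
    rw [Fintype.card_subtype]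
    congr 1
    ext j; simp
  rw [this, Finset.card_compl, Finset.card_union_of_disjoint hJC, Fintype.card_fin]
  have : J.card + C.card ≤ n := by
    rw [← Finset.card_union_of_disjoint hJC]
    simpa using Finset.card_le_univ (J ∪ C)
  omega

lemma finrank_ESp (ιR ιC : Type) [Fintype ιR] [Fintype ιC] :
    Module.finrank ℝ (ESp ιR ιC) = Fintype.card ιR + 2 * Fintype.card ιC + 3 := by
  simp only [ESp, WSp, Module.finrank_prod, Module.finrank_pi_fintype, Complex.finrank_real_complex,
    Module.finrank_self, Finset.sum_const, smul_eq_mul, Finset.card_univ]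
  ring

/-- zero-column case -/
theorem case_B (ℓ : Fin r → ℤ) (C : Finset (Fin n)) (h0 : Fin n) (hh0 : ∀ i, z i h0 = 0)
    (hC : ∀ j, j ∈ C ↔ ∑ i, ℓ i * z i j ≠ 0) (hr : r ≤ 1) (hC3 : 3 ≤ C.card)
    (hman : LocallyEuclidean (OrbitSpace z) (2 * n - 1 - r))
    (hspan : ∀ v : Fin r → ℤ, ∑ i, ℓ i * v i = 0 → ∃ N : ℕ, 0 < N ∧ ∃ μ : Fin n → ℤ,
      ∀ i, N * v i = ∑ k ∈ ({h0} : Finset (Fin n)), μ k * z i k) : False := by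
  classical
  obtain ⟨i1, h1, i2, h2, h12⟩ := Finset.one_lt_card.1 (by omega : 1 < C.card)
  obtain ⟨M, m, μ, hM, hmH, hm2, hμ0, hχ⟩ := RP_all z ℓ C {h0} i2 h2 hC hspan
  have hJC : Disjoint ({h0} : Finset (Fin n)) C := by
    rw [Finset.disjoint_singleton_left, hC]
    simp [hh0]
  have hw : ∀ t, weightProd z t h0 = 1 := fun t => by simp [weightProd, hh0]
  refine geom z hman ℓ {h0} C hJC (fun j hj => by by_contra h; exact hj ((hC j).2 h)) i1 i2 h12 h1 h2
    ((hC i2).1 h2) Unit ?_ M hM m μ hmH hm2 hχ {x | 0 < (x h0).re} ?_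
    (fun x => (x h0).re) (fun x _ => (x h0).im / (x h0).re) ?_ ?_ (fun x hx => hx) ?_ ?_ ?_
    (fun v _ => 1 + (v () : ℂ) * Complex.I) ?_ ?_ ?_ ?_ ?_
  · rw [finrank_ESp]
    have := card_ιC {h0} C hJC
    rw [Finset.card_singleton] at this
    simp only [Fintype.card_unit]
    omega
  · exact isOpen_lt continuous_const (Complex.continuous_re.comp (continuous_apply h0))
  · exact (Complex.continuous_re.comp (continuous_apply h0)).continuousOn
  · refine continuousOn_pi.2 fun _ => ContinuousOn.div ?_ ?_ ?_
    · exact (Complex.continuous_im.comp (continuous_apply h0)).continuousOn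
    · exact (Complex.continuous_re.comp (continuous_apply h0)).continuousOn
    · intro x hx; exact (show 0 < (x h0).re from hx).ne'
  · intro x hx i hi h
    rw [Finset.mem_singleton] at hi
    subst hi
    rw [mem_setOf_eq, h] at hx
    simp at hx
  · intro t x hx
    simp only [hw, Circle.coe_one, one_mul, mem_setOf_eq]
    exact ⟨hx, trivial, trivial⟩
  · intro a ha x hx
    simp only [Complex.re_ofReal_mul, Complex.im_ofReal_mul, mem_setOf_eq]
    refine ⟨mul_pos ha hx, trivial, ?_⟩
    funext _
    rw [mul_div_mul_left _ _ ha.ne']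
  · fun_prop
  · intro v
    refine ⟨h0, by simp, fun h => ?_⟩
    have := congrArg Complex.re h
    simp at this
  · intro v hv x hx
    have := hx h0 (by simp)
    have e1 : (x h0).re = 1 := by rw [this]; simp
    have e2 : (x h0).im = v () := by rw [this]; simp
    refine ⟨?_, e1, ?_⟩
    · simp [e1]
    · funext u
      rw [e1, e2, div_one]
  · intro v hv j hj i hi
    rw [Finset.mem_singleton] at hi
    subst hi
    rw [hμ0 j _ hh0, neg_zero, zpow_zero]
  · intro x hx hV
    refine ⟨1, fun i hi => ?_⟩
    rw [Finset.mem_singleton] at hi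
    subst hi
    have hx' : 0 < (x i).re := hx
    have := congrFun hV ()
    simp only [Pi.zero_apply, div_eq_zero_iff] at this
    have him : (x i).im = 0 := by
      rcases this with h | h
      · exact h
      · exact absurd h hx'.ne'
    rw [hw]
    apply Complex.ext <;> simp [him]

/-- independent case -/
theorem case_A (ℓ : Fin r → ℤ) (C J : Finset (Fin n)) (h0 : Fin n) (hh0 : h0 ∈ J)
    (hC : ∀ j, j ∈ C ↔ ∑ i, ℓ i * z i j ≠ 0) (hJC : Disjoint J C) (hr : r ≤ J.card + 1) (hC3 : 3 ≤ C.card)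
    (hman : LocallyEuclidean (OrbitSpace z) (2 * n - 1 - r))
    (hspan : ∀ v : Fin r → ℤ, ∑ i, ℓ i * v i = 0 → ∃ N : ℕ, 0 < N ∧ ∃ μ : Fin n → ℤ,
      ∀ i, N * v i = ∑ k ∈ J, μ k * z i k)
    (hsurj : ∀ c : Fin n → Circle, ∃ t, ∀ i ∈ J, weightProd z t i = c i) : False := by
  classical
  obtain ⟨i1, h1, i2, h2, h12⟩ := Finset.one_lt_card.1 (by omega : 1 < C.card)
  obtain ⟨M, m, μ, hM, hmH, hm2, hμ0, hχ⟩ := RP_all z ℓ C J i2 h2 hC hspan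
  let ιR := {h : Fin n // h ∈ J ∧ h ≠ h0}
  have hcR : Fintype.card ιR + 1 = J.card := by
    have : Fintype.card ιR = (J.erase h0).card := by
      rw [Fintype.card_subtype]
      congr 1
      ext j; simp [and_comm]
    rw [this, Finset.card_erase_add_one hh0]
  let g : (ιR → ℝ) → Fin n → ℂ := fun v h =>
    if hh : h ∈ J ∧ h ≠ h0 then (((1 + v ⟨h, hh⟩ : ℝ)) : ℂ) else 1
  have g1 : ∀ v, g v h0 = 1 := fun v => by simp [g]
  have g2 : ∀ v h (hh : h ∈ J ∧ h ≠ h0), g v h = (((1 + v ⟨h, hh⟩ : ℝ)) : ℂ) := fun v h hh => by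
    simp only [g, dif_pos hh]
  have gpos : ∀ v : ιR → ℝ, ‖v‖ ≤ 1/2 → ∀ i, 0 < 1 + v i := by
    intro v hv i
    have := (norm_le_pi_norm v i).trans hv
    rw [Real.norm_eq_abs, abs_le] at this
    linarith
  refine geom z hman ℓ J C hJC (fun j hj => by by_contra h; exact hj ((hC j).2 h)) i1 i2 h12 h1 h2
    ((hC i2).1 h2) ιR ?_ M hM m μ hmH hm2 hχ {x | ∀ i ∈ J, x i ≠ 0} ?_
    (fun x => ‖x h0‖) (fun x h => ‖x h.1‖ / ‖x h0‖ - 1) ?_ ?_ ?_ (fun x hx => hx) ?_ ?_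
    g ?_ ?_ ?_ ?_ ?_
  · rw [finrank_ESp]
    have := card_ιC J C hJC
    omega
  · have : {x : Fin n → ℂ | ∀ i ∈ J, x i ≠ 0} = ⋂ i ∈ J, {x | x i ≠ 0} := by ext; simp
    rw [this]
    exact isOpen_biInter_finset fun i _ => isOpen_ne.preimage (continuous_apply i)
  · exact (continuous_apply h0).norm.continuousOn
  · refine continuousOn_pi.2 fun h => (ContinuousOn.div ?_ ?_ ?_).sub continuousOn_const
    · exact (continuous_apply h.1).norm.continuousOn
    · exact (continuous_apply h0).norm.continuousOn
    · intro x hx; exact norm_ne_zero_iff.2 (hx h0 hh0)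
  · intro x hx; exact norm_pos_iff.2 (hx h0 hh0)
  · intro t x hx
    simp only [norm_mul, Circle.norm_coe, one_mul, mem_setOf_eq]
    exact ⟨fun i hi => mul_ne_zero (Circle.coe_ne_zero _) (hx i hi), trivial, trivial⟩
  · intro a ha x hx
    simp only [norm_mul, Complex.norm_real, Real.norm_eq_abs, abs_of_pos ha, mem_setOf_eq]
    refine ⟨fun i hi => mul_ne_zero (by exact_mod_cast ha.ne') (hx i hi), trivial, ?_⟩
    funext h
    rw [mul_div_mul_left _ _ ha.ne']
  · refine continuous_pi fun h => ?_
    by_cases hh : h ∈ J ∧ h ≠ h0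
    · simp only [g2 _ h hh]
      exact Complex.continuous_ofReal.comp (continuous_const.add (continuous_apply _))
    · simp only [g, dif_neg hh]
      exact continuous_const
  · intro v
    exact ⟨h0, hh0, by rw [g1]; exact one_ne_zero⟩
  · intro v hv x hx
    have e0 : ‖x h0‖ = 1 := by rw [hx h0 hh0, g1, norm_one]
    refine ⟨fun i hi => ?_, e0, ?_⟩
    · rw [hx i hi]
      by_cases hi0 : i = h0
      · rw [hi0, g1]; exact one_ne_zero
      · rw [g2 v i ⟨hi, hi0⟩]
        exact_mod_cast (gpos v hv _).ne'
    · funext h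
      rw [e0, hx h h.2.1, g2 v h h.2, Complex.norm_real, Real.norm_eq_abs, abs_of_pos (gpos v hv _)]
      simp
  · intro v hv j hj i hi
    have : ph (g v i) = 1 := by
      by_cases hi0 : i = h0
      · rw [hi0, g1]
        have := ph_one 1 zero_le_one
        simpa using this
      · rw [g2 v i ⟨hi, hi0⟩]
        exact ph_one _ (gpos v hv _).le
    rw [this, one_zpow]
  · intro x hx hV
    obtain ⟨t, ht⟩ := hsurj fun i => (ph (x i))⁻¹
    refine ⟨t, fun i hi => ?_⟩
    have hn : ‖x i‖ = ‖x h0‖ := by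
      by_cases hi0 : i = h0
      · rw [hi0]
      · have := congrFun hV ⟨i, hi, hi0⟩
        simp only [Pi.zero_apply] at this
        have hp : ‖x h0‖ ≠ 0 := norm_ne_zero_iff.2 (hx h0 hh0)
        field_simp at this
        linarith
    have hg : g 0 i = 1 := by
      by_cases hi0 : i = h0
      · rw [hi0, g1]
      · rw [g2 0 i ⟨hi, hi0⟩]; simp
    rw [ht i hi, hg, mul_one, ← hn]
    conv_lhs => rw [← ph_mul (x i)]
    have hne : (ph (x i) : ℂ) ≠ 0 := Circle.coe_ne_zero _
    rw [ph_mul, Circle.coe_inv]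
    rw [inv_mul_eq_iff_eq_mul₀ hne, mul_comm]
    exact (ph_mul (x i)).symm
end SecD4

section SecE1
variable {n r : ℕ} (z : Fin r → Fin n → ℤ)

abbrev clq (j : Fin n) : Fin r → ℚ := fun i => (z i j : ℚ)

def wq (φ : Fin r → ℚ) (j : Fin n) : ℚ := ∑ i, φ i * (z i j : ℚ)

def spq (φ : Fin r → ℚ) : Finset (Fin n) := Finset.univ.filter fun j => wq z φ j ≠ 0

lemma mem_spq (φ : Fin r → ℚ) (j : Fin n) : j ∈ spq z φ ↔ wq z φ j ≠ 0 := by simp [spq]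

lemma wq_comb (a b : ℚ) (φ ψ : Fin r → ℚ) (j : Fin n) :
    wq z (fun i => a * φ i + b * ψ i) j = a * wq z φ j + b * wq z ψ j := by
  unfold wq
  rw [Finset.mul_sum, Finset.mul_sum, ← Finset.sum_add_distrib]
  exact Finset.sum_congr rfl fun i _ => by ring

lemma clear_den {ι : Type} [Fintype ι] (q : ι → ℚ) : ∃ N : ℕ, 0 < N ∧ ∃ ℓ : ι → ℤ,
    ∀ i, (ℓ i : ℚ) = N * q i := by
  refine ⟨∏ k, (q k).den, Finset.prod_pos fun k _ => (q k).den_pos, ?_⟩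
  have : ∀ i, ∃ l : ℤ, (l : ℚ) = (∏ k, (q k).den : ℕ) * q i := by
    intro i
    obtain ⟨c, hc⟩ := Finset.dvd_prod_of_mem (fun k => (q k).den) (Finset.mem_univ i)
    refine ⟨c * (q i).num, ?_⟩
    rw [hc]
    push_cast
    have := Rat.mul_den_eq_num (q i)
    rw [← this]; ring
  choose ℓ hℓ using this
  exact ⟨ℓ, hℓ⟩

lemma wq_inj (heff : Submodule.span ℤ (Set.range fun j => fun i => z i j) = ⊤) (φ : Fin r → ℚ)
    (h : ∀ j, wq z φ j = 0) : φ = 0 := by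
  have key : ∀ v ∈ Submodule.span ℤ (Set.range fun j => fun i => z i j), ∑ i, φ i * (v i : ℚ) = 0 := by
    intro v hv
    induction hv using Submodule.span_induction with
    | mem x hx => obtain ⟨j, rfl⟩ := hx; exact h j
    | zero => simp
    | add x y _ _ hx hy =>
      simp only [Pi.add_apply, Int.cast_add, mul_add, Finset.sum_add_distrib, hx, hy, add_zero]
    | smul a x _ hx =>
      have : ∀ i, φ i * ((a • x) i : ℚ) = a * (φ i * x i) := fun i => by
        simp only [Pi.smul_apply, smul_eq_mul]; push_cast; ring
      simp only [this, ← Finset.mul_sum, hx, mul_zero]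
  funext i
  have := key (Pi.single i 1) (by rw [heff]; trivial)
  simpa [Pi.single_apply] using this

lemma dual_dot (f : (Fin r → ℚ) →ₗ[ℚ] ℚ) (v : Fin r → ℚ) :
    f v = ∑ i, f (Pi.single i 1) * v i := by
  rw [LinearMap.pi_apply_eq_sum_univ f v]
  refine Finset.sum_congr rfl fun i _ => ?_
  rw [smul_eq_mul, mul_comm]
  congr 2
  funext k
  simp [Pi.single_apply, eq_comm]

lemma sep (S : Submodule ℚ (Fin r → ℚ)) (v : Fin r → ℚ) (hv : v ∉ S) :
    ∃ φ : Fin r → ℚ, (∀ s ∈ S, ∑ i, φ i * s i = 0) ∧ ∑ i, φ i * v i ≠ 0 := by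
  obtain ⟨f, hf, hS⟩ := Submodule.exists_le_ker_of_notMem hv
  refine ⟨fun i => f (Pi.single i 1), fun s hs => ?_, ?_⟩
  · rw [← dual_dot]; exact hS hs
  · rw [← dual_dot]; exact hf

lemma hyper (heff : Submodule.span ℤ (Set.range fun j => fun i => z i j) = ⊤) (φ : Fin r → ℚ)
    (hne : (spq z φ).Nonempty) (hmin : ∀ ψ, spq z ψ ⊂ spq z φ → spq z ψ = ∅) (v : Fin r → ℚ)
    (hv : ∑ i, φ i * v i = 0) : v ∈ Submodule.span ℚ (clq z '' {j | j ∉ spq z φ}) := by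
  by_contra hcon
  obtain ⟨ψ, h1, h2⟩ := sep _ v hcon
  obtain ⟨j0, hj0⟩ := hne
  let χ : Fin r → ℚ := fun i => wq z φ j0 * ψ i + (- wq z ψ j0) * φ i
  have hχ := wq_comb z (wq z φ j0) (- wq z ψ j0) ψ φ
  have hsub : spq z χ ⊂ spq z φ := by
    refine ⟨fun j hj => ?_, fun h => ?_⟩
    · by_contra hj'
      rw [mem_spq] at hj
      apply hj
      rw [hχ]
      have e1 : wq z ψ j = 0 := h1 _ (Submodule.subset_span ⟨j, hj', rfl⟩)
      have e2 : wq z φ j = 0 := by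
        by_contra h; exact hj' ((mem_spq z φ j).2 h)
      rw [e1, e2]; ring
    · have := h hj0
      rw [mem_spq, hχ] at this
      apply this; ring
  have h3 := hmin χ hsub
  have h4 : χ = 0 := wq_inj z heff χ fun j => by
    by_contra h
    have := (mem_spq z χ j).2 h
    rw [h3] at this; simp at this
  have h5 : ∑ i, χ i * v i = 0 := by rw [h4]; simp
  have h6 : ∑ i, χ i * v i = wq z φ j0 * ∑ i, ψ i * v i + (- wq z ψ j0) * ∑ i, φ i * v i := by
    rw [Finset.mul_sum, Finset.mul_sum, ← Finset.sum_add_distrib]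
    exact Finset.sum_congr rfl fun i _ => by simp only [χ]; ring
  rw [h5, hv, mul_zero, add_zero] at h6
  rcases mul_eq_zero.1 h6.symm with h | h
  · exact (mem_spq z φ j0).1 hj0 h
  · exact h2 h

lemma span_int (J : Finset (Fin n)) (v : Fin r → ℤ)
    (hv : (fun i => (v i : ℚ)) ∈ Submodule.span ℚ (clq z '' (J : Set (Fin n)))) :
    ∃ N : ℕ, 0 < N ∧ ∃ μ : Fin n → ℤ, ∀ i, N * v i = ∑ k ∈ J, μ k * z i k := by
  rw [Submodule.mem_span_image_finset_iff_exists_fun'] at hv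
  obtain ⟨c, hc⟩ := hv
  obtain ⟨N, hN, μ, hμ⟩ := clear_den c
  refine ⟨N, hN, μ, fun i => ?_⟩
  have := congrFun hc i
  simp only [Finset.sum_apply, Pi.smul_apply, smul_eq_mul] at this
  have h2 : ((N * v i : ℤ) : ℚ) = ((∑ k ∈ J, μ k * z i k : ℤ) : ℚ) := by
    push_cast
    rw [← this, Finset.mul_sum]
    exact Finset.sum_congr rfl fun k _ => by rw [hμ]; ring
  exact_mod_cast h2

lemma span_rank (J : Finset (Fin n)) (φ : Fin r → ℚ)
    (h : ∀ v : Fin r → ℚ, ∑ i, φ i * v i = 0 → v ∈ Submodule.span ℚ (clq z '' (J : Set (Fin n)))) :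
    r ≤ J.card + 1 := by
  classical
  let f : (Fin r → ℚ) →ₗ[ℚ] ℚ := ∑ i, φ i • LinearMap.proj i
  have hf : ∀ v, f v = ∑ i, φ i * v i := fun v => by simp [f]
  have h1 : LinearMap.ker f ≤ Submodule.span ℚ ((J.image (clq z) : Finset (Fin r → ℚ)) : Set (Fin r → ℚ)) := by
    intro v hv
    rw [Finset.coe_image]
    exact h v (by rw [← hf]; exact hv)
  have h2 := Submodule.finrank_mono h1
  have h3 := finrank_span_finset_le_card (R := ℚ) (J.image (clq z))
  have h3' : Module.finrank ℚ (Submodule.span ℚ ((J.image (clq z) : Finset (Fin r → ℚ)) : Set (Fin r → ℚ))) ≤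
    (J.image (clq z)).card := h3
  have h4 := Finset.card_image_le (s := J) (f := clq z)
  have h5 := LinearMap.finrank_range_add_finrank_ker f
  have h6 : Module.finrank ℚ (LinearMap.range f) ≤ 1 := by
    simpa using Submodule.finrank_le (LinearMap.range f)
  simp only [Module.finrank_fin_fun] at h5
  omega

lemma surj_torus (J : Finset (Fin n)) (hJ : LinearIndepOn ℚ (clq z) (J : Set (Fin n)))
    (c : Fin n → Circle) : ∃ t, ∀ i ∈ J, weightProd z t i = c i := by
  classical
  have hdual : ∀ k ∈ J, ∃ ℓ : Fin r → ℤ, ∑ i, ℓ i * z i k ≠ 0 ∧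
      ∀ j ∈ J, j ≠ k → ∑ i, ℓ i * z i j = 0 := by
    intro k hk
    have hnot : clq z k ∉ Submodule.span ℚ (clq z '' ((J : Set (Fin n)) \ {k})) := by
      exact LinearIndepOn.notMem_span hJ hk
    obtain ⟨φ, h1, h2⟩ := sep _ _ hnot
    obtain ⟨N, hN, ℓ, hℓ⟩ := clear_den φ
    have hc : ∀ j, ((∑ i, ℓ i * z i j : ℤ) : ℚ) = N * ∑ i, φ i * clq z j i := by
      intro j
      push_cast
      rw [Finset.mul_sum]
      exact Finset.sum_congr rfl fun i _ => by rw [hℓ]; ring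
    refine ⟨ℓ, fun h => ?_, fun j hj hjk => ?_⟩
    · have := hc k
      rw [h, Int.cast_zero] at this
      rcases mul_eq_zero.1 this.symm with h | h
      · exact hN.ne' (by exact_mod_cast h)
      · exact h2 h
    · have := hc j
      rw [h1 _ (Submodule.subset_span ⟨j, ⟨hj, by simpa using hjk⟩, rfl⟩), mul_zero] at this
      exact_mod_cast this
  have hone : ∀ k ∈ J, ∃ t : Fin r → Circle, weightProd z t k = c k ∧
      ∀ j ∈ J, j ≠ k → weightProd z t j = 1 := by
    intro k hk
    obtain ⟨ℓ, h1, h2⟩ := hdual k hk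
    obtain ⟨u, hu⟩ := circle_root (c k) _ h1
    refine ⟨fun i => u ^ ℓ i, by rw [wp_pow, hu], fun j hj hjk => by rw [wp_pow, h2 j hj hjk, zpow_zero]⟩
  have hall : ∀ K : Finset (Fin n), K ⊆ J → ∃ t : Fin r → Circle, (∀ k ∈ K, weightProd z t k = c k) ∧
      ∀ j ∈ J, j ∉ K → weightProd z t j = 1 := by
    intro K
    induction K using Finset.induction_on with
    | empty => exact fun _ => ⟨1, by simp, fun j _ _ => by simp [weightProd]⟩
    | insert a s ha ih =>
      intro hs
      obtain ⟨t, ht1, ht2⟩ := ih fun x hx => hs (Finset.mem_insert_of_mem hx)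
      have haJ := hs (Finset.mem_insert_self a s)
      obtain ⟨t', h1, h2⟩ := hone a haJ
      refine ⟨t * t', fun k hk => ?_, fun j hj hjs => ?_⟩
      · rw [wp_mul]
        rcases Finset.mem_insert.1 hk with rfl | hk'
        · rw [ht2 _ haJ ha, h1, one_mul]
        · rw [ht1 k hk', h2 k (hs hk) (fun h => ha (h ▸ hk')), mul_one]
      · rw [Finset.mem_insert, not_or] at hjs
        rw [wp_mul, ht2 j hj hjs.2, h2 j hj hjs.1, one_mul]
  obtain ⟨t, ht, -⟩ := hall J subset_rfl
  exact ⟨t, ht⟩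

theorem case_three (heff : Submodule.span ℤ (Set.range fun j => fun i => z i j) = ⊤)
    (hman : LocallyEuclidean (OrbitSpace z) (2 * n - 1 - r)) (φ : Fin r → ℚ)
    (hc3 : 3 ≤ (spq z φ).card) (hmin : ∀ ψ, spq z ψ ⊂ spq z φ → spq z ψ = ∅)
    (h0 : Fin n) (hh0 : h0 ∉ spq z φ) : False := by
  classical
  obtain ⟨N, hN, ℓ, hℓ⟩ := clear_den φ
  have hN' : (N : ℚ) ≠ 0 := by exact_mod_cast hN.ne'
  have hdot : ∀ v : Fin r → ℤ, ((∑ i, ℓ i * v i : ℤ) : ℚ) = N * ∑ i, φ i * (v i : ℚ) := by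
    intro v
    push_cast
    rw [Finset.mul_sum]
    exact Finset.sum_congr rfl fun i _ => by rw [hℓ]; ring
  have hC : ∀ j, j ∈ spq z φ ↔ ∑ i, ℓ i * z i j ≠ 0 := by
    intro j
    rw [mem_spq, ← Int.cast_ne_zero (α := ℚ), hdot, mul_ne_zero_iff]
    exact ⟨fun h => ⟨hN', h⟩, fun h => h.2⟩
  have hyp := hyper z heff φ (Finset.card_pos.1 (by omega)) hmin
  obtain ⟨b, hbt, -, hsp, hli⟩ := exists_linearIndepOn_extension (K := ℚ) (v := clq z)
    (linearIndepOn_empty ℚ (clq z)) (empty_subset {j | j ∉ spq z φ})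
  obtain ⟨J, rfl⟩ : ∃ J : Finset (Fin n), (J : Set (Fin n)) = b := ⟨b.toFinite.toFinset, by simp⟩
  have hyp2 : ∀ v : Fin r → ℚ, ∑ i, φ i * v i = 0 →
      v ∈ Submodule.span ℚ (clq z '' (J : Set (Fin n))) := fun v hv =>
    Submodule.span_le.2 hsp (hyp v hv)
  have hint : ∀ v : Fin r → ℤ, ∑ i, ℓ i * v i = 0 → ∑ i, φ i * (v i : ℚ) = 0 := by
    intro v hv
    have := hdot v
    rw [hv, Int.cast_zero] at this
    exact (mul_eq_zero.1 this.symm).resolve_left hN'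
  have hrk := span_rank z J φ hyp2
  rcases J.eq_empty_or_nonempty with hJ | ⟨k0, hk0⟩
  · subst hJ
    rw [Finset.card_empty] at hrk
    have hz0 : ∀ i, z i h0 = 0 := by
      intro i
      have := hsp ⟨h0, hh0, rfl⟩
      simp only [Finset.coe_empty, image_empty, Submodule.span_empty] at this
      have h2 : clq z h0 = 0 := by simpa using this
      have := congrFun h2 i
      simpa using this
    refine case_B z ℓ (spq z φ) h0 hz0 hC hrk hc3 hman fun v hv => ?_
    refine span_int z {h0} v ?_
    refine Submodule.span_mono ?_ (hyp2 _ (hint v hv))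
    simp
  · refine case_A z ℓ (spq z φ) J k0 hk0 hC ?_ hrk hc3 hman (fun v hv => span_int z J v (hyp2 _ (hint v hv)))
      (surj_torus z J hli)
    rw [Finset.disjoint_left]
    exact fun j hj => hbt hj
end SecE1

section SecE2
variable {n r : ℕ} (z : Fin r → Fin n → ℤ)

lemma min_ex (φ : Fin r → ℚ) (h : (spq z φ).Nonempty) : ∃ ψ, spq z ψ ⊆ spq z φ ∧ (spq z ψ).Nonempty ∧
    ∀ χ, spq z χ ⊂ spq z ψ → spq z χ = ∅ := by
  induction hk : (spq z φ).card using Nat.strong_induction_on generalizing φ with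
  | _ k ih =>
    by_cases hm : ∀ χ, spq z χ ⊂ spq z φ → spq z χ = ∅
    · exact ⟨φ, subset_rfl, h, hm⟩
    · push Not at hm
      obtain ⟨χ, h1, h2⟩ := hm
      obtain ⟨ψ, h3, h4, h5⟩ := ih _ (hk ▸ Finset.card_lt_card h1) χ h2 rfl
      exact ⟨ψ, h3.trans h1.1, h4, h5⟩

lemma wq_sum {ι : Type} (s : Finset ι) (c : ι → ℚ) (f : ι → Fin r → ℚ) (j : Fin n) :
    wq z (fun i => ∑ k ∈ s, c k * f k i) j = ∑ k ∈ s, c k * wq z (f k) j := by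
  unfold wq
  simp only [Finset.sum_mul, Finset.mul_sum]
  rw [Finset.sum_comm]
  exact Finset.sum_congr rfl fun k _ => Finset.sum_congr rfl fun i _ => by ring

lemma rank_eq_s17 (κ : Type) [Fintype κ] [DecidableEq κ] (a : κ → Fin n)
    (hinj : ∀ φ, (∀ k, wq z φ (a k) = 0) → φ = 0)
    (f : κ → Fin r → ℚ) (hf : ∀ k k', wq z (f k) (a k') = if k = k' then 1 else 0) :
    r = Fintype.card κ := by
  let Φ : (Fin r → ℚ) →ₗ[ℚ] (κ → ℚ) :=
    { toFun := fun φ k => wq z φ (a k)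
      map_add' := fun x y => by
        funext k
        have := wq_comb z 1 1 x y (a k)
        simp only [one_mul] at this
        exact this
      map_smul' := fun c x => by
        funext k
        have := wq_comb z c 0 x 0 (a k)
        simp only [Pi.zero_apply, mul_zero, zero_mul, add_zero] at this
        exact this }
  have h1 : Function.Injective Φ := by
    rw [← LinearMap.ker_eq_bot, LinearMap.ker_eq_bot']
    intro φ hφ
    exact hinj φ fun k => congrFun hφ k
  have h2 : Function.Surjective Φ := by
    intro y
    refine ⟨fun i => ∑ k, y k * f k i, ?_⟩
    funext k'
    change wq z (fun i => ∑ k, y k * f k i) (a k') = y k'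
    rw [wq_sum]
    simp [hf]
  have := (LinearEquiv.ofBijective Φ ⟨h1, h2⟩).finrank_eq
  simpa using this

theorem sum_of_circuits (heff : Submodule.span ℤ (Set.range fun j => fun i => z i j) = ⊤)
    (h2 : ∀ φ, (spq z φ).Nonempty → (∀ χ, spq z χ ⊂ spq z φ → spq z χ = ∅) → (spq z φ).card = 2) :
    IsSumOfCircuits z := by
  classical
  let rel : Fin n → Fin n → Prop := fun i j => i = j ∨ ∃ φ, spq z φ = {i, j}
  let S : Setoid (Fin n) :=
    { r := rel
      iseqv := by
        refine ⟨fun i => Or.inl rfl, ?_, ?_⟩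
        · rintro i j (h | ⟨φ, h⟩)
          · exact Or.inl h.symm
          · exact Or.inr ⟨φ, by rw [h, Finset.pair_comm]⟩
        · rintro i j k (rfl | ⟨φ, hφ⟩)
          · exact id
          rintro (rfl | ⟨ψ, hψ⟩)
          · exact Or.inr ⟨φ, hφ⟩
          by_cases hik : i = k
          · exact Or.inl hik
          by_cases hij : i = j
          · subst hij; exact Or.inr ⟨ψ, hψ⟩
          by_cases hjk : j = k
          · subst hjk; exact Or.inr ⟨φ, hφ⟩
          have mφ : ∀ x, wq z φ x ≠ 0 ↔ x = i ∨ x = j := fun x => by rw [← mem_spq, hφ]; simp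
          have mψ : ∀ x, wq z ψ x ≠ 0 ↔ x = j ∨ x = k := fun x => by rw [← mem_spq, hψ]; simp
          right
          refine ⟨fun x => wq z ψ j * φ x + (- wq z φ j) * ψ x, ?_⟩
          ext x
          rw [mem_spq, wq_comb]
          simp only [Finset.mem_insert, Finset.mem_singleton]
          have f1 := (mφ j).2 (Or.inr rfl)
          have f2 := (mψ j).2 (Or.inl rfl)
          by_cases xi : x = i
          · subst xi
            have f3 := (mφ x).2 (Or.inl rfl)
            have f4 : wq z ψ x = 0 := by
              by_contra h; rcases (mψ x).1 h with h | h
              · exact hij h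
              · exact hik h
            simp [f4, f2, f3]
          by_cases xk : x = k
          · subst xk
            have f3 := (mψ x).2 (Or.inr rfl)
            have f4 : wq z φ x = 0 := by
              by_contra h; rcases (mφ x).1 h with h | h
              · exact xi h
              · exact hjk h.symm
            simp [f4, f1, f3]
          simp only [xi, xk, or_self, iff_false, not_not]
          by_cases xj : x = j
          · subst xj; ring
          · have f3 : wq z φ x = 0 := by
              by_contra h; rcases (mφ x).1 h with h | h
              · exact xi h
              · exact xj h
            have f4 : wq z ψ x = 0 := by
              by_contra h; rcases (mψ x).1 h with h | h
              · exact xj h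
              · exact xk h
            rw [f3, f4]; ring }
  let Q := Quotient S
  let cls : Fin n → Q := fun j => Quotient.mk S j
  let b : Fin n → Fin n := fun j => (cls j).out
  have hb : ∀ j, cls (b j) = cls j := fun j => Quotient.out_eq _
  have hbc : ∀ i j, cls i = cls j → b i = b j := fun i j h => by simp only [b, h]
  have hbq : ∀ q : Q, cls q.out = q := fun q => Quotient.out_eq q
  have hbq' : ∀ q : Q, b q.out = q.out := fun q => by simp only [b, hbq]
  let κ := {j : Fin n // b j ≠ j}
  have hφ : ∀ j : κ, ∃ φ, wq z φ j = 1 ∧ wq z φ (b j) ≠ 0 ∧ ∀ x : Fin n, x ≠ j.1 → x ≠ b j.1 → wq z φ x = 0 := by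
    intro j
    have hr : rel (b j) j := Quotient.exact (hb j)
    rcases hr with h | ⟨φ, h⟩
    · exact absurd h j.2
    have m : ∀ x, wq z φ x ≠ 0 ↔ x = b j ∨ x = j := fun x => by rw [← mem_spq, h]; simp
    have hj := (m j).2 (Or.inr rfl)
    have hc : ∀ x, wq z (fun i => (wq z φ j)⁻¹ * φ i + 0 * (0 : Fin r → ℚ) i) x = (wq z φ j)⁻¹ * wq z φ x := fun x => by
      rw [wq_comb]; ring
    refine ⟨fun i => (wq z φ j)⁻¹ * φ i + 0 * (0 : Fin r → ℚ) i, ?_, ?_, ?_⟩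
    · rw [hc, inv_mul_cancel₀ hj]
    · rw [hc]; exact mul_ne_zero (inv_ne_zero hj) ((m _).2 (Or.inl rfl))
    · intro x h1 h2
      rw [hc]
      have : wq z φ x = 0 := by
        by_contra h'
        rcases (m x).1 h' with h | h
        · exact h2 h
        · exact h1 h
      rw [this, mul_zero]
  choose F hF1 hFb hF0 using hφ
  have bb : ∀ j, b (b j) = b j := fun j => hbc _ _ (hb j)
  have hFκ : ∀ k k' : κ, wq z (F k) k' = if k = k' then 1 else 0 := by
    intro k k'
    split_ifs with h
    · rw [← h, hF1]
    · refine hF0 k k' (fun h' => h (Subtype.ext h'.symm)) (fun h' => k'.2 ?_)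
      rw [h', bb]
  have hinj : ∀ φ, (∀ k : κ, wq z φ k = 0) → φ = 0 := by
    intro φ h
    apply wq_inj z heff
    by_contra hne
    push Not at hne
    obtain ⟨j, hj⟩ := hne
    obtain ⟨ψ, h3, h4, h5⟩ := min_ex z φ ⟨j, (mem_spq z φ j).2 hj⟩
    have hbase : ∀ x ∈ spq z ψ, b x = x := by
      intro x hx
      by_contra hxb
      exact (mem_spq z φ x).1 (h3 hx) (h ⟨x, hxb⟩)
    obtain ⟨x, y, hxy, hs⟩ := Finset.card_eq_two.1 (h2 ψ h4 h5)
    have : cls x = cls y := Quotient.sound (s := S) (Or.inr ⟨ψ, hs⟩)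
    apply hxy
    rw [← hbase x (by rw [hs]; simp), ← hbase y (by rw [hs]; simp)]
    exact hbc _ _ this
  have hr : r = Fintype.card κ := rank_eq_s17 z κ (fun k => k.1) hinj F hFκ
  have hexp : ∀ φ j, wq z φ j = ∑ k : κ, wq z φ k * wq z (F k) j := by
    intro φ j
    have h0 : (fun i => 1 * φ i + (-1) * (fun i => ∑ k : κ, wq z φ k * F k i) i) = 0 := by
      apply hinj
      intro k
      rw [wq_comb, wq_sum]
      rw [Finset.sum_eq_single k]
      · rw [hFκ, if_pos rfl]; ring
      · intro x _ hx
        rw [hFκ, if_neg hx, mul_zero]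
      · intro h; exact absurd (Finset.mem_univ k) h
    have h1 := wq_comb z 1 (-1) φ (fun i => ∑ k : κ, wq z φ k * F k i) j
    rw [h0, wq_sum] at h1
    have h2 : wq z 0 j = 0 := by simp [wq]
    rw [h2] at h1
    linarith
  -- card count
  have hcard : Fintype.card κ + Fintype.card Q = n := by
    have e1 : Fintype.card Q = (Finset.univ.filter fun j => b j = j).card := by
      rw [← Finset.card_univ]
      refine Finset.card_bij' (fun q _ => q.out) (fun j _ => cls j) ?_ ?_ ?_ ?_
      · intro q _; simp [hbq']
      · intro j _; simp
      · intro q _; exact hbq q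
      · intro j hj
        simpa using hj
    have e2 : Fintype.card κ = (Finset.univ.filter fun j => ¬ b j = j).card := by
      rw [Fintype.card_subtype]
    rw [e1, e2, add_comm, Finset.card_filter_add_card_filter_not]
    simp
  let e : Q ≃ Fin (Fintype.card Q) := Fintype.equivFin Q
  let B : Fin (Fintype.card Q) → Finset (Fin n) := fun k => Finset.univ.filter fun j => cls j = e.symm k
  have mB : ∀ k j, j ∈ B k ↔ cls j = e.symm k := fun k j => by simp [B]
  refine ⟨Fintype.card Q, B, ?_, ?_, ?_, ?_, by omega⟩
  · intro k
    exact ⟨(e.symm k).out, (mB k _).2 (hbq _)⟩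
  · intro k
    let o := (e.symm k).out
    have hoB : o ∈ B k := (mB k _).2 (hbq _)
    have hbo : ∀ j ∈ B k, b j = o := fun j hj => by
      have := (mB k j).1 hj
      simp only [b, this, o]
    have hoo : b o = o := hbq' _
    constructor
    · intro hli
      have hli' : LinearIndepOn ℚ (clq z) (B k : Set (Fin n)) := hli
      have hn := LinearIndepOn.notMem_span hli' (i := o) hoB
      obtain ⟨φ, h1, h2⟩ := sep _ _ hn
      apply h2
      change wq z φ o = 0
      rw [hexp]
      refine Finset.sum_eq_zero fun j _ => ?_
      by_cases hj : j.1 ∈ B k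
      · have : wq z φ j = 0 := by
          refine h1 _ (Submodule.subset_span ⟨j.1, ⟨hj, ?_⟩, rfl⟩)
          intro h
          have h' : j.1 = o := h
          exact j.2 (by rw [h', hoo])
        rw [this, zero_mul]
      · rw [hF0 j o, mul_zero]
        · intro h; exact hj (h ▸ hoB)
        · intro h
          apply hj
          rw [mB, ← hb j, ← h]
          exact (mB k o).1 hoB
    · intro C hC
      have : LinearIndepOn ℚ (clq z) (C : Set (Fin n)) := by
        rw [linearIndepOn_finset_iff]
        intro c hc
        have hpair : ∀ φ, ∑ j ∈ C, c j * wq z φ j = 0 := by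
          intro φ
          have h1 : ∀ i, ∑ j ∈ C, c j * (z i j : ℚ) = 0 := fun i => by
            have := congrFun hc i
            simpa using this
          calc ∑ j ∈ C, c j * wq z φ j = ∑ j ∈ C, ∑ i, φ i * (c j * (z i j : ℚ)) := by
                refine Finset.sum_congr rfl fun j _ => ?_
                unfold wq
                rw [Finset.mul_sum]
                exact Finset.sum_congr rfl fun i _ => by ring
            _ = ∑ i, φ i * ∑ j ∈ C, c j * (z i j : ℚ) := by
                rw [Finset.sum_comm]
                simp only [Finset.mul_sum]
            _ = 0 := by simp [h1]
        let c' : Fin n → ℚ := fun j => if j ∈ C then c j else 0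
        have hpair' : ∀ φ, ∑ j, c' j * wq z φ j = 0 := by
          intro φ
          rw [← hpair φ]
          simp only [c', ite_mul, zero_mul]
          rw [Finset.sum_ite_mem, Finset.univ_inter]
        have hrelc : ∀ j ∈ B k, (hj : b j ≠ j) → c' j + c' o * wq z (F ⟨j, hj⟩) o = 0 := by
          intro j hjB hj
          have h := hpair' (F ⟨j, hj⟩)
          have hjo : j ≠ o := fun h => hj (by rw [h, hoo])
          rw [Finset.sum_eq_add (M := ℚ) j o hjo] at h
          · rw [hF1 ⟨j, hj⟩, mul_one] at h
            exact h
          · intro x _ hx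
            rw [hF0 ⟨j, hj⟩ x hx.1, mul_zero]
            change x ≠ b j
            rw [hbo j hjB]; exact hx.2
          · simp
          · simp
        have hco : c' o = 0 := by
          obtain ⟨j0, hj0, hj0C⟩ := Finset.exists_of_ssubset hC
          have hc0 : c' j0 = 0 := by simp [c', hj0C]
          by_cases hj : b j0 = j0
          · rw [← hbo j0 hj0, hj]; exact hc0
          · have := hrelc j0 hj0 hj
            rw [hc0, zero_add] at this
            rcases mul_eq_zero.1 this with h | h
            · exact h
            · exfalso
              apply hFb ⟨j0, hj⟩
              change wq z _ (b j0) = 0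
              rw [hbo j0 hj0]; exact h
        intro j hj
        have hcj : c' j = c j := by simp [c', hj]
        rw [← hcj]
        by_cases hbj : b j = j
        · rw [← hbj, hbo j (hC.1 hj)]; exact hco
        · have := hrelc j (hC.1 hj) hbj
          rwa [hco, zero_mul, add_zero] at this
      exact this
  · intro k k' hkk
    rw [Finset.disjoint_left]
    intro j hj hj'
    rw [mB] at hj hj'
    exact hkk (e.symm.injective (hj.symm.trans hj'))
  · intro j
    exact ⟨e (cls j), by rw [mB]; simp⟩
end SecE2

end Helpers

/-- If the action is effective and the orbit space `X_z` is a topological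
manifold (locally euclidean of dimension `2n - 1 - r`), then either `r = 1` and no column
of `z` is zero (the column matroid is rank-one uniform), or the column matroid of `z` is a
direct sum of circuits. -/
theorem orbitSpace_manifold_classification (n r : ℕ) (hn : 1 ≤ n)
    (z : Fin r → Fin n → ℤ)
    (heff : Submodule.span ℤ (Set.range fun j => fun i => z i j) = ⊤)
    (hman : LocallyEuclidean (OrbitSpace z) (2 * n - 1 - r)) :
    (r = 1 ∧ ∀ j : Fin n, ∃ i : Fin r, z i j ≠ 0) ∨ IsSumOfCircuits z := by
  classical
  by_cases h2 : ∀ φ, (spq z φ).Nonempty → (∀ χ, spq z χ ⊂ spq z φ → spq z χ = ∅) → (spq z φ).card = 2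
  · exact Or.inr (sum_of_circuits z heff h2)
  left
  push Not at h2
  obtain ⟨φ, hne, hmin, hcard⟩ := h2
  by_cases hall : ∀ j, j ∈ spq z φ
  · have hcol : ∀ j : Fin n, ∃ i : Fin r, z i j ≠ 0 := by
      intro j
      by_contra hcon
      push Not at hcon
      exact (mem_spq z φ j).1 (hall j) (by simp [wq, hcon])
    refine ⟨le_antisymm ?_ ?_, hcol⟩
    · have := span_rank z ∅ φ (fun v hv => by
        have h := hyper z heff φ hne hmin v hv
        have he : {j | j ∉ spq z φ} = ((∅ : Finset (Fin n)) : Set (Fin n)) := by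
          ext j; simp [hall j]
        rwa [he] at h)
      simpa using this
    · obtain ⟨i, -⟩ := hcol ⟨0, hn⟩
      exact Nat.one_le_iff_ne_zero.2 (fun h => by subst h; exact i.elim0)
  · exfalso
    push Not at hall
    obtain ⟨h0, hh0⟩ := hall
    have hpos := Finset.card_pos.2 hne
    rcases (by omega : (spq z φ).card = 1 ∨ 3 ≤ (spq z φ).card) with h1 | h3
    · obtain ⟨j0, hj0⟩ := Finset.card_eq_one.1 h1
      obtain ⟨N, hN, ℓ, hℓ⟩ := clear_den φ
      have hN' : (N : ℚ) ≠ 0 := by exact_mod_cast hN.ne'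
      have hdot : ∀ j, ((∑ i, ℓ i * z i j : ℤ) : ℚ) = N * wq z φ j := by
        intro j
        unfold wq
        push_cast
        rw [Finset.mul_sum]
        exact Finset.sum_congr rfl fun i _ => by rw [hℓ]; ring
      have hiff : ∀ j, ∑ i, ℓ i * z i j ≠ 0 ↔ j = j0 := by
        intro j
        rw [← Int.cast_ne_zero (α := ℚ), hdot, mul_ne_zero_iff, ← mem_spq, hj0, Finset.mem_singleton]
        exact ⟨fun h => h.2, fun h => ⟨hN', h⟩⟩
      refine case_one z hman ℓ j0 h0 ?_ ((hiff j0).2 rfl) (fun j hj => ?_)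
      · rintro rfl; exact hh0 (by rw [hj0]; simp)
      · by_contra h; exact hj ((hiff j).1 h)
    · exact case_three z heff hman φ h3 hmin h0 hh0
end
end
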